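/- Let s ∈ (0,1) be irrational. Then the limit set Λ̂_s is a perfect set: every point p ∈ Λ̂_s is an accumulation point of Λ̂_s \ {p}. -/

import Mathlib

noncomputable section

open Set Topology Filter

/-- The parallelogram `X_s = F₁(s)`, centered at the origin and spanned by the
vectors `(2,0)` and `(2s,2s)`. -/
def F1 (s : ℝ) : Set (ℝ × ℝ) :=
  {p | ∃ a b : ℝ, a ∈ Icc (-(1:ℝ)/2) (1/2) ∧ b ∈ Icc (-(1:ℝ)/2) (1/2) ∧
    p = (2 * a + 2 * s * b, 2 * s * b)}

/-- Rotation by `π/2` about the origin. -/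
def rotQ (p : ℝ × ℝ) : ℝ × ℝ := (-p.2, p.1)

/-- `F₂(s)`, the image of `F₁(s)` under rotation by `π/2` about the origin. -/
def F2 (s : ℝ) : Set (ℝ × ℝ) := rotQ '' F1 s

/-- The lattice `L₁` generated by `(0,2)` and `(2s,2s)`. -/
def L1 (s : ℝ) : Set (ℝ × ℝ) :=
  {v | ∃ m n : ℤ, v = (2 * s * n, 2 * m + 2 * s * n)}

/-- The lattice `L₂` generated by `(2,0)` and `(2s,−2s)`. -/
def L2 (s : ℝ) : Set (ℝ × ℝ) :=
  {v | ∃ m n : ℤ, v = (2 * m + 2 * s * n, -(2 * s * n))}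

/-- `F_j` indexed by `Fin 2` (index `0` is `F₁`, index `1` is `F₂`). -/
def FF (s : ℝ) : Fin 2 → Set (ℝ × ℝ) := fun j => if j = 0 then F1 s else F2 s

/-- `L_j` indexed by `Fin 2` (index `0` is `L₁`, index `1` is `L₂`). -/
def LL (s : ℝ) : Fin 2 → Set (ℝ × ℝ) := fun j => if j = 0 then L1 s else L2 s

/-- One application of the map `f′`, as a relation: `StepRel s p q` holds iff `p ∈ F_j`
for some `j`, there is a unique `v ∈ L_{3−j}` with `p + v ∈ F_{3−j}`, and `q = p + v`
(i.e. `q − p ∈ L_{3−j}` and `q ∈ F_{3−j}`).  `f′` is undefined where the translation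
is not unique. -/
def StepRel (s : ℝ) (p q : ℝ × ℝ) : Prop :=
  ∃ j : Fin 2, p ∈ FF s j ∧ (∃! v, v ∈ LL s (j + 1) ∧ p + v ∈ FF s (j + 1)) ∧
    q - p ∈ LL s (j + 1) ∧ q ∈ FF s (j + 1)

/-- The octagonal PET map `f_s = (f′)²`, as a relation. -/
def MapRel (s : ℝ) (p q : ℝ × ℝ) : Prop := ∃ r, StepRel s p r ∧ StepRel s r q

/-- `n`-fold iteration of the (partially defined) map `f_s`, as a relation. -/
def IterRel (s : ℝ) : ℕ → ℝ × ℝ → ℝ × ℝ → Prop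
  | 0, p, q => p = q
  | n + 1, p, q => ∃ r, IterRel s n p r ∧ MapRel s r q

/-- A convex polygon: the convex hull of a finite set of points, with nonempty interior. -/
def IsConvexPolygon (P : Set (ℝ × ℝ)) : Prop :=
  (∃ V : Finset (ℝ × ℝ), P = convexHull ℝ (V : Set (ℝ × ℝ))) ∧ (interior P).Nonempty

/-- A periodic tile of `(X_s, f_s)`: a maximal convex polygon in `X_s` on whose interior
`f_s` and all its iterates are defined and periodic. -/
def IsPeriodicTile (s : ℝ) (P : Set (ℝ × ℝ)) : Prop :=
  IsConvexPolygon P ∧ P ⊆ F1 s ∧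
    (∃ n, 0 < n ∧ ∀ p ∈ interior P, IterRel s n p p) ∧
    ∀ Q, IsConvexPolygon Q → Q ⊆ F1 s →
      (∃ n, 0 < n ∧ ∀ p ∈ interior Q, IterRel s n p p) → P ⊆ Q → P = Q

/-- The tiling `Δ_s`: the collection of all periodic tiles. -/
def tiles (s : ℝ) : Set (Set (ℝ × ℝ)) := {P | IsPeriodicTile s P}

/-- The limit set `Λ̂_s`: points of `X_s` every neighborhood of which meets infinitely
many tiles of `Δ_s`. -/
def limitSet (s : ℝ) : Set (ℝ × ℝ) :=
  {p | p ∈ F1 s ∧ ∀ U ∈ 𝓝 p, {P ∈ tiles s | (U ∩ P).Nonempty}.Infinite}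

/-- The renormalization map `R`. -/
def Rmap (x : ℝ) : ℝ :=
  if x < 1 / 2 then 1 / (2 * x) - (⌊1 / (2 * x)⌋ : ℤ) else 1 - x

/-- The central tiles of `Δ_s`: for `s > 1/2` the single octagon `F₁ ∩ F₂`; for
`s ≤ 1/2` the squares of the grid generated by the square `F₁ ∩ F₂` that lie in `X_s`. -/
def centralTiles (s : ℝ) : Set (Set (ℝ × ℝ)) :=
  if 1 / 2 < s then {F1 s ∩ F2 s}
  else {T | (∃ m n : ℤ,
        T = (fun p : ℝ × ℝ => (p.1 + 2 * s * m, p.2 + 2 * s * n)) '' (F1 s ∩ F2 s)) ∧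
      T ⊆ F1 s}

/-- The portion of a set `S ⊆ X_s` lying to the left of the central tiles of `Δ_s`
(the closure of the set of points of `S` lying strictly to the left of every point of
every central tile). -/
def leftPart (s : ℝ) (S : Set (ℝ × ℝ)) : Set (ℝ × ℝ) :=
  closure {p ∈ S | ∀ T ∈ centralTiles s, ∀ q ∈ T, p.1 < q.1}

/-- `X_s⁰`, the left half of `X_s`. -/
def Xzero (s : ℝ) : Set (ℝ × ℝ) := leftPart s (F1 s)

/-- `S_s = Λ̂_s ∩ X_s⁰`, the left half of the limit set. -/
def leftLimitSet (s : ℝ) : Set (ℝ × ℝ) := limitSet s ∩ Xzero s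

/-- Dot product in the plane. -/
def dot2 (v w : ℝ × ℝ) : ℝ := v.1 * w.1 + v.2 * w.2

/-- Cross product (signed area form) in the plane. -/
def cross2 (v w : ℝ × ℝ) : ℝ := v.1 * w.2 - v.2 * w.1

/-- The Euclidean distance on `ℝ × ℝ`. -/
def eudist (p q : ℝ × ℝ) : ℝ := Real.sqrt ((p.1 - q.1) ^ 2 + (p.2 - q.2) ^ 2)

/-- A (solid) square in the plane. -/
def IsSquareSet (P : Set (ℝ × ℝ)) : Prop :=
  ∃ p v w : ℝ × ℝ, dot2 v w = 0 ∧ dot2 v v = dot2 w w ∧ v ≠ 0 ∧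
    P = {q | ∃ a b : ℝ, a ∈ Icc (0:ℝ) 1 ∧ b ∈ Icc (0:ℝ) 1 ∧ q = p + a • v + b • w}

/-- Rotation by `π/4` about the origin. -/
def rot45 (v : ℝ × ℝ) : ℝ × ℝ :=
  ((v.1 - v.2) / Real.sqrt 2, (v.1 + v.2) / Real.sqrt 2)

/-- A (solid) semi-regular octagon: a convex octagon whose interior angles all equal
`3π/4` (so consecutive edge directions differ by rotation by `π/4`) and whose side
lengths alternate between two values `a` and `b`. -/
def IsSemiregularOctagon (P : Set (ℝ × ℝ)) : Prop :=
  ∃ (p u : ℝ × ℝ) (a b : ℝ), dot2 u u = 1 ∧ 0 < a ∧ 0 < b ∧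
    P = convexHull ℝ (Set.range fun k : Fin 8 =>
      p + ∑ i ∈ Finset.range k.1, (if Even i then a else b) • rot45^[i] u)

/-- A box: a square with sides parallel to the coordinate axes. -/
def IsBox (P : Set (ℝ × ℝ)) : Prop :=
  ∃ (p : ℝ × ℝ) (c : ℝ), 0 < c ∧ P = Icc p (p + (c, c))

/-- A diamond: a square whose sides have slope `±1`. -/
def IsDiamond (P : Set (ℝ × ℝ)) : Prop :=
  ∃ (p : ℝ × ℝ) (c : ℝ), 0 < c ∧
    P = convexHull ℝ {p + (c, 0), p - (c, 0), p + (0, c), p - (0, c)}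

/-- The horizontal fundamental line of symmetry `H : y = 0`. -/
def lineH : Set (ℝ × ℝ) := {p | p.2 = 0}

/-- The vertical fundamental line of symmetry `V : x = −1`. -/
def lineV : Set (ℝ × ℝ) := {p | p.1 = -1}

/-- The fundamental line of symmetry `D_s`, of slope `−1` through `(−s,−s)`. -/
def lineD (s : ℝ) : Set (ℝ × ℝ) := {p | p.1 + p.2 = -2 * s}

/-- The fundamental line of symmetry `E_s`: for `s ≤ 1/2` the line of slope `−1`
through `(−3s,−3s)`, for `s > 1/2` the line of slope `1` through `(−s,−s)`. -/
def lineE (s : ℝ) : Set (ℝ × ℝ) :=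
  if s ≤ 1 / 2 then {p | p.1 + p.2 = -6 * s} else {p | p.2 = p.1}

/-- The first piecewise reflection of the trapezoid. -/
def rhoF (p : ℝ × ℝ) : ℝ × ℝ := if p.1 + p.2 < 1 then (1 - p.1, p.2) else (p.1, 1 - p.2)

/-- The second piecewise reflection of the trapezoid. -/
def sigF (t : ℝ) (p : ℝ × ℝ) : ℝ × ℝ :=
  if p.1 < t then (t - p.2, t - p.1) else (1 + t - p.2, 1 + t - p.1)

/-- Points of the open trapezoid off the discontinuity lines. -/
def Reg (t : ℝ) (p : ℝ × ℝ) : Prop :=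
  0 < p.2 ∧ p.2 < 1 ∧ p.2 < p.1 ∧ p.1 < 1 + t ∧ p.1 + p.2 ≠ 1 ∧ p.1 ≠ t

/-- Points of the trapezoid with a finite, everywhere defined orbit. -/
def Per (t : ℝ) : Set (ℝ × ℝ) :=
  {p | ∃ S : Set (ℝ × ℝ), S.Finite ∧ p ∈ S ∧ ∀ x ∈ S, Reg t x ∧ rhoF x ∈ S ∧ sigF t x ∈ S}

/-- The piecewise reflection of the triangle. -/
def sigQ (u : ℝ) (p : ℝ × ℝ) : ℝ × ℝ :=
  if p.1 < u then (u - p.2, u - p.1)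
  else if p.1 - p.2 < 2 * u then (p.2 + u, p.1 - u) else (1 + 2 * u - p.1, p.2)

/-- Points of the open triangle off the discontinuity lines. -/
def RegQ (u : ℝ) (p : ℝ × ℝ) : Prop :=
  0 < p.2 ∧ p.2 < p.1 ∧ p.1 + p.2 < 1 ∧ p.1 ≠ u ∧ p.1 - p.2 ≠ 2 * u

/-- Points of the triangle with a finite, everywhere defined orbit. -/
def PerQ (u : ℝ) : Set (ℝ × ℝ) :=
  {p | ∃ S : Set (ℝ × ℝ), S.Finite ∧ p ∈ S ∧
    ∀ x ∈ S, RegQ u x ∧ (1 - x.1, x.2) ∈ S ∧ sigQ u x ∈ S}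

theorem rhoF_lt {x y : ℝ} (h : x + y < 1) : rhoF (x, y) = (1 - x, y) := if_pos h
theorem rhoF_gt {x y : ℝ} (h : 1 < x + y) : rhoF (x, y) = (x, 1 - y) := if_neg h.not_gt
theorem sigF_lt {t x y : ℝ} (h : x < t) : sigF t (x, y) = (t - y, t - x) := if_pos h
theorem sigF_gt {t x y : ℝ} (h : t < x) : sigF t (x, y) = (1 + t - y, 1 + t - x) :=
  if_neg h.not_gt
theorem sigQ_fst {u x y : ℝ} (h : x < u) : sigQ u (x, y) = (u - y, u - x) := if_pos h
theorem sigQ_snd {u x y : ℝ} (h : u < x) (h' : x - y < 2 * u) :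
    sigQ u (x, y) = (y + u, x - u) := by
  simp only [sigQ, if_neg h.not_gt, if_pos h']
theorem sigQ_trd {u x y : ℝ} (h : u < x) (h' : 2 * u < x - y) :
    sigQ u (x, y) = (1 + 2 * u - x, y) := by
  simp only [sigQ, if_neg h.not_gt, if_neg h'.not_gt]

theorem mem_of_eq {S : Set (ℝ × ℝ)} {a b c d : ℝ} (h : (a, b) ∈ S) (h1 : c = a) (h2 : d = b) :
    (c, d) ∈ S := by subst h1 h2; exact h

theorem perQ_iff_of_lt {t : ℝ} (h0 : 0 < t) (h1 : t < 1 / 2) (p : ℝ × ℝ) :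
    p ∈ PerQ t ↔ p ∈ Per t ∧ p.1 + p.2 < 1 := by
  constructor
  · rintro ⟨S, hf, hp, hS⟩
    refine ⟨⟨S ∪ (fun z : ℝ × ℝ => (1 + t - z.2, 1 + t - z.1)) '' {z ∈ S | t < z.1} ∪
      (fun z : ℝ × ℝ => (1 + t - z.2, z.1 - t)) '' {z ∈ S | t < z.1}, ?_, ?_, ?_⟩, (hS p hp).1.2.2.1⟩
    · exact (hf.union ((hf.subset (sep_subset _ _)).image _)).union
        ((hf.subset (sep_subset _ _)).image _)
    · exact Or.inl (Or.inl hp)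
    · rintro _ ((hz | ⟨⟨x, y⟩, ⟨hz, htx⟩, rfl⟩) | ⟨⟨x, y⟩, ⟨hz, htx⟩, rfl⟩)
      · rename_i w
        obtain ⟨x, y⟩ := w
        obtain ⟨⟨a1, a2, a3, a4, a5⟩, b, c⟩ := hS _ hz
        dsimp only at *
        refine ⟨⟨a1, by dsimp only; linarith, a2, by dsimp only; linarith, a3.ne, a4⟩, ?_, ?_⟩
        · rw [rhoF_lt a3]; exact Or.inl (Or.inl b)
        · rcases lt_or_gt_of_ne a4 with h | h
          · rw [sigF_lt h]; rw [sigQ_fst h] at c; exact Or.inl (Or.inl c)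
          · rw [sigF_gt h]; exact Or.inl (Or.inr ⟨_, ⟨hz, h⟩, rfl⟩)
      · obtain ⟨⟨a1, a2, a3, a4, a5⟩, b, c⟩ := hS _ hz
        dsimp only at *
        refine ⟨⟨by dsimp only; linarith, by dsimp only; linarith, by dsimp only; linarith,
          by dsimp only; linarith, fun h => by dsimp only at h; linarith,
          fun h => by dsimp only at h; linarith⟩, ?_, ?_⟩
        · rw [rhoF_gt (by linarith)]
          exact Or.inr ⟨_, ⟨hz, htx⟩, by ext <;> dsimp only; ring⟩
        · rw [sigF_gt (by linarith)]
          exact Or.inl (Or.inl (mem_of_eq hz (by ring) (by ring)))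
      · obtain ⟨⟨a1, a2, a3, a4, a5⟩, b, c⟩ := hS _ hz
        dsimp only at *
        refine ⟨⟨by dsimp only; linarith, by dsimp only; linarith, by dsimp only; linarith,
          by dsimp only; linarith, fun h => a5 (by dsimp only at h; linarith),
          fun h => by dsimp only at h; linarith⟩, ?_, ?_⟩
        · rw [rhoF_gt (by linarith)]
          exact Or.inl (Or.inr ⟨_, ⟨hz, htx⟩, by ext <;> dsimp only <;> ring⟩)
        · rw [sigF_gt (by linarith)]
          rcases lt_or_gt_of_ne a5 with h | h
          · rw [sigQ_snd htx h] at c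
            exact Or.inr ⟨_, ⟨c, by dsimp only; linarith⟩, by ext <;> dsimp only <;> ring⟩
          · rw [sigQ_trd htx h] at c
            exact Or.inl (Or.inl (mem_of_eq c (by ring) (by ring)))
  · rintro ⟨⟨S, hf, hp, hS⟩, hpl⟩
    refine ⟨{z ∈ S | z.1 + z.2 < 1}, hf.subset (sep_subset _ _), ⟨hp, hpl⟩, ?_⟩
    rintro ⟨x, y⟩ ⟨hz, hl⟩
    obtain ⟨⟨a1, a2, a3, a4, a5, a6⟩, b, c⟩ := hS _ hz
    dsimp only at *
    rw [rhoF_lt hl] at b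
    have key : t < x → x - y ≠ 2 * t ∧ (1 + 2 * t - x, y) ∈ S := by
      intro h
      rw [sigF_gt h] at c
      have e := (hS _ c).2.1
      rw [rhoF_gt (by linarith)] at e
      have e2 := (hS _ e).2.2
      rw [sigF_gt (by linarith)] at e2
      refine ⟨fun h2 => (hS _ e2).1.2.2.2.2.1 (by dsimp only; linarith),
        mem_of_eq e2 (by ring) (by ring)⟩
    refine ⟨⟨a1, a3, hl, a6, ?_⟩, ⟨b, by dsimp only; linarith⟩, ?_⟩
    · rcases lt_or_gt_of_ne a6 with h | h
      · intro h'; dsimp only at h'; linarith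
      · exact (key h).1
    · rcases lt_or_gt_of_ne a6 with h | h
      · rw [sigF_lt h] at c; rw [sigQ_fst h]
        exact ⟨c, by dsimp only; linarith⟩
      · obtain ⟨k1, k2⟩ := key h
        rcases lt_or_gt_of_ne k1 with h' | h'
        · rw [sigQ_snd h h']
          have e := (hS _ k2).2.1
          rw [rhoF_gt (by linarith)] at e
          have e2 := (hS _ e).2.2
          rw [sigF_gt (by linarith)] at e2
          exact ⟨mem_of_eq e2 (by ring) (by ring), by dsimp only; linarith⟩
        · rw [sigQ_trd h h']
          exact ⟨k2, by dsimp only; linarith⟩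

theorem perQ_iff_of_gt {t : ℝ} (h0 : 1 / 2 < t) (h1 : t < 1) (p : ℝ × ℝ) :
    p ∈ PerQ (1 - t) ↔ p ∈ Per t ∧ p.1 + p.2 < 1 := by
  constructor
  · rintro ⟨S, hf, hp, hS⟩
    let f : ℝ × ℝ → ℝ × ℝ := fun z => sigF t (1 - z.1, z.2)
    let C := {z ∈ S | z.1 < 1 - t ∨ 2 * (1 - t) < z.1 - z.2}
    have hC : (C : Set (ℝ × ℝ)).Finite := hf.subset (sep_subset _ _)
    refine ⟨⟨S ∪ f '' C ∪ (fun z => ((f z).1, 1 - (f z).2)) '' C, ?_, Or.inl (Or.inl hp), ?_⟩,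
      (hS p hp).1.2.2.1⟩
    · exact (hf.union (hC.image _)).union (hC.image _)
    · have fK : ∀ x y, x < 1 - t → f (x, y) = (1 + t - y, t + x) := by
        intro x y h
        simp only [f]
        rw [sigF_gt (by linarith)]; ext <;> dsimp only <;> ring
      have fR : ∀ x y, 1 - t < x → f (x, y) = (t - y, t - 1 + x) := by
        intro x y h
        simp only [f]
        rw [sigF_lt (by linarith)]; ext <;> dsimp only; ring
      rintro w ((hz | ⟨⟨x, y⟩, ⟨hz, htx⟩, rfl⟩) | ⟨⟨x, y⟩, ⟨hz, htx⟩, rfl⟩)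
      · obtain ⟨x, y⟩ := w
        obtain ⟨⟨a1, a2, a3, a4, a5⟩, b, c⟩ := hS _ hz
        obtain ⟨⟨b1, b2, b3, b4, b5⟩, b', b''⟩ := hS _ b
        dsimp only at *
        refine ⟨⟨a1, by dsimp only; linarith, a2, by dsimp only; linarith, a3.ne,
          fun h => b4 (by dsimp only at h; linarith)⟩, ?_, ?_⟩
        · rw [rhoF_lt a3]; exact Or.inl (Or.inl b)
        · have e : sigF t (x, y) = f (1 - x, y) := by simp [f]
          rw [e]
          by_cases hw : 1 - x < 1 - t ∨ 2 * (1 - t) < 1 - x - y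
          · exact Or.inl (Or.inr ⟨_, ⟨b, hw⟩, rfl⟩)
          · rw [not_or, not_lt, not_lt] at hw
            have k1 := lt_of_le_of_ne hw.1 (Ne.symm b4)
            have k2 := lt_of_le_of_ne hw.2 b5
            rw [fR _ _ k1]
            rw [sigQ_snd k1 k2] at b''
            exact Or.inl (Or.inl (mem_of_eq (hS _ b'').2.1 (by dsimp only; ring)
              (by dsimp only; ring)))
      · obtain ⟨⟨a1, a2, a3, a4, a5⟩, b, c⟩ := hS _ hz
        dsimp only at *
        rcases htx with h | h
        · have e := fK x y h
          refine ⟨?_, Or.inr ⟨_, ⟨hz, Or.inl h⟩, ?_⟩, ?_⟩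
          · rw [e]
            refine ⟨by dsimp only; linarith, by dsimp only; linarith, by dsimp only; linarith,
              by dsimp only; linarith, fun h => by dsimp only at h; linarith,
              fun h => by dsimp only at h; linarith⟩
          · rw [e, rhoF_gt (by linarith)]; dsimp only; rw [e]
          · rw [e, sigF_gt (by linarith)]
            exact Or.inl (Or.inl (mem_of_eq b (by ring) (by ring)))
        · have e := fR x y (by linarith)
          refine ⟨?_, Or.inr ⟨_, ⟨hz, Or.inr h⟩, ?_⟩, ?_⟩
          · rw [e]
            refine ⟨by dsimp only; linarith, by dsimp only; linarith, by dsimp only; linarith,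
              by dsimp only; linarith, fun h => by dsimp only at h; linarith,
              fun h => by dsimp only at h; linarith⟩
          · rw [e, rhoF_gt (by linarith)]; dsimp only; rw [e]
          · rw [e, sigF_lt (by linarith)]
            exact Or.inl (Or.inl (mem_of_eq b (by ring) (by ring)))
      · obtain ⟨⟨a1, a2, a3, a4, a5⟩, b, c⟩ := hS _ hz
        dsimp only at *
        rcases htx with h | h
        · have e := fK x y h
          refine ⟨?_, Or.inl (Or.inr ⟨_, ⟨hz, Or.inl h⟩, ?_⟩), ?_⟩
          · rw [e]
            refine ⟨by dsimp only; linarith, by dsimp only; linarith, by dsimp only; linarith,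
              by dsimp only; linarith, fun h => by dsimp only at h; linarith,
              fun h => by dsimp only at h; linarith⟩
          · rw [e, rhoF_gt (by linarith)]; simp
          · rw [sigQ_fst h] at c
            have e' := fK (1 - t - y) (1 - t - x) (by linarith)
            refine Or.inr ⟨_, ⟨c, Or.inl (by dsimp only; linarith)⟩, ?_⟩
            rw [e, sigF_gt (by linarith)]; dsimp only; rw [e']; ext <;> dsimp only <;> ring
        · have e := fR x y (by linarith)
          refine ⟨?_, Or.inl (Or.inr ⟨_, ⟨hz, Or.inr h⟩, ?_⟩), ?_⟩
          · rw [e]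
            refine ⟨by dsimp only; linarith, by dsimp only; linarith, by dsimp only; linarith,
              by dsimp only; linarith, fun h => by dsimp only at h; linarith,
              fun h => by dsimp only at h; linarith⟩
          · rw [e, rhoF_gt (by linarith)]; simp
          · rw [sigQ_trd (by linarith) h] at c
            rw [e, sigF_lt (by linarith)]
            exact Or.inl (Or.inl (mem_of_eq (hS _ c).2.1 (by dsimp only; ring)
              (by dsimp only; ring)))
  · rintro ⟨⟨S, hf, hp, hS⟩, hpl⟩
    refine ⟨{z ∈ S | z.1 + z.2 < 1}, hf.subset (sep_subset _ _), ⟨hp, hpl⟩, ?_⟩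
    rintro ⟨x, y⟩ ⟨hz, hl⟩
    obtain ⟨⟨a1, a2, a3, a4, a5, a6⟩, b, c⟩ := hS _ hz
    dsimp only at *
    rw [rhoF_lt hl] at b
    obtain ⟨⟨b1, b2, b3, b4, b5, b6⟩, -, b8⟩ := hS _ b
    dsimp only at *
    have hx : x ≠ 1 - t := fun h => b6 (by linarith)
    rcases lt_or_gt_of_ne hx with h | h
    · rw [sigF_gt (by linarith)] at b8
      have e1 := (hS _ b8).2.1
      rw [rhoF_gt (by linarith)] at e1
      have e2 := (hS _ e1).2.2
      rw [sigF_gt (by linarith)] at e2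
      have e3 := (hS _ e2).2.1
      rw [rhoF_gt (by linarith)] at e3
      have e4 := (hS _ e3).2.2
      rw [sigF_gt (by linarith)] at e4
      have e5 := (hS _ e4).2.1
      rw [rhoF_lt (by linarith)] at e5
      rw [sigQ_fst h]
      refine ⟨⟨a1, a3, hl, hx, fun h => by dsimp only at h; linarith⟩,
        ⟨b, by dsimp only; linarith⟩, mem_of_eq e5 (by ring) (by ring), by dsimp only; linarith⟩
    · rw [sigF_lt (by linarith)] at b8
      have hne : x - y ≠ 2 * (1 - t) :=
        fun h => (hS _ b8).1.2.2.2.2.1 (by dsimp only; linarith)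
      refine ⟨⟨a1, a3, hl, hx, hne⟩, ⟨b, by dsimp only; linarith⟩, ?_⟩
      have e1 := (hS _ b8).2.1
      rcases lt_or_gt_of_ne hne with h' | h'
      · rw [rhoF_lt (by linarith)] at e1
        rw [sigQ_snd h h']
        exact ⟨mem_of_eq e1 (by ring) (by ring), by dsimp only; linarith⟩
      · rw [rhoF_gt (by linarith)] at e1
        have e2 := (hS _ e1).2.2
        rw [sigF_lt (by linarith)] at e2
        have e3 := (hS _ e2).2.1
        rw [rhoF_lt (by linarith)] at e3
        rw [sigQ_trd h h']
        exact ⟨mem_of_eq e3 (by ring) (by ring), by dsimp only; linarith⟩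

/-- The similarity conjugating a trapezoid system to a first return map of the triangle. -/
def psi (u : ℝ) (p : ℝ × ℝ) : ℝ × ℝ := (u * (p.1 + p.2), u * (p.1 - p.2))

theorem psi_injective {u : ℝ} (h0 : 0 < u) : Function.Injective (psi u) := by
  rintro ⟨a, b⟩ ⟨c, d⟩ h
  simp only [psi, Prod.mk.injEq, mul_eq_mul_left_iff, h0.ne', or_false] at h
  ext <;> dsimp only <;> linarith [h.1, h.2]

theorem psi_mem_perQ {u t : ℝ} {k : ℕ} (h0 : 0 < u) (ht : 0 < t) (ht1 : t < 1)
    (hk : 2 * u * (k + t) = 1) (hk1 : 1 ≤ k) {p : ℝ × ℝ} (hp : p ∈ Per t) :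
    psi u p ∈ PerQ u := by
  obtain ⟨S', hf, hp, hS⟩ := hp
  let A : Set (ℝ × ℝ) := {z | ∃ x ∈ S', ∃ j ∈ Finset.range (k + 1),
    z = ((psi u x).1 + 2 * u * (j : ℕ), (psi u x).2) ∧ z.2 < z.1 ∧ z.1 + z.2 < 1}
  have hk1' : (1 : ℝ) ≤ k := by exact_mod_cast hk1
  have hAf : A.Finite := by
    refine Set.Finite.subset ((hf.prod (Finset.range (k + 1)).finite_toSet).image
      (fun q : (ℝ × ℝ) × ℕ => ((psi u q.1).1 + 2 * u * (q.2 : ℕ), (psi u q.1).2))) ?_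
    rintro z ⟨x, hx, j, hj, e, -⟩
    exact ⟨(x, j), ⟨hx, hj⟩, e.symm⟩
  have mkA : ∀ (X Y : ℝ) (j : ℕ) (a b : ℝ), (X, Y) ∈ S' → a = u * (X + Y) + 2 * u * j →
      b = u * (X - Y) → X + j < k + t → (a, b) ∈ A := by
    intro X Y j a b hX ha hb hj
    obtain ⟨⟨r1, r2, r3, r4, r5, r6⟩, -, -⟩ := hS _ hX
    dsimp only at *
    have hj' : (j : ℝ) < (k + 1 : ℕ) := by push_cast; linarith
    refine ⟨_, hX, j, Finset.mem_range.2 (by exact_mod_cast hj'), ?_, ?_, ?_⟩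
    · rw [ha, hb]; rfl
    · dsimp only; rw [ha, hb]
      have : 0 ≤ u * j := by positivity
      nlinarith
    · dsimp only; rw [ha, hb]; nlinarith
  have hA : ∀ z ∈ A, RegQ u z ∧ (sigQ u z ∈ A ∨ (1 - (sigQ u z).1, (sigQ u z).2) ∈ A) := by
    rintro _ ⟨⟨X, Y⟩, hX, j, -, rfl, q1, q2⟩
    obtain ⟨⟨r1, r2, r3, r4, r5, r6⟩, rr, -⟩ := hS _ hX
    simp only [psi] at *
    have hXj : X + j < k + t := by
      by_contra! h
      nlinarith
    have hpos : 0 < u * (X - Y) := mul_pos h0 (by linarith)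
    rcases Nat.eq_zero_or_pos j with rfl | hj
    · simp only [Nat.cast_zero, mul_zero, add_zero] at *
      rcases lt_or_gt_of_ne r5 with h | h
      · have e1 : u * (X + Y) < u := by nlinarith
        rw [rhoF_lt h] at rr
        refine ⟨⟨hpos, q1, q2, e1.ne, ?_⟩, Or.inl ?_⟩
        · dsimp only; intro h; nlinarith
        · rw [sigQ_fst e1]
          exact mkA _ _ 0 _ _ rr (by push_cast; ring) (by ring) (by push_cast; linarith)
      · have e1 : u < u * (X + Y) := by nlinarith
        have e2 : u * (X + Y) - u * (X - Y) < 2 * u := by nlinarith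
        rw [rhoF_gt h] at rr
        refine ⟨⟨hpos, q1, q2, e1.ne', e2.ne⟩, Or.inl ?_⟩
        rw [sigQ_snd e1 e2]
        exact mkA _ _ 0 _ _ rr (by push_cast; ring) (by ring) (by push_cast; linarith)
    · have hj1 : (1 : ℝ) ≤ j := by exact_mod_cast hj
      have e2 : 2 * u < u * (X + Y) + 2 * u * j - u * (X - Y) := by nlinarith
      have e1 : u < u * (X + Y) + 2 * u * j := by nlinarith
      refine ⟨⟨hpos, q1, q2, e1.ne', e2.ne'⟩, Or.inr ?_⟩
      rw [sigQ_trd e1 e2]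
      exact mkA _ _ (j - 1) _ _ hX (by push_cast [hj]; ring) rfl
        (by push_cast [hj]; linarith)
  refine ⟨A ∪ (fun z : ℝ × ℝ => (1 - z.1, z.2)) '' A, hAf.union (hAf.image _), Or.inl ?_, ?_⟩
  · obtain ⟨X, Y⟩ := p
    obtain ⟨⟨r1, r2, r3, r4, r5, r6⟩, -⟩ := hS _ hp
    dsimp only at *
    refine mkA X Y 0 _ _ hp (by simp [psi]) rfl ?_
    push_cast; linarith
  · have fromA : ∀ z ∈ A, RegQ u z ∧ (1 - z.1, z.2) ∈ A ∪ (fun z : ℝ × ℝ => (1 - z.1, z.2)) '' A ∧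
        sigQ u z ∈ A ∪ (fun z : ℝ × ℝ => (1 - z.1, z.2)) '' A := by
      intro z hz
      obtain ⟨h1, h2⟩ := hA z hz
      refine ⟨h1, Or.inr ⟨z, hz, rfl⟩, h2.imp id fun h => ⟨_, h, ?_⟩⟩
      ext <;> simp
    rintro z (hz | ⟨z, hz, rfl⟩)
    · exact fromA z hz
    · obtain ⟨⟨X, Y⟩, hX, j, hjk, rfl, q1, q2⟩ := id hz
      obtain ⟨⟨r1, r2, r3, r4, r5, r6⟩, -, rs⟩ := hS _ hX
      simp only [psi] at *
      have hXj : X + j < k + t := by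
        by_contra! h
        nlinarith
      have hpos : 0 < u * (X - Y) := mul_pos h0 (by linarith)
      have hjk' : j ≤ k := Nat.lt_succ_iff.1 (Finset.mem_range.1 hjk)
      by_cases hj : j + 1 ≤ k ∧ X + j + 1 < k + t
      · have e2 : 2 * u < 1 - (u * (X + Y) + 2 * u * j) - u * (X - Y) := by nlinarith
        have e1 : u < 1 - (u * (X + Y) + 2 * u * j) := by linarith
        refine ⟨⟨hpos, by dsimp only; linarith, by dsimp only; linarith, e1.ne', e2.ne'⟩,
          Or.inl (by convert hz using 2; ring), Or.inl ?_⟩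
        rw [sigQ_trd e1 e2]
        exact mkA _ _ (j + 1) _ _ hX (by push_cast; ring) rfl (by push_cast; linarith)
      · refine fromA _ ?_
        rcases hjk'.eq_or_lt with rfl | hlt
        · rw [sigF_lt (by linarith)] at rs
          exact mkA _ _ 0 _ _ rs (by push_cast; linarith) (by ring) (by push_cast; linarith)
        · rcases (Nat.succ_le_of_lt hlt).eq_or_lt with h | h
          · have hjk1 : (j : ℝ) + 1 = k := by exact_mod_cast h
            have hXt : t < X := by
              refine lt_of_le_of_ne ?_ (Ne.symm r6)
              by_contra! h'
              exact hj ⟨hlt, by linarith⟩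
            rw [sigF_gt hXt] at rs
            refine mkA _ _ 0 _ _ rs ?_ (by ring) (by push_cast; linarith)
            rw [← hjk1] at hk; push_cast; linarith
          · have hjk1 : (j : ℝ) + 2 ≤ k := by exact_mod_cast h
            exact absurd ⟨hlt, by linarith⟩ hj

theorem mem_per_of_psi {u t : ℝ} {k : ℕ} (h0 : 0 < u) (ht : 0 < t) (ht1 : t < 1)
    (hk : 2 * u * (k + t) = 1) (hk1 : 1 ≤ k) {p : ℝ × ℝ} (hX : p.1 ≤ 1 + t) (hY : p.2 ≤ 1)
    (hp : psi u p ∈ PerQ u) : p ∈ Per t := by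
  obtain ⟨S, hf, hp, hS⟩ := hp
  have key : ∀ X Y, psi u (X, Y) ∈ S → X ≤ 1 + t → Y ≤ 1 →
      0 < Y ∧ Y < 1 ∧ Y < X ∧ X < 1 + t ∧ X ≠ t ∧ X + Y ≠ 1 ∧
      (X < t → psi u (t - Y, t - X) ∈ S) ∧ (t < X → psi u (1 + t - Y, 1 + t - X) ∈ S) := by
    intro X Y hz h1 h2
    obtain ⟨⟨a1, a2, a3, a4, a5⟩, b, -⟩ := hS _ hz
    simp only [psi] at *
    have hYX : Y < X := by
      by_contra! h; nlinarith
    have hY0 : 0 < Y := by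
      by_contra! h; nlinarith
    have hY1 : Y < 1 := lt_of_le_of_ne h2 (by rintro rfl; exact a5 (by ring))
    have step : ∀ j : ℕ, (1 - u * (X + Y) - 2 * u * j, u * (X - Y)) ∈ S →
        (X + j ≠ k + t - 1) ∧ (X + j < k + t - 1 →
          (1 - u * (X + Y) - 2 * u * (j + 1 : ℕ), u * (X - Y)) ∈ S) := by
      intro j hj
      obtain ⟨⟨c1, c2, c3, c4, c5⟩, -, c⟩ := hS _ hj
      dsimp only at *
      refine ⟨fun h => c5 (by nlinarith), fun h => ?_⟩
      rw [sigQ_trd (by nlinarith) (by nlinarith)] at c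
      exact mem_of_eq (hS _ c).2.1 (by push_cast; ring) rfl
    have ind : ∀ j : ℕ, X + j < k + t →
        (1 - u * (X + Y) - 2 * u * j, u * (X - Y)) ∈ S := by
      intro j
      induction j with
      | zero => intro _; exact mem_of_eq b (by push_cast; ring) rfl
      | succ j ih =>
        intro h
        push_cast at h
        exact (step j (ih (by linarith))).2 (by linarith)
    have notEq : ∀ j : ℕ, X + j ≠ k + t - 1 := fun j h => (step j (ind j (by linarith))).1 h
    have hXt : X ≠ t := by
      intro h
      refine notEq (k - 1) ?_
      push_cast [hk1]; linarith
    have hX1 : X ≠ 1 + t := by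
      intro h
      by_cases hk2 : 2 ≤ k
      · refine notEq (k - 2) ?_
        push_cast [hk2]; linarith
      · have : k = 1 := by omega
        subst this
        push_cast at hk
        nlinarith
    refine ⟨hY0, hY1, hYX, lt_of_le_of_ne h1 hX1, hXt, ?_, ?_, ?_⟩
    · intro h; rw [h] at a4; exact a4 (by ring)
    · intro h
      exact mem_of_eq (ind k (by linarith)) (by linarith) (by ring)
    · intro h
      have := lt_of_le_of_ne h1 hX1
      refine mem_of_eq (ind (k - 1) (by push_cast [hk1]; linarith)) ?_ (by ring)
      push_cast [hk1]; linarith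
  refine ⟨{x | psi u x ∈ S ∧ x.1 ≤ 1 + t ∧ x.2 ≤ 1}, ?_, ⟨hp, hX, hY⟩, ?_⟩
  · exact (hf.preimage (psi_injective h0).injOn).subset fun x hx => hx.1
  · rintro ⟨X, Y⟩ ⟨hz, h1, h2⟩
    obtain ⟨k1, k2, k3, k4, k5, k6, k7, k8⟩ := key X Y hz h1 h2
    obtain ⟨⟨a1, a2, a3, a4, a5⟩, b, c⟩ := hS _ hz
    refine ⟨⟨k1, k2, k3, k4, k6, k5⟩, ?_, ?_⟩
    · simp only [psi] at c
      rcases lt_or_gt_of_ne k6 with h | h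
      · rw [rhoF_lt h]
        rw [sigQ_fst (by nlinarith)] at c
        exact ⟨mem_of_eq c (by ring) (by ring), by dsimp only; linarith, by dsimp only; linarith⟩
      · rw [rhoF_gt h]
        rw [sigQ_snd (by nlinarith) (by nlinarith)] at c
        exact ⟨mem_of_eq c (by ring) (by ring), by dsimp only; linarith, by dsimp only; linarith⟩
    · rcases lt_or_gt_of_ne k5 with h | h
      · rw [sigF_lt h]
        exact ⟨k7 h, by dsimp only; linarith, by dsimp only; linarith⟩
      · rw [sigF_gt h]
        exact ⟨k8 h, by dsimp only; linarith, by dsimp only; linarith⟩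

theorem psi_mem_perQ_iff {u t : ℝ} {k : ℕ} (h0 : 0 < u) (ht : 0 < t) (ht1 : t < 1)
    (hk : 2 * u * (k + t) = 1) (hk1 : 1 ≤ k) {p : ℝ × ℝ} (hX : p.1 ≤ 1 + t) (hY : p.2 ≤ 1) :
    psi u p ∈ PerQ u ↔ p ∈ Per t :=
  ⟨mem_per_of_psi h0 ht ht1 hk hk1 hX hY, psi_mem_perQ h0 ht ht1 hk hk1⟩

theorem reg_of_per {t : ℝ} {p : ℝ × ℝ} (h : p ∈ Per t) : Reg t p := by
  obtain ⟨S, -, hp, hS⟩ := h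
  exact (hS p hp).1

theorem rhoF_mem_per {t : ℝ} {p : ℝ × ℝ} (h : p ∈ Per t) : rhoF p ∈ Per t := by
  obtain ⟨S, hf, hp, hS⟩ := h
  exact ⟨S, hf, (hS p hp).2.1, hS⟩

theorem sigF_mem_per {t : ℝ} {p : ℝ × ℝ} (h : p ∈ Per t) : sigF t p ∈ Per t := by
  obtain ⟨S, hf, hp, hS⟩ := h
  exact ⟨S, hf, (hS p hp).2.2, hS⟩

theorem regQ_of_perQ {t : ℝ} {p : ℝ × ℝ} (h : p ∈ PerQ t) : RegQ t p := by
  obtain ⟨S, -, hp, hS⟩ := h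
  exact (hS p hp).1

theorem rho_mem_perQ {t : ℝ} {p : ℝ × ℝ} (h : p ∈ PerQ t) : (1 - p.1, p.2) ∈ PerQ t := by
  obtain ⟨S, hf, hp, hS⟩ := h
  exact ⟨S, hf, (hS p hp).2.1, hS⟩

theorem sigQ_mem_perQ {t : ℝ} {p : ℝ × ℝ} (h : p ∈ PerQ t) : sigQ t p ∈ PerQ t := by
  obtain ⟨S, hf, hp, hS⟩ := h
  exact ⟨S, hf, (hS p hp).2.2, hS⟩

theorem perQ_shift {u x y : ℝ} (h0 : 0 < u) (h : (x, y) ∈ PerQ u) (hx : x + 2 * u + y < 1) :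
    (x + 2 * u, y) ∈ PerQ u := by
  have r := regQ_of_perQ h
  simp only [RegQ] at r
  have e := sigQ_mem_perQ (rho_mem_perQ h)
  dsimp only at e
  rw [sigQ_trd (by linarith) (by linarith)] at e
  exact mem_of_eq e (by ring) rfl

theorem perQ_unshift {u x y : ℝ} (h0 : 0 < u) (h : (x + 2 * u, y) ∈ PerQ u) (hx : y ≤ x) :
    (x, y) ∈ PerQ u := by
  obtain ⟨r1, r2, r3, r4, r5⟩ := regQ_of_perQ h
  dsimp only at *
  have e := sigQ_mem_perQ h
  rw [sigQ_trd (by linarith) (lt_of_le_of_ne (by linarith) (Ne.symm r5))] at e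
  exact mem_of_eq (rho_mem_perQ e) (by dsimp only; ring) rfl

theorem perQ_shift_iff {u x y : ℝ} (h0 : 0 < u) (hx : y ≤ x) (j : ℕ) :
    (x + 2 * u * j, y) ∈ PerQ u ↔ (x, y) ∈ PerQ u ∧ x + 2 * u * j + y < 1 := by
  induction j with
  | zero =>
    simp only [Nat.cast_zero, mul_zero, add_zero]
    exact ⟨fun h => ⟨h, (regQ_of_perQ h).2.2.1⟩, fun h => h.1⟩
  | succ j ih =>
    have e : x + 2 * u * (j + 1 : ℕ) = x + 2 * u * j + 2 * u := by push_cast; ring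
    rw [e]
    constructor
    · intro h
      have := perQ_unshift h0 h (by nlinarith [(by positivity : 0 ≤ u * j)])
      exact ⟨(ih.1 this).1, (regQ_of_perQ h).2.2.1⟩
    · rintro ⟨h1, h2⟩
      exact perQ_shift h0 (ih.2 ⟨h1, by linarith⟩) h2

/-- The similarity `psi` followed by a horizontal translation. -/
def psiJ (u : ℝ) (j : ℕ) (p : ℝ × ℝ) : ℝ × ℝ := (u * (p.1 + p.2) + 2 * u * j, u * (p.1 - p.2))

theorem psiJ_mem_perQ_iff {u t : ℝ} {k : ℕ} (h0 : 0 < u) (ht : 0 < t) (ht1 : t < 1)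
    (hk : 2 * u * (k + t) = 1) (hk1 : 1 ≤ k) {p : ℝ × ℝ} {j : ℕ} (hX : p.1 ≤ 1 + t)
    (hY0 : 0 ≤ p.2) (hY : p.2 ≤ 1) (hj : j + 1 ≤ k ∨ j = k ∧ p.1 ≤ t) :
    p ∈ Per t ↔ psiJ u j p ∈ PerQ u := by
  rw [← psi_mem_perQ_iff h0 ht ht1 hk hk1 hX hY, psiJ,
    perQ_shift_iff h0 (by nlinarith), psi, iff_self_and]
  intro h
  have r := reg_of_per ((psi_mem_perQ_iff h0 ht ht1 hk hk1 hX hY).1 h)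
  simp only [Reg] at r
  have : p.1 + j < k + t := by
    rcases hj with h' | ⟨rfl, h'⟩
    · have : (j : ℝ) + 1 ≤ k := by exact_mod_cast h'
      linarith
    · linarith [lt_of_le_of_ne h' r.2.2.2.2.2]
  nlinarith

theorem square_subset_perQ {u t : ℝ} {k i : ℕ} (h0 : 0 < u) (ht : 0 < t)
    (hk : 2 * u * (k + t) = 1) (hi : 1 ≤ i) {a b : ℝ} {j : ℕ} (hij : i + j + 1 ≤ k)
    (ha : 0 < a) (ha1 : a < 1) (hb : 0 < b) (hb1 : b < 1) :
    psiJ u j (i + t + a, b) ∈ PerQ u := by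
  let W : Set ℝ := {a, 1 - a, b, 1 - b}
  have hW : ∀ c ∈ W, 0 < c ∧ c < 1 ∧ 1 - c ∈ W := by
    rintro c (rfl | rfl | rfl | rfl) <;>
      exact ⟨by linarith, by linarith, by simp [W]⟩
  have hWf : W.Finite := by simp [W]
  let S : Set (ℝ × ℝ) := {z | ∃ c ∈ W, ∃ d ∈ W, ∃ l ∈ Finset.range k, i + l + 1 ≤ k ∧
    z = psiJ u l (i + t + c, d)}
  refine ⟨S, ?_, ⟨a, by simp [W], b, by simp [W], j, by simp; omega, hij, rfl⟩, ?_⟩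
  · refine ((hWf.prod (hWf.prod (Finset.range k).finite_toSet)).image
      (fun q : ℝ × ℝ × ℕ => psiJ u q.2.2 (i + t + q.1, q.2.1))).subset ?_
    rintro z ⟨c, hc, d, hd, l, hl, -, rfl⟩
    exact ⟨(c, d, l), ⟨hc, hd, hl⟩, rfl⟩
  · have hi' : (1 : ℝ) ≤ i := by exact_mod_cast hi
    have hrho : ∀ c ∈ W, ∀ d ∈ W, ∀ l : ℕ, i + l + 1 ≤ k →
        (1 - (psiJ u l (i + t + c, d)).1, (psiJ u l (i + t + c, d)).2) ∈ S := by
      intro c hc d hd l hl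
      refine ⟨1 - d, (hW d hd).2.2, 1 - c, (hW c hc).2.2, k - 1 - i - l, by simp; omega,
        by omega, ?_⟩
      have e : ((k - 1 - i - l : ℕ) : ℝ) = k - 1 - i - l := by
        rw [Nat.cast_sub (by omega), Nat.cast_sub (by omega), Nat.cast_sub (by omega)]; simp
      simp only [psiJ, e]
      ext
      · dsimp only; linarith
      · dsimp only; ring
    rintro _ ⟨c, hc, d, hd, l, -, hl, rfl⟩
    obtain ⟨c0, c1, c2⟩ := hW c hc
    obtain ⟨d0, d1, d2⟩ := hW d hd
    have hl' : (i : ℝ) + l + 1 ≤ k := by exact_mod_cast hl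
    have hxu : u < u * (i + t + c + d) + 2 * u * l := by
      nlinarith [(by positivity : 0 ≤ u * l)]
    refine ⟨⟨?_, ?_, ?_, ?_, ?_⟩, hrho c hc d hd l hl, ?_⟩
    · exact mul_pos h0 (by dsimp only; linarith)
    · simp only [psiJ]; nlinarith [(by positivity : 0 ≤ u * l)]
    · simp only [psiJ]; nlinarith
    · exact hxu.ne'
    · simp only [psiJ]
      intro h
      have h2 : u * (d + l - 1) = 0 := by linarith
      rcases mul_eq_zero.1 h2 with h3 | h3
      · linarith
      · rcases Nat.eq_zero_or_pos l with rfl | hl0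
        · simp at h3; linarith
        · have : (1 : ℝ) ≤ l := by exact_mod_cast hl0
          linarith
    · rcases Nat.eq_zero_or_pos l with rfl | hl0
      · have e : sigQ u (psiJ u 0 (i + t + c, d)) = psiJ u 0 (i + t + c, 1 - d) := by
          simp only [psiJ]
          rw [sigQ_snd hxu (by push_cast; nlinarith)]
          ext <;> (push_cast; ring)
        rw [e]
        exact ⟨c, hc, 1 - d, d2, 0, by simp; omega, hl, rfl⟩
      · have h1 : (1 : ℝ) ≤ l := by exact_mod_cast hl0
        have e : sigQ u (psiJ u l (i + t + c, d)) =
            (1 - (psiJ u (l - 1) (i + t + c, d)).1, (psiJ u (l - 1) (i + t + c, d)).2) := by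
          simp only [psiJ]
          rw [sigQ_trd hxu (by nlinarith)]
          ext
          · push_cast [hl0]; ring
          · rfl
        rw [e]
        exact hrho c hc d hd (l - 1) (by omega)

theorem fst_ne_of_psi_mem_perQ {u t X Y : ℝ} {k : ℕ} (h0 : 0 < u)
    (hk : 2 * u * (k + t) = 1) (h : psi u (X, Y) ∈ PerQ u) (j : ℕ) : X ≠ k + t - 1 - j := by
  intro hX
  have b := rho_mem_perQ h
  simp only [psi] at b
  have r := regQ_of_perQ b
  simp only [RegQ] at r
  have e : 1 - u * (X + Y) = (1 - u * (X + Y) - 2 * u * j) + 2 * u * j := by ring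
  rw [e, perQ_shift_iff h0 (by nlinarith)] at b
  exact (regQ_of_perQ b.1).2.2.2.2 (by dsimp only; subst hX; linarith)

theorem perQ_cover {u t : ℝ} {k : ℕ} (h0 : 0 < u) (ht : 0 < t) (ht1 : t < 1)
    (hk : 2 * u * (k + t) = 1) (hk1 : 1 ≤ k) {z : ℝ × ℝ} (hz : z ∈ PerQ u) :
    (∃ (j : ℕ) (p : ℝ × ℝ), p ∈ Per t ∧ (j + 1 ≤ k ∨ j = k ∧ p.1 < t) ∧ z = psiJ u j p) ∨
    ∃ (i j : ℕ) (a b : ℝ), 1 ≤ i ∧ i + j + 1 ≤ k ∧ 0 < a ∧ a < 1 ∧ 0 < b ∧ b < 1 ∧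
      z = psiJ u j (i + t + a, b) := by
  obtain ⟨x, y⟩ := z
  obtain ⟨r1, r2, r3, r4, r5⟩ := regQ_of_perQ hz
  dsimp only at *
  set j := ⌊(x - y) / (2 * u)⌋₊ with hj
  have hnn : 0 ≤ (x - y) / (2 * u) := by apply div_nonneg <;> linarith
  have f1 : 2 * u * j ≤ x - y := by
    have := Nat.floor_le hnn
    rw [le_div_iff₀ (by linarith)] at this; linarith
  have f2 : x - y < 2 * u * j + 2 * u := by
    have := Nat.lt_floor_add_one ((x - y) / (2 * u))
    rw [div_lt_iff₀ (by linarith)] at this; linarith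
  set X := (x + y - 2 * u * j) / (2 * u) with hX
  set Y := (x - y - 2 * u * j) / (2 * u) with hY
  have eX : 2 * u * X = x + y - 2 * u * j := by rw [hX]; field_simp
  have eY : 2 * u * Y = x - y - 2 * u * j := by rw [hY]; field_simp
  have ez : (x, y) = psiJ u j (X, Y) := by
    simp only [psiJ]; ext <;> dsimp only <;> linarith
  have hY0 : 0 ≤ Y := by
    by_contra! h; nlinarith
  have hY1 : Y < 1 := by
    by_contra! h; nlinarith
  have hXj : X + j < k + t := by
    by_contra! h; nlinarith
  have hYX : Y < X := by
    by_contra! h; nlinarith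
  have hz0 : psi u (X, Y) ∈ PerQ u := by
    rw [ez, psiJ, perQ_shift_iff h0 (by nlinarith)] at hz
    exact hz.1
  have hYpos : 0 < Y := by
    have := (regQ_of_perQ hz0).2.1
    simp only [psi] at this
    by_contra! h; nlinarith
  have hne := fst_ne_of_psi_mem_perQ h0 hk hz0
  rcases lt_or_ge X (1 + t) with hlt | hge
  · left
    refine ⟨j, (X, Y), (psi_mem_perQ_iff h0 ht ht1 hk hk1 hlt.le hY1.le).1 hz0, ?_, ez⟩
    have : j < k + 1 := by
      have : (j : ℝ) < (k + 1 : ℕ) := by push_cast; linarith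
      exact_mod_cast this
    rcases (Nat.lt_succ_iff.1 this).eq_or_lt with h | h
    · right; refine ⟨h, ?_⟩; dsimp only; rw [h] at hXj; linarith
    · left; omega
  · right
    set i := ⌊X - t⌋₊ with hi
    have g1 : (i : ℝ) ≤ X - t := Nat.floor_le (by linarith)
    have g2 : X - t < i + 1 := Nat.lt_floor_add_one _
    have hi1 : 1 ≤ i := Nat.le_floor (by push_cast; linarith)
    have hik : i + j + 1 ≤ k := by
      have : ((i + j : ℕ) : ℝ) < k := by push_cast; linarith
      have : i + j < k := by exact_mod_cast this
      omega
    refine ⟨i, j, X - t - i, Y, hi1, hik, ?_, by linarith, hYpos, hY1, ?_⟩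
    · refine lt_of_le_of_ne (by linarith) fun h => hne (k - 1 - i) ?_
      rw [Nat.cast_sub (by omega), Nat.cast_sub (by omega)]
      push_cast; linarith
    · rw [ez]; congr 2; ring

/-- The squared Euclidean norm. -/
def sqN (p : ℝ × ℝ) : ℝ := p.1 ^ 2 + p.2 ^ 2

/-- Open Euclidean discs, indexed by the squared radius. -/
def disc (p : ℝ × ℝ) (r : ℝ) : Set (ℝ × ℝ) := {x | sqN (x - p) < r}

theorem sqN_nonneg (p : ℝ × ℝ) : 0 ≤ sqN p := by unfold sqN; positivity

theorem continuous_sqN : Continuous sqN := by unfold sqN; fun_prop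

theorem isOpen_disc (p : ℝ × ℝ) (r : ℝ) : IsOpen (disc p r) :=
  isOpen_lt (continuous_sqN.comp (continuous_id.sub continuous_const)) continuous_const

theorem mem_disc_self {p : ℝ × ℝ} {r : ℝ} (hr : 0 < r) : p ∈ disc p r := by
  simp [disc, sqN, hr]

theorem disc_subset {p : ℝ × ℝ} {r r' : ℝ} (h : r ≤ r') : disc p r ⊆ disc p r' :=
  fun _ hx => lt_of_lt_of_le hx h

theorem exists_disc_subset {p : ℝ × ℝ} {U : Set (ℝ × ℝ)} (hU : U ∈ 𝓝 p) :
    ∃ r > 0, disc p r ⊆ U := by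
  obtain ⟨ε, hε, h⟩ := Metric.mem_nhds_iff.1 hU
  refine ⟨ε ^ 2, by positivity, fun x hx => h ?_⟩
  simp only [disc, sqN, mem_ofPred_eq, Prod.fst_sub, Prod.snd_sub] at hx
  rw [Metric.mem_ball, Prod.dist_eq, max_lt_iff, Real.dist_eq, Real.dist_eq]
  exact ⟨abs_lt_of_sq_lt_sq (by nlinarith [sq_nonneg (x.2 - p.2)]) hε.le,
    abs_lt_of_sq_lt_sq (by nlinarith [sq_nonneg (x.1 - p.1)]) hε.le⟩

/-- Similarities of the plane whose squared ratio is `κ`. -/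
def IsSim (κ : ℝ) (g : ℝ × ℝ → ℝ × ℝ) : Prop :=
  ∃ a c e f ε : ℝ, ε ^ 2 = 1 ∧ 0 < κ ∧ a ^ 2 + c ^ 2 = κ ∧
    ∀ p, g p = (a * p.1 - ε * c * p.2 + e, c * p.1 + ε * a * p.2 + f)

namespace IsSim

variable {κ κ' : ℝ} {g g' : ℝ × ℝ → ℝ × ℝ}

theorem pos (h : IsSim κ g) : 0 < κ := by
  obtain ⟨a, c, e, f, ε, -, h, -⟩ := h
  exact h

theorem comp (h' : IsSim κ' g') (h : IsSim κ g) : IsSim (κ' * κ) (g' ∘ g) := by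
  obtain ⟨a, c, e, f, ε, h1, h2, h3, h4⟩ := h
  obtain ⟨a', c', e', f', ε', h1', h2', h3', h4'⟩ := h'
  refine ⟨a' * a - ε' * c' * c, c' * a + ε' * a' * c, a' * e - ε' * c' * f + e',
    c' * e + ε' * a' * f + f', ε' * ε, by rw [mul_pow, h1, h1']; ring, mul_pos h2' h2, ?_, ?_⟩
  · rw [← h3, ← h3']
    linear_combination (a' ^ 2 * c ^ 2 + c' ^ 2 * c ^ 2) * h1'
  · intro p
    simp only [Function.comp_apply, h4, h4']
    ext
    · dsimp only
      linear_combination a' * ε * c * p.2 * h1'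
    · dsimp only
      linear_combination c' * ε * c * p.2 * h1'

theorem sqN_sub (h : IsSim κ g) (x y : ℝ × ℝ) : sqN (g x - g y) = κ * sqN (x - y) := by
  obtain ⟨a, c, e, f, ε, h1, h2, h3, h4⟩ := h
  simp only [sqN, h4, Prod.fst_sub, Prod.snd_sub]
  rw [← h3]
  linear_combination (a ^ 2 + c ^ 2) * (x.2 - y.2) ^ 2 * h1

theorem continuous (h : IsSim κ g) : Continuous g := by
  obtain ⟨a, c, e, f, ε, h1, h2, h3, h4⟩ := h
  rw [funext h4]
  fun_prop

theorem exists_inverse (h : IsSim κ g) :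
    ∃ g', IsSim κ⁻¹ g' ∧ Function.LeftInverse g' g ∧ Function.RightInverse g' g := by
  obtain ⟨a, c, e, f, ε, h1, h2, h3, h4⟩ := h
  refine ⟨fun q => (a / κ * (q.1 - e) + c / κ * (q.2 - f),
    -ε * c / κ * (q.1 - e) + ε * a / κ * (q.2 - f)), ⟨a / κ, -ε * c / κ,
    -(a / κ * e) - c / κ * f, ε * c / κ * e - ε * a / κ * f, ε, h1, inv_pos.2 h2, ?_, ?_⟩, ?_, ?_⟩
  · field_simp
    linear_combination h3 + c ^ 2 * h1
  · intro p
    ext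
    · dsimp only
      linear_combination (-(c / κ * p.2)) * h1
    · dsimp only; ring
  · intro p
    rw [h4]
    ext
    · dsimp only; field_simp; linear_combination p.1 * h3
    · dsimp only; field_simp; linear_combination p.2 * h3 * ε ^ 2 + κ * p.2 * h1
  · intro p
    rw [h4]
    ext
    · dsimp only; field_simp; linear_combination (p.1 - e) * h3 +
        (c ^ 2 * (p.1 - e) - a * c * (p.2 - f)) * h1
    · dsimp only; field_simp; linear_combination (p.2 - f) * h3 +
        (a ^ 2 * (p.2 - f) - a * c * (p.1 - e)) * h1

/-- A similarity as a homeomorphism. -/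
def homeo (h : IsSim κ g) : (ℝ × ℝ) ≃ₜ (ℝ × ℝ) where
  toFun := g
  invFun := h.exists_inverse.choose
  left_inv := h.exists_inverse.choose_spec.2.1
  right_inv := h.exists_inverse.choose_spec.2.2
  continuous_toFun := h.continuous
  continuous_invFun := h.exists_inverse.choose_spec.1.continuous

@[simp] theorem coe_homeo (h : IsSim κ g) : ⇑h.homeo = g := rfl

/-- Affine equations pull back to affine equations. -/
theorem exists_line (h : IsSim κ g) {A B C : ℝ} (hAB : A ≠ 0 ∨ B ≠ 0) :
    ∃ A' B' C' : ℝ, (A' ≠ 0 ∨ B' ≠ 0) ∧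
      ∀ p : ℝ × ℝ, A' * p.1 + B' * p.2 + C' = A * (g p).1 + B * (g p).2 + C := by
  obtain ⟨a, c, e, f, ε, h1, h2, h3, h4⟩ := h
  refine ⟨A * a + B * c, ε * (B * a - A * c), A * e + B * f + C, ?_, fun p => ?_⟩
  · by_contra! hh
    have k2 : B * a - A * c = 0 := by
      have : ε * (ε * (B * a - A * c)) = 0 := by rw [hh.2, mul_zero]
      linear_combination this - (B * a - A * c) * h1
    have k3 : (A ^ 2 + B ^ 2) * κ = 0 := by
      rw [← h3]
      linear_combination (A * a + B * c) * hh.1 + (B * a - A * c) * k2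
    rcases mul_eq_zero.1 k3 with k | k
    · rcases hAB with k' | k' <;> (apply k'; nlinarith)
    · exact h2.ne' k
  · rw [h4]; dsimp only; ring

end IsSim

/-- Every disc about `p` meets infinitely many components of `W` inside `D`. -/
def MeetsAt (W D : Set (ℝ × ℝ)) (p : ℝ × ℝ) : Prop :=
  ∀ r > 0, (connectedComponentIn W '' (W ∩ D ∩ disc p r)).Infinite

/-- Every disc about `q` contains infinitely many components of `W` that lie in `D`. -/
def SmallAt (W D : Set (ℝ × ℝ)) (q : ℝ × ℝ) : Prop :=
  ∀ r > 0, {N | ∃ x ∈ W, N = connectedComponentIn W x ∧ N ⊆ D ∩ disc q r}.Infinite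

theorem SmallAt.mono {W D D' : Set (ℝ × ℝ)} {q : ℝ × ℝ} (h : SmallAt W D q) {r : ℝ} (hr : 0 < r)
    (hD : D ∩ disc q r ⊆ D') : SmallAt W D' q := by
  intro r' hr'
  refine (h (min r r') (lt_min hr hr')).mono ?_
  rintro N ⟨x, hx, rfl, hN⟩
  exact ⟨x, hx, rfl, fun y hy => ⟨hD ⟨(hN hy).1, disc_subset (min_le_left _ _) (hN hy).2⟩,
    disc_subset (min_le_right _ _) (hN hy).2⟩⟩

theorem SmallAt.mono_left {W D D' : Set (ℝ × ℝ)} {q : ℝ × ℝ} (h : SmallAt W D q)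
    (hD : D ⊆ D') : SmallAt W D' q :=
  h.mono one_pos fun _ hx => hD hx.1

theorem SmallAt.meetsAt {W D : Set (ℝ × ℝ)} {q : ℝ × ℝ} (h : SmallAt W D q) : MeetsAt W D q := by
  intro r hr
  refine (h r hr).mono ?_
  rintro N ⟨x, hx, rfl, hN⟩
  have := hN (mem_connectedComponentIn hx)
  exact ⟨x, ⟨⟨hx, this.1⟩, this.2⟩, rfl⟩

theorem MeetsAt.mem_closure {W D : Set (ℝ × ℝ)} {q : ℝ × ℝ} (h : MeetsAt W D q) :
    q ∈ closure D := by
  rw [mem_closure_iff_nhds]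
  intro U hU
  obtain ⟨r, hr, hrU⟩ := exists_disc_subset hU
  obtain ⟨_, x, ⟨⟨-, hxD⟩, hxr⟩, -⟩ := (h r hr).nonempty
  exact ⟨x, hrU hxr, hxD⟩

theorem MeetsAt.nonempty {W D : Set (ℝ × ℝ)} {q : ℝ × ℝ} (h : MeetsAt W D q) : D.Nonempty :=
  closure_nonempty_iff.1 ⟨q, h.mem_closure⟩

theorem MeetsAt.pigeonhole {W D : Set (ℝ × ℝ)} {p : ℝ × ℝ} (h : MeetsAt W D p)
    {T E : Set (Set (ℝ × ℝ))} (hT : T.Finite) (hE : E.Finite)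
    (hTc : ∀ A ∈ T, IsPreconnected A ∧ A ⊆ W) (hc : W ∩ D ⊆ ⋃₀ T ∪ ⋃₀ E) :
    ∃ A ∈ E, MeetsAt W A p := by
  by_contra! hcon
  simp only [MeetsAt, not_forall, Set.not_infinite] at hcon
  choose! r hr hfin using hcon
  obtain ⟨R, hR, hRle⟩ : ∃ R > 0, ∀ A ∈ E, R ≤ r A := by
    rcases E.eq_empty_or_nonempty with rfl | hne
    · exact ⟨1, one_pos, by simp⟩
    · obtain ⟨A, hA, hmin⟩ := hE.exists_minimalFor r E hne
      refine ⟨r A, hr A hA, fun B hB => ?_⟩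
      rcases le_total (r A) (r B) with h | h
      · exact h
      · exact hmin hB h
  refine h R hR (Set.Finite.subset ((hE.biUnion hfin).union
    (hT.biUnion fun A hA => (?_ : (connectedComponentIn W '' A).Finite))) ?_)
  · refine Set.Subsingleton.finite ?_
    rintro _ ⟨x, hx, rfl⟩ _ ⟨y, hy, rfl⟩
    exact connectedComponentIn_eq
      ((hTc A hA).1.subset_connectedComponentIn hx (hTc A hA).2 hy)
  · rintro _ ⟨x, ⟨⟨hxW, hxD⟩, hxr⟩, rfl⟩
    rcases hc ⟨hxW, hxD⟩ with ⟨A, hA, hxA⟩ | ⟨A, hA, hxA⟩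
    · exact Or.inr (mem_biUnion hA ⟨x, hxA, rfl⟩)
    · exact Or.inl (mem_biUnion hA
        ⟨x, ⟨⟨hxW, hxA⟩, disc_subset (hRle A hA) hxr⟩, rfl⟩)

/-- A similarity carrying `W` inside `D` to `W'` inside `D'`, where `W` avoids the boundary
of `D`. -/
structure CleanMap (κ : ℝ) (h : ℝ × ℝ → ℝ × ℝ) (W D W' D' : Set (ℝ × ℝ)) : Prop where
  sim : IsSim κ h
  isOpen : IsOpen D
  clean : W ∩ closure D ⊆ D
  mapsTo : MapsTo h D D'
  mem_iff : ∀ x ∈ closure D, x ∈ W ↔ h x ∈ W'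

namespace CleanMap

variable {κ κ' : ℝ} {h h' : ℝ × ℝ → ℝ × ℝ} {W D W' D' W'' D'' : Set (ℝ × ℝ)} {x p : ℝ × ℝ}

theorem comp (H' : CleanMap κ' h' W' D' W'' D'') (H : CleanMap κ h W D W' D') :
    CleanMap (κ' * κ) (h' ∘ h) W D W'' D'' :=
  ⟨H'.sim.comp H.sim, H.isOpen, H.clean, H'.mapsTo.comp H.mapsTo, fun x hx =>
    (H.mem_iff x hx).trans (H'.mem_iff _ (map_mem_closure H.sim.continuous hx H.mapsTo))⟩

theorem component_subset (H : CleanMap κ h W D W' D') (hx : x ∈ W) (hxD : x ∈ D) :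
    connectedComponentIn W x ⊆ D :=
  isPreconnected_connectedComponentIn.subset_of_closure_inter_subset H.isOpen
    ⟨x, mem_connectedComponentIn hx, hxD⟩
    fun _ hy => H.clean ⟨connectedComponentIn_subset _ _ hy.2, hy.1⟩

theorem image_component (H : CleanMap κ h W D W' D') (hx : x ∈ W) (hxD : x ∈ D) :
    h '' connectedComponentIn W x = connectedComponentIn W' (h x) := by
  have hx' : h x ∈ W' := (H.mem_iff x (subset_closure hxD)).1 hx
  apply Subset.antisymm
  · refine (isPreconnected_connectedComponentIn.image _
      H.sim.continuous.continuousOn).subset_connectedComponentIn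
      ⟨x, mem_connectedComponentIn hx, rfl⟩ ?_
    rintro _ ⟨y, hy, rfl⟩
    exact (H.mem_iff y (subset_closure (H.component_subset hx hxD hy))).1
      (connectedComponentIn_subset _ _ hy)
  · have hsub : connectedComponentIn W' (h x) ⊆ h '' D := by
      refine isPreconnected_connectedComponentIn.subset_of_closure_inter_subset
        (H.sim.homeo.isOpenMap _ H.isOpen) ⟨h x, mem_connectedComponentIn hx', x, hxD, rfl⟩ ?_
      rintro y ⟨hy1, hy2⟩
      obtain ⟨z, hz, rfl⟩ := (H.sim.homeo.image_closure D).symm.subset hy1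
      rw [IsSim.coe_homeo] at hy2 ⊢
      exact ⟨z, H.clean ⟨(H.mem_iff z hz).2 (connectedComponentIn_subset _ _ hy2), hz⟩, rfl⟩
    have hpre : IsPreconnected (h ⁻¹' connectedComponentIn W' (h x)) :=
      H.sim.homeo.isPreconnected_preimage.2 isPreconnected_connectedComponentIn
    have h2 := hpre.subset_connectedComponentIn (x := x) (F := W)
      (mem_connectedComponentIn hx') ?_
    · intro y hy
      obtain ⟨z, hz, rfl⟩ := hsub hy
      exact ⟨z, h2 hy, rfl⟩
    · intro y hy
      obtain ⟨z, hz, he⟩ := hsub hy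
      have : z = y := H.sim.homeo.injective he
      subst this
      exact (H.mem_iff z (subset_closure hz)).2 (connectedComponentIn_subset _ _ hy)

theorem image_disc_subset (h0 : IsSim κ h) (r : ℝ) : h '' disc p (r / κ) ⊆ disc (h p) r := by
  rintro _ ⟨y, hy, rfl⟩
  change sqN _ < _
  rw [h0.sqN_sub]
  have : sqN (y - p) < r / κ := hy
  rw [lt_div_iff₀ h0.pos] at this
  linarith

theorem infinite_small (H : CleanMap κ h W D W' D') {E E' : Set (ℝ × ℝ)} (hE : E ⊆ D)
    (hEE : MapsTo h E E') {r : ℝ}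
    (hp : {N | ∃ x ∈ W, N = connectedComponentIn W x ∧ N ⊆ E ∩ disc p (r / κ)}.Infinite) :
    {N | ∃ x ∈ W', N = connectedComponentIn W' x ∧ N ⊆ E' ∩ disc (h p) r}.Infinite := by
  refine Set.Infinite.mono ?_ (hp.image (image_injective.2 H.sim.homeo.injective).injOn)
  rintro _ ⟨_, ⟨x, hx, rfl, hN⟩, rfl⟩
  have hxD := hE (hN (mem_connectedComponentIn hx)).1
  refine ⟨h x, (H.mem_iff x (subset_closure hxD)).1 hx, H.image_component hx hxD, ?_⟩
  rintro _ ⟨y, hy, rfl⟩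
  exact ⟨hEE (hN hy).1, image_disc_subset H.sim r ⟨y, (hN hy).2, rfl⟩⟩

theorem smallAt_of_subset (H : CleanMap κ h W D W' D') {E E' : Set (ℝ × ℝ)} (hE : E ⊆ D)
    (hEE : MapsTo h E E') (hp : SmallAt W E p) : SmallAt W' E' (h p) := fun r hr =>
  H.infinite_small hE hEE (hp (r / κ) (div_pos hr H.sim.pos))

theorem smallAt (H : CleanMap κ h W D W' D') (hp : SmallAt W D p) : SmallAt W' D' (h p) :=
  H.smallAt_of_subset Subset.rfl H.mapsTo hp

theorem exists_meetsAt (H : CleanMap κ h W D W' D') (hp : MeetsAt W' (h '' D) p) :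
    ∃ p', h p' = p ∧ MeetsAt W D p' := by
  obtain ⟨p', rfl⟩ := H.sim.homeo.surjective p
  refine ⟨p', rfl, fun r hr hfin => hp (κ * r) (mul_pos H.sim.pos hr) ?_⟩
  refine (hfin.image (image h)).subset ?_
  rintro _ ⟨_, ⟨⟨hxW, y, hy, rfl⟩, hxr⟩, rfl⟩
  have hyW := (H.mem_iff y (subset_closure hy)).2 hxW
  refine ⟨_, ⟨y, ⟨⟨hyW, hy⟩, ?_⟩, rfl⟩, H.image_component hyW hy⟩
  have : sqN (h y - h p') < κ * r := hxr
  rw [H.sim.sqN_sub] at this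
  exact lt_of_mul_lt_mul_left this H.sim.pos.le

end CleanMap

/-- The four cells of the trapezoid cut out by the discontinuity lines. -/
def cell (t : ℝ) (c : Bool × Bool) : Set (ℝ × ℝ) :=
  {p | 0 < p.2 ∧ p.2 < 1 ∧ p.2 < p.1 ∧ p.1 < 1 + t ∧
    (bif c.1 then p.1 else t) < (bif c.1 then t else p.1) ∧
    (bif c.2 then p.1 + p.2 else 1) < (bif c.2 then 1 else p.1 + p.2)}

theorem isOpen_cell (t : ℝ) (c : Bool × Bool) : IsOpen (cell t c) := by
  obtain ⟨_ | _, _ | _⟩ := c <;>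
  · simp only [cell, ofPred_and, cond_true, cond_false]
    repeat' apply IsOpen.inter
    all_goals exact isOpen_lt (by fun_prop) (by fun_prop)

theorem le_of_mem_closure {D : Set (ℝ × ℝ)} {f g : ℝ × ℝ → ℝ} (h : ∀ x ∈ D, f x ≤ g x)
    (hf : Continuous f) (hg : Continuous g) : ∀ x ∈ closure D, f x ≤ g x :=
  fun _ hx => closure_minimal (t := {x | f x ≤ g x}) h (isClosed_le hf hg) hx

theorem mem_closure_cell {t : ℝ} {c : Bool × Bool} {p : ℝ × ℝ} (hp : p ∈ closure (cell t c)) :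
    0 ≤ p.2 ∧ p.2 ≤ 1 ∧ p.2 ≤ p.1 ∧ p.1 ≤ 1 + t ∧
    (bif c.1 then p.1 else t) ≤ (bif c.1 then t else p.1) ∧
    (bif c.2 then p.1 + p.2 else 1) ≤ (bif c.2 then 1 else p.1 + p.2) := by
  refine ⟨?_, ?_, ?_, ?_, ?_, ?_⟩
  · exact le_of_mem_closure (fun x hx => hx.1.le) (by fun_prop) (by fun_prop) p hp
  · exact le_of_mem_closure (fun x hx => hx.2.1.le) (by fun_prop) (by fun_prop) p hp
  · exact le_of_mem_closure (fun x hx => hx.2.2.1.le) (by fun_prop) (by fun_prop) p hp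
  · exact le_of_mem_closure (fun x hx => hx.2.2.2.1.le) (by fun_prop) (by fun_prop) p hp
  · refine le_of_mem_closure (fun x hx => hx.2.2.2.2.1.le) ?_ ?_ p hp <;>
      rcases c with ⟨_ | _, _⟩ <;> simp only [cond_true, cond_false] <;> fun_prop
  · refine le_of_mem_closure (fun x hx => hx.2.2.2.2.2.le) ?_ ?_ p hp <;>
      rcases c with ⟨_, _ | _⟩ <;> simp only [cond_true, cond_false] <;> fun_prop

theorem Reg.exists_cell {t : ℝ} {p : ℝ × ℝ} (h : Reg t p) : ∃ c, p ∈ cell t c := by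
  obtain ⟨h1, h2, h3, h4, h5, h6⟩ := h
  refine ⟨(decide (p.1 < t), decide (p.1 + p.2 < 1)), h1, h2, h3, h4, ?_, ?_⟩
  · rcases lt_or_gt_of_ne h6 with h | h
    · simp [h]
    · simp [h, h.not_gt]
  · rcases lt_or_gt_of_ne h5 with h | h
    · simp [h]
    · simp [h, h.not_gt]

theorem per_inter_closure_cell (t : ℝ) (c : Bool × Bool) : Per t ∩ closure (cell t c) ⊆ cell t c := by
  rintro p ⟨hp, hc⟩
  obtain ⟨h1, h2, h3, h4, h5, h6⟩ := reg_of_per hp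
  obtain ⟨-, -, -, -, k5, k6⟩ := mem_closure_cell hc
  refine ⟨h1, h2, h3, h4, lt_of_le_of_ne k5 ?_, lt_of_le_of_ne k6 ?_⟩
  · rcases c with ⟨_ | _, _⟩ <;> simp [h6, Ne.symm h6]
  · rcases c with ⟨_, _ | _⟩ <;> simp [h5, Ne.symm h5]

theorem eq_of_mem_cell {t : ℝ} {c c' : Bool × Bool} {p : ℝ × ℝ} (h : p ∈ cell t c)
    (h' : p ∈ cell t c') : c = c' := by
  obtain ⟨-, -, -, -, h1, h2⟩ := h
  obtain ⟨-, -, -, -, h3, h4⟩ := h'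
  rcases c with ⟨_ | _, _ | _⟩ <;> rcases c' with ⟨_ | _, _ | _⟩ <;>
    simp only [cond_true, cond_false] at * <;> first | rfl | (exfalso; linarith)

/-- The parameters of one renormalization step. -/
structure Renorm (t u t' : ℝ) (k : ℕ) : Prop where
  pos : 0 < t
  lt_one : t < 1
  cases : (t < 1 / 2 ∧ u = t) ∨ (1 / 2 < t ∧ u = 1 - t)
  pos' : 0 < t'
  lt_one' : t' < 1
  mul_eq : 2 * u * (k + t') = 1
  one_le : 1 ≤ k

namespace Renorm

variable {t u t' : ℝ} {k : ℕ} (R : Renorm t u t' k)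
include R

theorem u_pos : 0 < u := by
  have := R.pos
  have := R.lt_one
  rcases R.cases with ⟨_, rfl⟩ | ⟨_, rfl⟩ <;> linarith

theorem u_lt : u < 1 / 2 := by
  rcases R.cases with ⟨_, rfl⟩ | ⟨_, rfl⟩ <;> linarith

theorem perQ_iff (p : ℝ × ℝ) : p ∈ PerQ u ↔ p ∈ Per t ∧ p.1 + p.2 < 1 := by
  rcases R.cases with ⟨h, rfl⟩ | ⟨h, rfl⟩
  · exact perQ_iff_of_lt R.pos h p
  · exact perQ_iff_of_gt h R.lt_one p

theorem perQ_iff' {p : ℝ × ℝ} (hp : p.1 + p.2 ≤ 1) : p ∈ PerQ u ↔ p ∈ Per t := by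
  rw [R.perQ_iff, and_iff_left_iff_imp]
  exact fun h => lt_of_le_of_ne hp (reg_of_per h).2.2.2.2.1

end Renorm

theorem exists_renorm {t : ℝ} (h0 : 0 < t) (h1 : t < 1) (ht : Irrational t) :
    ∃ u t' k, Renorm t u t' k ∧ Irrational t' := by
  obtain ⟨u, hu0, hu1, hui, hu⟩ : ∃ u, 0 < u ∧ u < 1 / 2 ∧ Irrational u ∧
      ((t < 1 / 2 ∧ u = t) ∨ (1 / 2 < t ∧ u = 1 - t)) := by
    have : t ≠ 1 / 2 := by
      rintro rfl
      exact ht ⟨1 / 2, by norm_num⟩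
    rcases lt_or_gt_of_ne this with h | h
    · exact ⟨t, h0, h, ht, Or.inl ⟨h, rfl⟩⟩
    · exact ⟨1 - t, by linarith, by linarith, by simpa using ht.ratCast_sub 1, Or.inr ⟨h, rfl⟩⟩
  have hi : Irrational (1 / (2 * u)) := by
    have := (hui.ratCast_mul (q := 2) (by norm_num)).inv
    simpa using this
  have hfl := Nat.floor_le (a := 1 / (2 * u)) (by positivity)
  have hfl' := Nat.lt_floor_add_one (1 / (2 * u))
  have hti : Irrational (1 / (2 * u) - ⌊1 / (2 * u)⌋₊) := hi.sub_natCast _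
  refine ⟨u, 1 / (2 * u) - ⌊1 / (2 * u)⌋₊, ⌊1 / (2 * u)⌋₊,
    ⟨h0, h1, hu, ?_, by linarith, ?_, ?_⟩, hti⟩
  · refine lt_of_le_of_ne (by linarith) fun h => hti ⟨0, by rw [← h]; simp⟩
  · field_simp; ring
  · refine Nat.le_floor ?_
    rw [Nat.cast_one, le_div_iff₀ (by linarith)]; linarith

theorem rho_lt_mem_per {t : ℝ} {p : ℝ × ℝ} (hp : p.1 + p.2 ≤ 1) (h : p ∈ Per t) :
    (1 - p.1, p.2) ∈ Per t := by
  have := rhoF_mem_per h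
  rwa [← Prod.eta p, rhoF_lt (lt_of_le_of_ne hp (reg_of_per h).2.2.2.2.1)] at this

theorem rho_lt_mem_per_iff {t : ℝ} {p : ℝ × ℝ} (h1 : p.2 ≤ p.1) (h2 : p.1 + p.2 ≤ 1) :
    p ∈ Per t ↔ (1 - p.1, p.2) ∈ Per t := by
  refine ⟨rho_lt_mem_per h2, fun h => ?_⟩
  simpa using rho_lt_mem_per (by dsimp only; linarith) h

theorem rho_gt_mem_per {t : ℝ} {p : ℝ × ℝ} (hp : 1 ≤ p.1 + p.2) (h : p ∈ Per t) :
    (p.1, 1 - p.2) ∈ Per t := by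
  have := rhoF_mem_per h
  rwa [← Prod.eta p, rhoF_gt (lt_of_le_of_ne hp (Ne.symm (reg_of_per h).2.2.2.2.1))] at this

theorem rho_gt_mem_per_iff {t : ℝ} {p : ℝ × ℝ} (h1 : p.2 ≤ p.1) (h2 : 1 ≤ p.1 + p.2) :
    p ∈ Per t ↔ (p.1, 1 - p.2) ∈ Per t := by
  refine ⟨rho_gt_mem_per h2, fun h => ?_⟩
  simpa using rho_gt_mem_per (by dsimp only; linarith) h

theorem sig_lt_mem_per {t : ℝ} {p : ℝ × ℝ} (hp : p.1 ≤ t) (h : p ∈ Per t) :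
    (t - p.2, t - p.1) ∈ Per t := by
  have := sigF_mem_per h
  rwa [← Prod.eta p, sigF_lt (lt_of_le_of_ne hp (reg_of_per h).2.2.2.2.2)] at this

theorem sig_lt_mem_per_iff {t : ℝ} {p : ℝ × ℝ} (h1 : 0 ≤ p.2) (h2 : p.1 ≤ t) :
    p ∈ Per t ↔ (t - p.2, t - p.1) ∈ Per t := by
  refine ⟨sig_lt_mem_per h2, fun h => ?_⟩
  simpa using sig_lt_mem_per (by dsimp only; linarith) h

theorem sig_gt_mem_per {t : ℝ} {p : ℝ × ℝ} (hp : t ≤ p.1) (h : p ∈ Per t) :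
    (1 + t - p.2, 1 + t - p.1) ∈ Per t := by
  have := sigF_mem_per h
  rwa [← Prod.eta p, sigF_gt (lt_of_le_of_ne hp (Ne.symm (reg_of_per h).2.2.2.2.2))] at this

theorem sig_gt_mem_per_iff {t : ℝ} {p : ℝ × ℝ} (h1 : p.2 ≤ 1) (h2 : t ≤ p.1) :
    p ∈ Per t ↔ (1 + t - p.2, 1 + t - p.1) ∈ Per t := by
  refine ⟨sig_gt_mem_per h2, fun h => ?_⟩
  simpa using sig_gt_mem_per (by dsimp only; linarith) h

theorem isSim_psiJ {u : ℝ} (h0 : 0 < u) (j : ℕ) : IsSim (2 * u ^ 2) (psiJ u j) :=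
  ⟨u, u, 2 * u * j, 0, -1, by norm_num, by positivity, by ring, fun p => by
    simp only [psiJ]; ext <;> dsimp only <;> ring⟩

theorem isSim_rho_lt : IsSim 1 fun p => (1 - p.1, p.2) :=
  ⟨-1, 0, 1, 0, -1, by norm_num, by norm_num, by norm_num, fun p => by
    ext <;> dsimp only <;> ring⟩

theorem isSim_rho_gt : IsSim 1 fun p => (p.1, 1 - p.2) :=
  ⟨1, 0, 0, 1, -1, by norm_num, by norm_num, by norm_num, fun p => by
    ext <;> dsimp only <;> ring⟩

theorem isSim_sig (t : ℝ) : IsSim 1 fun p => (t - p.2, t - p.1) :=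
  ⟨0, -1, t, t, -1, by norm_num, by norm_num, by norm_num, fun p => by
    ext <;> dsimp only <;> ring⟩

/-- The three domains of continuity of the piecewise reflection of the triangle. -/
def piece (u : ℝ) : Option Bool → Set (ℝ × ℝ)
  | none => {p | 0 < p.2 ∧ p.2 < p.1 ∧ p.1 + p.2 < 1 ∧ p.1 < u}
  | some true => {p | 0 < p.2 ∧ p.2 < p.1 ∧ p.1 + p.2 < 1 ∧ u < p.1 ∧ p.1 - p.2 < 2 * u}
  | some false => {p | 0 < p.2 ∧ p.2 < p.1 ∧ p.1 + p.2 < 1 ∧ u < p.1 ∧ 2 * u < p.1 - p.2}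

theorem isOpen_piece (u : ℝ) (n : Option Bool) : IsOpen (piece u n) := by
  obtain _ | _ | _ := n <;>
  · simp only [piece, ofPred_and]
    repeat' apply IsOpen.inter
    all_goals exact isOpen_lt (by fun_prop) (by fun_prop)

theorem mem_closure_piece {u : ℝ} {n : Option Bool} {p : ℝ × ℝ} (hp : p ∈ closure (piece u n)) :
    0 ≤ p.2 ∧ p.2 ≤ p.1 ∧ p.1 + p.2 ≤ 1 := by
  have key : ∀ x ∈ piece u n, 0 < x.2 ∧ x.2 < x.1 ∧ x.1 + x.2 < 1 := by
    rintro x hx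
    obtain _ | _ | _ := n <;> exact ⟨hx.1, hx.2.1, hx.2.2.1⟩
  exact ⟨le_of_mem_closure (fun x hx => (key x hx).1.le) (by fun_prop) (by fun_prop) p hp,
    le_of_mem_closure (fun x hx => (key x hx).2.1.le) (by fun_prop) (by fun_prop) p hp,
    le_of_mem_closure (fun x hx => (key x hx).2.2.le) (by fun_prop) (by fun_prop) p hp⟩

theorem mem_closure_piece_none {u : ℝ} {p : ℝ × ℝ} (hp : p ∈ closure (piece u none)) : p.1 ≤ u :=
  le_of_mem_closure (fun _ hx => hx.2.2.2.le) (by fun_prop) (by fun_prop) p hp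

theorem mem_closure_piece_some {u : ℝ} {b : Bool} {p : ℝ × ℝ}
    (hp : p ∈ closure (piece u (some b))) : u ≤ p.1 := by
  have key : ∀ x ∈ piece u (some b), u < x.1 := by
    rintro x hx
    obtain _ | _ := b <;> exact hx.2.2.2.1
  exact le_of_mem_closure (fun x hx => (key x hx).le) (by fun_prop) (by fun_prop) p hp

theorem mem_closure_piece_true {u : ℝ} {p : ℝ × ℝ} (hp : p ∈ closure (piece u (some true))) :
    p.1 - p.2 ≤ 2 * u :=
  le_of_mem_closure (fun _ hx => hx.2.2.2.2.le) (by fun_prop) (by fun_prop) p hp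

theorem mem_closure_piece_false {u : ℝ} {p : ℝ × ℝ} (hp : p ∈ closure (piece u (some false))) :
    2 * u ≤ p.1 - p.2 :=
  le_of_mem_closure (fun _ hx => hx.2.2.2.2.le) (by fun_prop) (by fun_prop) p hp

theorem perQ_inter_closure_piece (u : ℝ) (n : Option Bool) :
    PerQ u ∩ closure (piece u n) ⊆ piece u n := by
  rintro p ⟨hp, hc⟩
  obtain ⟨h1, h2, h3, h4, h5⟩ := regQ_of_perQ hp
  obtain _ | _ | _ := n
  · exact ⟨h1, h2, h3, lt_of_le_of_ne (mem_closure_piece_none hc) h4⟩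
  · exact ⟨h1, h2, h3, lt_of_le_of_ne (mem_closure_piece_some hc) h4.symm,
      lt_of_le_of_ne (mem_closure_piece_false hc) h5.symm⟩
  · exact ⟨h1, h2, h3, lt_of_le_of_ne (mem_closure_piece_some hc) h4.symm,
      lt_of_le_of_ne (mem_closure_piece_true hc) h5⟩

theorem Renorm.per_inter_closure_piece {t u t' : ℝ} {k : ℕ} (R : Renorm t u t' k)
    (n : Option Bool) : Per t ∩ closure (piece u n) ⊆ piece u n := fun _ hp =>
  perQ_inter_closure_piece u n ⟨(R.perQ_iff' (mem_closure_piece hp.2).2.2).2 hp.1, hp.2⟩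

theorem exists_mem_piece {u : ℝ} {p : ℝ × ℝ} (hp : p ∈ PerQ u) : ∃ n, p ∈ piece u n := by
  obtain ⟨h1, h2, h3, h4, h5⟩ := regQ_of_perQ hp
  rcases lt_or_gt_of_ne h4 with h | h
  · exact ⟨none, h1, h2, h3, h⟩
  · rcases lt_or_gt_of_ne h5 with h' | h'
    · exact ⟨some true, h1, h2, h3, h, h'⟩
    · exact ⟨some false, h1, h2, h3, h, h'⟩

theorem Renorm.cleanMap_psiJ {t u t' : ℝ} {k j : ℕ} (R : Renorm t u t' k) {c : Bool × Bool}
    (hj : j + 1 ≤ k ∨ j = k ∧ c.1 = true) {n : Option Bool}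
    (hn : (j = 0 ∧ c.2 = true ∧ n = none) ∨ (j = 0 ∧ c.2 = false ∧ n = some true) ∨
      (1 ≤ j ∧ n = some false)) :
    CleanMap (2 * u ^ 2) (psiJ u j) (Per t') (cell t' c) (Per t) (piece u n) := by
  have hu := R.u_pos
  have hm := R.mul_eq
  refine ⟨isSim_psiJ hu j, isOpen_cell _ _, per_inter_closure_cell _ _, ?_, ?_⟩
  · intro p hp
    obtain ⟨h1, h2, h3, h4, h5, h6⟩ := hp
    have hsum : p.1 + j < k + t' := by
      rcases hj with hj | ⟨rfl, hj⟩
      · have : (j : ℝ) + 1 ≤ k := by exact_mod_cast hj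
        linarith
      · rw [hj] at h5; simp only [cond_true] at h5; linarith
    have e1 : u * (p.1 + p.2) + 2 * u * j + u * (p.1 - p.2) < 1 := by
      rw [← hm]; nlinarith
    have e2 : u * (p.1 - p.2) < u * (p.1 + p.2) + 2 * u * j := by
      have : 0 ≤ u * j := by positivity
      nlinarith
    have e3 : 0 < u * (p.1 - p.2) := mul_pos hu (by linarith)
    rcases hn with ⟨rfl, hc, rfl⟩ | ⟨rfl, hc, rfl⟩ | ⟨hj1, rfl⟩
    · rw [hc] at h6
      simp only [cond_true] at h6
      exact ⟨e3, e2, e1, by simp only [psiJ]; push_cast; nlinarith⟩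
    · rw [hc] at h6
      simp only [cond_false] at h6
      exact ⟨e3, e2, e1, by simp only [psiJ]; push_cast; nlinarith,
        by simp only [psiJ]; push_cast; nlinarith⟩
    · have : (1 : ℝ) ≤ j := by exact_mod_cast hj1
      exact ⟨e3, e2, e1, by simp only [psiJ]; nlinarith, by simp only [psiJ]; nlinarith⟩
  · intro p hp
    obtain ⟨h1, h2, h3, h4, h5, h6⟩ := mem_closure_cell hp
    have hj' : j + 1 ≤ k ∨ j = k ∧ p.1 ≤ t' := by
      rcases hj with hj | ⟨hk, hj⟩
      · exact Or.inl hj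
      · rw [hj] at h5; exact Or.inr ⟨hk, h5⟩
    rw [psiJ_mem_perQ_iff hu R.pos' R.lt_one' hm R.one_le h4 h1 h2 hj', R.perQ_iff']
    have hsum : p.1 + j ≤ k + t' := by
      rcases hj' with hj | ⟨rfl, hj⟩
      · have : (j : ℝ) + 1 ≤ k := by exact_mod_cast hj
        linarith
      · linarith
    simp only [psiJ]
    rw [← hm]; nlinarith

/-- The open unit square at distance `i` to the right of the line `x = t`. -/
def unitSq (t : ℝ) (i : ℕ) : Set (ℝ × ℝ) :=
  {p | i + t < p.1 ∧ p.1 < i + t + 1 ∧ 0 < p.2 ∧ p.2 < 1}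

theorem isPreconnected_unitSq (t : ℝ) (i : ℕ) : IsPreconnected (unitSq t i) := by
  apply Convex.isPreconnected
  intro p hp q hq a b ha hb hab
  obtain rfl : b = 1 - a := by linarith
  obtain ⟨h1, h2, h3, h4⟩ := hp
  obtain ⟨k1, k2, k3, k4⟩ := hq
  have hb' : 0 ≤ 1 - a := hb
  have key : ∀ x y : ℝ, 0 < x → 0 < y → 0 < a * x + (1 - a) * y := by
    intro x y hx hy
    rcases ha.eq_or_lt with rfl | ha
    · linarith
    · have := mul_pos ha hx
      have := mul_nonneg hb' hy.le
      linarith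
  have e1 := key _ _ (sub_pos.2 h1) (sub_pos.2 k1)
  have e2 := key _ _ (sub_pos.2 h2) (sub_pos.2 k2)
  have e3 := key _ _ (sub_pos.2 h3) (sub_pos.2 k3)
  have e4 := key _ _ (sub_pos.2 h4) (sub_pos.2 k4)
  simp only [unitSq, mem_ofPred_eq, Prod.fst_add, Prod.snd_add, Prod.smul_fst, Prod.smul_snd,
    smul_eq_mul]
  refine ⟨?_, ?_, ?_, ?_⟩ <;> linarith

theorem Renorm.image_unitSq_subset {t u t' : ℝ} {k i j : ℕ} (R : Renorm t u t' k) (hi : 1 ≤ i)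
    (hij : i + j + 1 ≤ k) :
    psiJ u j '' unitSq t' i ⊆ Per t ∩ piece u (some (decide (j = 0))) := by
  rintro _ ⟨⟨x, y⟩, ⟨h1, h2, h3, h4⟩, rfl⟩
  dsimp only at *
  have hu := R.u_pos
  have hQ := square_subset_perQ hu R.pos' R.mul_eq hi hij (a := x - i - t') (b := y) (by linarith)
    (by linarith) h3 h4
  have e : (i : ℝ) + t' + (x - i - t') = x := by ring
  rw [e] at hQ
  refine ⟨((R.perQ_iff _).1 hQ).1, ?_⟩
  obtain ⟨r1, r2, r3, -, -⟩ := regQ_of_perQ hQ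
  have : (1 : ℝ) ≤ i := by exact_mod_cast hi
  have := R.pos'
  have hj0 : (0 : ℝ) ≤ j := by positivity
  by_cases hj : j = 0
  · subst hj
    refine ⟨r1, r2, r3, ?_, ?_⟩
    · simp only [psiJ]; push_cast; nlinarith
    · simp only [psiJ]; push_cast; nlinarith
  · have hj1 : (1 : ℝ) ≤ j := by exact_mod_cast Nat.one_le_iff_ne_zero.2 hj
    simp only [decide_eq_false hj]
    refine ⟨r1, r2, r3, ?_, ?_⟩
    · simp only [psiJ]; nlinarith
    · simp only [psiJ]; nlinarith

theorem Renorm.cover_triangle {t u t' : ℝ} {k : ℕ} (R : Renorm t u t' k) {z : ℝ × ℝ}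
    (hz : z ∈ Per t) (hz1 : z.1 + z.2 < 1) : ∃ n,
    (∃ j ≤ k, ∃ c, CleanMap (2 * u ^ 2) (psiJ u j) (Per t') (cell t' c) (Per t) (piece u n) ∧
      ∃ p ∈ Per t' ∩ cell t' c, psiJ u j p = z) ∨
    ∃ i ≤ k, ∃ j ≤ k, psiJ u j '' unitSq t' i ⊆ Per t ∩ piece u n ∧ z ∈ psiJ u j '' unitSq t' i := by
  have hzQ := (R.perQ_iff z).2 ⟨hz, hz1⟩
  rcases perQ_cover R.u_pos R.pos' R.lt_one' R.mul_eq R.one_le hzQ with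
    ⟨j, p, hp, hj, rfl⟩ | ⟨i, j, a, b, hi, hij, ha, ha1, hb, hb1, rfl⟩
  · obtain ⟨c, hc⟩ := (reg_of_per hp).exists_cell
    have hj' : j + 1 ≤ k ∨ j = k ∧ c.1 = true := by
      rcases hj with hj | ⟨hj, hp1⟩
      · exact Or.inl hj
      · refine Or.inr ⟨hj, ?_⟩
        by_contra hcon
        rw [Bool.not_eq_true] at hcon
        have := hc.2.2.2.2.1
        rw [hcon] at this
        simp only [cond_false] at this
        linarith
    have hjk : j ≤ k := by omega
    rcases Nat.eq_zero_or_pos j with hj0 | hj0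
    · rcases hc2 : c.2 with _ | _
      · exact ⟨some true, Or.inl ⟨j, hjk, c, R.cleanMap_psiJ hj' (Or.inr (Or.inl ⟨hj0, hc2, rfl⟩)),
          p, ⟨hp, hc⟩, rfl⟩⟩
      · exact ⟨none, Or.inl ⟨j, hjk, c, R.cleanMap_psiJ hj' (Or.inl ⟨hj0, hc2, rfl⟩),
          p, ⟨hp, hc⟩, rfl⟩⟩
    · exact ⟨some false, Or.inl ⟨j, hjk, c, R.cleanMap_psiJ hj' (Or.inr (Or.inr ⟨hj0, rfl⟩)),
          p, ⟨hp, hc⟩, rfl⟩⟩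
  · refine ⟨_, Or.inr ⟨i, by omega, j, by omega, R.image_unitSq_subset hi hij, _, ?_, rfl⟩⟩
    exact ⟨by dsimp only; linarith, by dsimp only; linarith, hb, hb1⟩

theorem eq_of_mem_piece {u : ℝ} {n n' : Option Bool} {p : ℝ × ℝ} (h : p ∈ piece u n)
    (h' : p ∈ piece u n') : n = n' := by
  obtain _ | _ | _ := n <;> obtain _ | _ | _ := n' <;> first
    | rfl
    | (exfalso; linarith [h.2.2.2, h'.2.2.2])

theorem CleanMap.of_subset {W D D' : Set (ℝ × ℝ)} (hD : IsOpen D) (hc : W ∩ closure D ⊆ D)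
    (h : D ⊆ D') : CleanMap 1 id W D W D' :=
  ⟨⟨1, 0, 0, 0, 1, by norm_num, by norm_num, by norm_num, fun p => by ext <;> simp⟩, hD, hc, h,
    fun _ _ => Iff.rfl⟩

theorem cleanMap_sig_gt {t : ℝ} (h0 : 0 < t) :
    CleanMap 1 (fun p => (1 + t - p.2, 1 + t - p.1)) (Per t) (cell t (false, true)) (Per t)
      (cell t (false, false)) := by
  refine ⟨isSim_sig (1 + t), isOpen_cell _ _, per_inter_closure_cell _ _, ?_, fun x hx => ?_⟩
  · rintro ⟨x, y⟩ ⟨h1, h2, h3, h4, h5, h6⟩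
    simp only [cond_true, cond_false] at h1 h2 h3 h4 h5 h6
    refine ⟨?_, ?_, ?_, ?_, ?_, ?_⟩ <;> simp only [cond_false] <;> linarith
  · obtain ⟨h1, h2, h3, h4, h5, h6⟩ := mem_closure_cell hx
    exact sig_gt_mem_per_iff h2 h5

theorem cleanMap_rho_gt (t : ℝ) :
    CleanMap 1 (fun p => (p.1, 1 - p.2)) (Per t) (cell t (false, false)) (Per t)
      (cell t (false, false)) := by
  refine ⟨isSim_rho_gt, isOpen_cell _ _, per_inter_closure_cell _ _, ?_, fun x hx => ?_⟩
  · rintro ⟨x, y⟩ ⟨h1, h2, h3, h4, h5, h6⟩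
    simp only [cond_false] at h1 h2 h3 h4 h5 h6
    refine ⟨?_, ?_, ?_, ?_, ?_, ?_⟩ <;> simp only [cond_false] <;> linarith
  · obtain ⟨h1, h2, h3, h4, h5, h6⟩ := mem_closure_cell hx
    exact rho_gt_mem_per_iff h3 h6

namespace Renorm

variable {t u t' : ℝ} {k : ℕ} (R : Renorm t u t' k)
include R

theorem cleanMap_id (h : t < 1 / 2) (n : Option Bool) :
    CleanMap 1 id (Per t) (piece u n) (Per t) (cell t (n.isNone, true)) := by
  have h0 := R.pos
  have hu : u = t := by
    rcases R.cases with ⟨_, h⟩ | ⟨h', _⟩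
    · exact h
    · linarith
  subst hu
  refine CleanMap.of_subset (isOpen_piece _ _) (R.per_inter_closure_piece n) ?_
  rintro ⟨x, y⟩ hx
  obtain _ | _ | _ := n
  · obtain ⟨h1, h2, h3, h4⟩ := hx
    dsimp only at h1 h2 h3 h4
    refine ⟨?_, ?_, ?_, ?_, ?_, ?_⟩ <;> simp only [Option.isNone, cond_true] <;> linarith
  all_goals
    obtain ⟨h1, h2, h3, h4, h5⟩ := hx
    dsimp only at h1 h2 h3 h4
    refine ⟨?_, ?_, ?_, ?_, ?_, ?_⟩ <;>
      simp only [Option.isNone, cond_true, cond_false] <;> linarith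

theorem cleanMap_rho_lt (h : 1 / 2 < t) (n : Option Bool) :
    CleanMap 1 (fun p => (1 - p.1, p.2)) (Per t) (piece u n) (Per t)
      (cell t (n.isSome, true)) := by
  have h0 := R.lt_one
  have hu : u = 1 - t := by
    rcases R.cases with ⟨h', _⟩ | ⟨_, h⟩
    · linarith
    · exact h
  subst hu
  refine ⟨isSim_rho_lt, isOpen_piece _ _, R.per_inter_closure_piece n, ?_, fun x hx => ?_⟩
  · rintro ⟨x, y⟩ hx
    obtain _ | _ | _ := n
    · obtain ⟨h1, h2, h3, h4⟩ := hx
      dsimp only at h1 h2 h3 h4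
      refine ⟨?_, ?_, ?_, ?_, ?_, ?_⟩ <;>
        simp only [Option.isSome, cond_true, cond_false] <;> linarith
    all_goals
      obtain ⟨h1, h2, h3, h4, h5⟩ := hx
      dsimp only at h1 h2 h3 h4
      refine ⟨?_, ?_, ?_, ?_, ?_, ?_⟩ <;> simp only [Option.isSome, cond_true] <;> linarith
  · obtain ⟨h1, h2, h3⟩ := mem_closure_piece hx
    exact rho_lt_mem_per_iff h2 h3

theorem cleanMap_sig_rho (h : 1 / 2 < t) :
    CleanMap 1 (fun p => (t - p.2, t - (1 - p.1))) (Per t) (piece u (some false)) (Per t)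
      (cell t (true, false)) := by
  have h0 := R.lt_one
  have hu : u = 1 - t := by
    rcases R.cases with ⟨h', _⟩ | ⟨_, h⟩
    · linarith
    · exact h
  subst hu
  refine ⟨?_, isOpen_piece _ _, R.per_inter_closure_piece _, ?_, fun x hx => ?_⟩
  · have := (isSim_sig t).comp isSim_rho_lt
    rwa [one_mul] at this
  · rintro ⟨x, y⟩ ⟨h1, h2, h3, h4, h5⟩
    dsimp only at h1 h2 h3 h4 h5
    refine ⟨?_, ?_, ?_, ?_, ?_, ?_⟩ <;> simp only [cond_true, cond_false] <;> linarith
  · obtain ⟨h1, h2, h3⟩ := mem_closure_piece hx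
    have h4 := mem_closure_piece_some hx
    rw [rho_lt_mem_per_iff h2 h3]
    exact sig_lt_mem_per_iff (p := (1 - x.1, x.2)) h1 (by dsimp only; linarith)


end Renorm

/-- The central octagon of the trapezoid. -/
def octagon (t : ℝ) : Set (ℝ × ℝ) :=
  {p | t < p.1 ∧ p.1 < 1 + t ∧ 0 < p.2 ∧ p.2 < 1 ∧ 1 < p.1 + p.2 ∧ p.1 + p.2 < 1 + 2 * t ∧
    p.2 < p.1 ∧ p.1 - p.2 < 2 * t}

theorem isPreconnected_octagon (t : ℝ) : IsPreconnected (octagon t) := by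
  apply Convex.isPreconnected
  intro p hp q hq a b ha hb hab
  obtain rfl : b = 1 - a := by linarith
  obtain ⟨h1, h2, h3, h4, h5, h6, h7, h8⟩ := hp
  obtain ⟨k1, k2, k3, k4, k5, k6, k7, k8⟩ := hq
  have hb' : 0 ≤ 1 - a := hb
  have key : ∀ x y : ℝ, 0 < x → 0 < y → 0 < a * x + (1 - a) * y := by
    intro x y hx hy
    rcases ha.eq_or_lt with rfl | ha
    · linarith
    · have := mul_pos ha hx
      have := mul_nonneg hb' hy.le
      linarith
  have e1 := key _ _ (sub_pos.2 h1) (sub_pos.2 k1)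
  have e2 := key _ _ (sub_pos.2 h2) (sub_pos.2 k2)
  have e3 := key _ _ (sub_pos.2 h3) (sub_pos.2 k3)
  have e4 := key _ _ (sub_pos.2 h4) (sub_pos.2 k4)
  have e5 := key _ _ (sub_pos.2 h5) (sub_pos.2 k5)
  have e6 := key _ _ (sub_pos.2 h6) (sub_pos.2 k6)
  have e7 := key _ _ (sub_pos.2 h7) (sub_pos.2 k7)
  have e8 := key _ _ (sub_pos.2 h8) (sub_pos.2 k8)
  simp only [octagon, mem_ofPred_eq, Prod.fst_add, Prod.snd_add, Prod.smul_fst, Prod.smul_snd,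
    smul_eq_mul]
  refine ⟨?_, ?_, ?_, ?_, ?_, ?_, ?_, ?_⟩ <;> linarith

theorem octagon_subset_per (t : ℝ) : octagon t ⊆ Per t := by
  rintro ⟨x, y⟩ hx
  let W : Set ℝ := {x - t, 1 - (x - t), y, 1 - y}
  have hW : ∀ c ∈ W, 1 - c ∈ W := by
    rintro c (rfl | rfl | rfl | rfl) <;> simp [W]
  have hWf : W.Finite := by simp [W]
  refine ⟨octagon t ∩ (fun c : ℝ × ℝ => (c.1 + t, c.2)) '' (W ×ˢ W),
    ((hWf.prod hWf).image _).subset inter_subset_right,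
    ⟨hx, (x - t, y), ⟨by simp [W], by simp [W]⟩, by simp⟩, ?_⟩
  rintro _ ⟨h, ⟨a, b⟩, ⟨ha, hb⟩, rfl⟩
  obtain ⟨h1, h2, h3, h4, h5, h6, h7, h8⟩ := h
  dsimp only at *
  refine ⟨⟨h3, h4, h7, h2, h5.ne', h1.ne'⟩, ?_, ?_⟩
  · rw [rhoF_gt h5]
    refine ⟨⟨?_, ?_, ?_, ?_, ?_, ?_, ?_, ?_⟩, (a, 1 - b), ⟨ha, hW _ hb⟩, rfl⟩ <;>
      dsimp only <;> linarith
  · rw [sigF_gt h1]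
    refine ⟨⟨?_, ?_, ?_, ?_, ?_, ?_, ?_, ?_⟩, (1 - b, 1 - a), ⟨hW _ hb, hW _ ha⟩, ?_⟩
    any_goals dsimp only
    any_goals linarith
    ext <;> dsimp only <;> ring

/-- The finitely many words in the reflections used to cover the trapezoid. -/
def words (t : ℝ) : Set (ℝ × ℝ → ℝ × ℝ) :=
  {id, fun p => (1 - p.1, p.2), fun p => (t - p.2, t - (1 - p.1)),
    (fun p => (1 + t - p.2, 1 + t - p.1)) ∘ id,
    (fun p => (1 + t - p.2, 1 + t - p.1)) ∘ fun p => (1 - p.1, p.2),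
    (fun p => (p.1, 1 - p.2)) ∘ (fun p => (1 + t - p.2, 1 + t - p.1)) ∘ id,
    (fun p => (p.1, 1 - p.2)) ∘ (fun p => (1 + t - p.2, 1 + t - p.1)) ∘ fun p => (1 - p.1, p.2)}

namespace Renorm

variable {t u t' : ℝ} {k : ℕ} (R : Renorm t u t' k)
include R

theorem exists_word_of_lt {x : ℝ × ℝ} (hx : x ∈ Per t) (h1 : x.1 + x.2 < 1) :
    ∃ w, (w = id ∨ w = fun p => (1 - p.1, p.2)) ∧ ∃ n b z,
      CleanMap 1 w (Per t) (piece u n) (Per t) (cell t (b, true)) ∧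
      z ∈ Per t ∩ piece u n ∧ w z = x := by
  rcases R.cases with ⟨h, -⟩ | ⟨h, -⟩
  · obtain ⟨n, hn⟩ := exists_mem_piece ((R.perQ_iff x).2 ⟨hx, h1⟩)
    exact ⟨_, Or.inl rfl, n, _, x, R.cleanMap_id h n, ⟨hx, hn⟩, rfl⟩
  · have hz := rho_lt_mem_per h1.le hx
    obtain ⟨n, hn⟩ := exists_mem_piece ((R.perQ_iff _).2 ⟨hz, by
      have := (reg_of_per hx).2.2.1
      dsimp only; linarith⟩)
    exact ⟨_, Or.inr rfl, n, _, _, R.cleanMap_rho_lt h n, ⟨hz, hn⟩, by ext <;> simp⟩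

theorem exists_word {x : ℝ × ℝ} (hx : x ∈ Per t) : x ∈ octagon t ∨
    ∃ w ∈ words t, ∃ n c z, CleanMap 1 w (Per t) (piece u n) (Per t) (cell t c) ∧
      z ∈ Per t ∩ piece u n ∧ w z = x := by
  have h0 := R.pos
  have step : ∀ x : ℝ × ℝ, x ∈ Per t → t < x.1 → 1 + 2 * t < x.1 + x.2 →
      ∃ w, (w = (fun p => (1 + t - p.2, 1 + t - p.1)) ∘ id ∨
        w = (fun p => (1 + t - p.2, 1 + t - p.1)) ∘ fun p => (1 - p.1, p.2)) ∧ ∃ n z,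
      CleanMap 1 w (Per t) (piece u n) (Per t) (cell t (false, false)) ∧
      z ∈ Per t ∩ piece u n ∧ w z = x := by
    intro x hx hxt hs
    have hr := reg_of_per hx
    obtain ⟨w, hw, n, b, z, hc, hz, hwz⟩ := R.exists_word_of_lt (sig_gt_mem_per hxt.le hx)
      (by dsimp only; linarith)
    have hb := hc.mapsTo hz.2
    rw [hwz] at hb
    have hb' := hb.2.2.2.2.1
    rcases b with _ | _
    · have := (cleanMap_sig_gt h0).comp hc
      rw [one_mul] at this
      refine ⟨_, ?_, n, z, this, hz, ?_⟩
      · rcases hw with rfl | rfl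
        · exact Or.inl rfl
        · exact Or.inr rfl
      · rw [Function.comp_apply, hwz]; ext <;> dsimp only <;> ring
    · simp only [cond_true] at hb'
      linarith [hr.2.1]
  obtain ⟨r1, r2, r3, r4, r5, r6⟩ := reg_of_per hx
  rcases lt_or_gt_of_ne r5 with h | h
  · obtain ⟨w, hw, n, b, z, hc⟩ := R.exists_word_of_lt hx h
    refine Or.inr ⟨w, ?_, n, _, z, hc⟩
    rcases hw with rfl | rfl <;> simp [words]
  rcases lt_or_gt_of_ne r6 with h' | h'
  · have ht : 1 / 2 < t := by linarith
    refine Or.inr ⟨_, by simp [words], some false, _, (1 - (t - x.2), t - x.1),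
      R.cleanMap_sig_rho ht, ⟨?_, ?_⟩, by ext <;> simp⟩
    · exact rho_lt_mem_per (p := (t - x.2, t - x.1)) (by dsimp only; linarith [R.lt_one])
        (sig_lt_mem_per h'.le hx)
    · have hu : u = 1 - t := by
        rcases R.cases with ⟨h', _⟩ | ⟨_, h⟩
        · linarith
        · exact h
      subst hu
      refine ⟨?_, ?_, ?_, ?_, ?_⟩ <;> dsimp only <;> linarith [R.lt_one]
  have nine : ∀ y ∈ Per t, t < y.1 → y.1 + y.2 ≠ 1 + 2 * t := fun y hy hyt he => by
    refine (reg_of_per (sig_gt_mem_per hyt.le hy)).2.2.2.2.1 ?_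
    dsimp only; linarith
  have hx' := rho_gt_mem_per h.le hx
  have e1 := nine x hx h'
  have e2 := nine _ hx' h'
  dsimp only at e2
  rcases lt_or_gt_of_ne e1 with k1 | k1
  · rcases lt_or_gt_of_ne e2 with k2 | k2
    · exact Or.inl ⟨h', r4, r1, r2, h, k1, r3, by linarith⟩
    · obtain ⟨w, hw, n, z, hc, hz, hwz⟩ := step _ hx' h' k2
      have := (cleanMap_rho_gt t).comp hc
      rw [one_mul] at this
      refine Or.inr ⟨_, ?_, n, _, z, this, hz, by rw [Function.comp_apply, hwz]; ext <;> simp⟩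
      rcases hw with rfl | rfl <;> simp [words]
  · obtain ⟨w, hw, n, z, hc⟩ := step x hx h' k1
    refine Or.inr ⟨w, ?_, n, _, z, hc⟩
    rcases hw with rfl | rfl <;> simp [words]

theorem exists_levels : ∃ (G : Set (ℝ × ℝ → ℝ × ℝ)) (T : Set (Set (ℝ × ℝ))), G.Finite ∧ T.Finite ∧
    (∀ A ∈ T, IsPreconnected A ∧ A ⊆ Per t) ∧ ∀ x ∈ Per t, (∃ A ∈ T, x ∈ A) ∨
      ∃ g ∈ G, ∃ c' c, CleanMap (2 * u ^ 2) g (Per t') (cell t' c') (Per t) (cell t c) ∧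
        ∃ y ∈ Per t' ∩ cell t' c', g y = x := by
  have hw : (words t).Finite := by simp [words]
  have hk : (Set.Iic k).Finite := finite_Iic k
  have hT : (insert (octagon t) (⋃ w ∈ words t, ⋃ i ∈ Set.Iic k,
      (fun j => w '' (psiJ u j '' unitSq t' i)) '' Set.Iic k)).Finite :=
    (hw.biUnion fun w _ => hk.biUnion fun i _ => hk.image _).insert _
  refine ⟨⋃ w ∈ words t, (fun j => w ∘ psiJ u j) '' Set.Iic k, _,
    hw.biUnion fun w _ => hk.image _,
    hT.subset (sep_subset _ fun A => IsPreconnected A ∧ A ⊆ Per t), fun A hA => hA.2, ?_⟩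
  intro x hx
  rcases R.exists_word hx with h | ⟨w, hw, n, c, z, hc, ⟨hz, hzn⟩, rfl⟩
  · exact Or.inl ⟨_, ⟨Or.inl rfl, isPreconnected_octagon t, octagon_subset_per t⟩, h⟩
  · have hz1 : z.1 + z.2 < 1 := by
      obtain _ | _ | _ := n <;> exact hzn.2.2.1
    obtain ⟨n', h⟩ := R.cover_triangle hz hz1
    rcases h with ⟨j, hj, c', hc', p, hp, rfl⟩ | ⟨i, hi, j, hj, hsub, hzm⟩
    · have hnn : n' = n := eq_of_mem_piece (hc'.mapsTo hp.2) hzn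
      subst hnn
      have := hc.comp hc'
      rw [one_mul] at this
      exact Or.inr ⟨_, mem_biUnion hw ⟨j, hj, rfl⟩, c', c, this, p, hp, rfl⟩
    · have hnn : n' = n := eq_of_mem_piece (hsub hzm).2 hzn
      subst hnn
      refine Or.inl ⟨w '' (psiJ u j '' unitSq t' i), ⟨Or.inr ?_, ?_, ?_⟩, z, hzm, rfl⟩
      · exact mem_biUnion hw (mem_biUnion hi ⟨j, hj, rfl⟩)
      · exact ((isPreconnected_unitSq t' i).image _
          (isSim_psiJ R.u_pos j).continuous.continuousOn).image _ hc.sim.continuous.continuousOn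
      · rintro _ ⟨q, hq, rfl⟩
        have := hsub hq
        exact (hc.mem_iff q (subset_closure this.2)).1 this.1

end Renorm

/-- The open trapezoid. -/
def trap (t : ℝ) : Set (ℝ × ℝ) := {p | 0 < p.2 ∧ p.2 < 1 ∧ p.2 < p.1 ∧ p.1 < 1 + t}

theorem isOpen_trap (t : ℝ) : IsOpen (trap t) := by
  simp only [trap, ofPred_and]
  repeat' apply IsOpen.inter
  all_goals exact isOpen_lt (by fun_prop) (by fun_prop)

theorem per_subset_trap (t : ℝ) : Per t ⊆ trap t := fun _ hp =>
  let h := reg_of_per hp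
  ⟨h.1, h.2.1, h.2.2.1, h.2.2.2.1⟩

theorem mem_closure_trap {t : ℝ} {p : ℝ × ℝ} (hp : p ∈ closure (trap t)) :
    0 ≤ p.2 ∧ p.2 ≤ 1 ∧ p.2 ≤ p.1 ∧ p.1 ≤ 1 + t :=
  ⟨le_of_mem_closure (fun _ hx => hx.1.le) (by fun_prop) (by fun_prop) p hp,
    le_of_mem_closure (fun _ hx => hx.2.1.le) (by fun_prop) (by fun_prop) p hp,
    le_of_mem_closure (fun _ hx => hx.2.2.1.le) (by fun_prop) (by fun_prop) p hp,
    le_of_mem_closure (fun _ hx => hx.2.2.2.le) (by fun_prop) (by fun_prop) p hp⟩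

/-- The open triangle cut off the trapezoid by the line `x + y = 1`. -/
def tri : Set (ℝ × ℝ) := {p | 0 < p.2 ∧ p.2 < p.1 ∧ p.1 + p.2 < 1}

theorem Renorm.cleanMap_psi {t u t' : ℝ} {k : ℕ} (R : Renorm t u t' k) :
    CleanMap (2 * u ^ 2) (psi u) (Per t') (trap t') (Per t) tri := by
  have hu := R.u_pos
  have hm := R.mul_eq
  have hk : (1 : ℝ) ≤ k := by exact_mod_cast R.one_le
  have hsim : IsSim (2 * u ^ 2) (psi u) :=
    ⟨u, u, 0, 0, -1, by norm_num, by positivity, by ring, fun p => by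
      simp only [psi]; ext <;> dsimp only <;> ring⟩
  refine ⟨hsim, isOpen_trap _, fun p hp => per_subset_trap _ hp.1, ?_, fun p hp => ?_⟩
  · rintro ⟨x, y⟩ ⟨h1, h2, h3, h4⟩
    dsimp only at h1 h2 h3 h4
    refine ⟨?_, ?_, ?_⟩ <;> simp only [psi]
    · exact mul_pos hu (by linarith)
    · nlinarith
    · rw [← hm]; nlinarith
  · obtain ⟨h1, h2, h3, h4⟩ := mem_closure_trap hp
    rw [← psi_mem_perQ_iff hu R.pos' R.lt_one' hm R.one_le h4 h2, R.perQ_iff']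
    simp only [psi]
    rw [← hm]; nlinarith

theorem Renorm.ratio_le {t u t' : ℝ} {k : ℕ} (R : Renorm t u t' k) : 2 * u ^ 2 ≤ 1 / 2 := by
  nlinarith [R.u_pos, R.u_lt]

theorem center_mem_per {t : ℝ} (h0 : 0 < t) : ((1 / 2 + t, 1 / 2) : ℝ × ℝ) ∈ Per t := by
  refine octagon_subset_per t ⟨?_, ?_, ?_, ?_, ?_, ?_, ?_, ?_⟩ <;> dsimp only <;> linarith

theorem infinite_components {t : ℝ} (h0 : 0 < t) (h1 : t < 1) (ht : Irrational t) :
    (connectedComponentIn (Per t) '' Per t).Infinite := by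
  intro hfin
  induction hn : (connectedComponentIn (Per t) '' Per t).ncard using Nat.strong_induction_on
    generalizing t with
  | _ n ih =>
    obtain ⟨u, t', k, R, ht'⟩ := exists_renorm h0 h1 ht
    have H := R.cleanMap_psi
    have hmem : ∀ x ∈ Per t', psi u '' connectedComponentIn (Per t') x ∈
        (connectedComponentIn (Per t) '' Per t) \
          {connectedComponentIn (Per t) (1 / 2 + t, 1 / 2)} := by
      intro x hx
      have hxt := per_subset_trap _ hx
      have hx' := (H.mem_iff x (subset_closure hxt)).1 hx
      rw [H.image_component hx hxt]
      refine ⟨⟨_, hx', rfl⟩, fun he => ?_⟩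
      rw [mem_singleton_iff, ← H.image_component hx hxt] at he
      have hc : ((1 / 2 + t, 1 / 2) : ℝ × ℝ) ∈ Per t := center_mem_per h0
      have := mem_connectedComponentIn hc
      rw [← he] at this
      obtain ⟨y, hy, hye⟩ := this
      have := H.mapsTo (H.component_subset hx hxt hy)
      rw [hye] at this
      have := this.2.2
      dsimp only at this
      linarith
    have hmaps : image (psi u) '' (connectedComponentIn (Per t') '' Per t') ⊆
        (connectedComponentIn (Per t) '' Per t) \
          {connectedComponentIn (Per t) (1 / 2 + t, 1 / 2)} := by
      rintro _ ⟨_, ⟨x, hx, rfl⟩, rfl⟩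
      exact hmem x hx
    have hinj : Function.Injective (image (psi u)) := image_injective.2 H.sim.homeo.injective
    have hfin' : (connectedComponentIn (Per t') '' Per t').Finite :=
      (hfin.subset (hmaps.trans sdiff_subset)).of_finite_image hinj.injOn
    refine ih _ ?_ R.pos' R.lt_one' ht' hfin' rfl
    rw [← hn, ← ncard_image_of_injective _ hinj]
    refine (ncard_le_ncard hmaps (hfin.subset sdiff_subset)).trans_lt ?_
    refine ncard_sdiff_singleton_lt_of_mem ⟨_, ?_, rfl⟩ hfin
    exact center_mem_per h0

theorem trap_subset_disc {t : ℝ} (h1 : t < 1) : trap t ⊆ disc 0 5 := by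
  rintro ⟨x, y⟩ ⟨h2, h3, h4, h5⟩
  dsimp only at h2 h3 h4 h5
  simp only [disc, sqN, mem_ofPred_eq, sub_zero]
  nlinarith

theorem psi_zero (u : ℝ) : psi u 0 = 0 := by simp [psi]

theorem exists_five_pow_le {r : ℝ} (hr : 0 < r) : ∃ n : ℕ, 5 * (1 / 2 : ℝ) ^ n ≤ r := by
  obtain ⟨n, hn⟩ := exists_pow_lt_of_lt_one (show 0 < r / 5 by linarith)
    (show (1 / 2 : ℝ) < 1 by norm_num)
  exact ⟨n, by linarith⟩

theorem smallAt_zero {t : ℝ} (h0 : 0 < t) (h1 : t < 1) (ht : Irrational t) :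
    SmallAt (Per t) (trap t) 0 := by
  have key : ∀ n : ℕ, ∀ t : ℝ, 0 < t → t < 1 → Irrational t →
      {N | ∃ x ∈ Per t, N = connectedComponentIn (Per t) x ∧
        N ⊆ trap t ∩ disc 0 (5 * (1 / 2 : ℝ) ^ n)}.Infinite := by
    intro n
    induction n with
    | zero =>
      intro t h0 h1 ht
      refine (infinite_components h0 h1 ht).mono ?_
      rintro _ ⟨x, hx, rfl⟩
      refine ⟨x, hx, rfl, fun y hy => ?_⟩
      have := per_subset_trap _ (connectedComponentIn_subset _ _ hy)
      exact ⟨this, by simpa using trap_subset_disc h1 this⟩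
    | succ n ih =>
      intro t h0 h1 ht
      obtain ⟨u, t', k, R, ht'⟩ := exists_renorm h0 h1 ht
      have H := R.cleanMap_psi
      rw [← psi_zero u]
      refine H.infinite_small Subset.rfl (E' := trap t) ?_ ((ih t' R.pos' R.lt_one' ht').mono ?_)
      · exact fun x hx => let h := H.mapsTo hx
          ⟨h.1, by linarith [h.1, h.2.1, h.2.2], h.2.1, by linarith [h.1, h.2.1, h.2.2]⟩
      · rintro N ⟨x, hx, rfl, hN⟩
        refine ⟨x, hx, rfl, hN.trans (inter_subset_inter_right _ (disc_subset ?_))⟩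
        rw [le_div_iff₀ H.sim.pos, pow_succ (1 / 2 : ℝ)]
        have := R.ratio_le
        have h5 : (0 : ℝ) < 5 * (1 / 2 : ℝ) ^ n := by positivity
        nlinarith
  intro r hr
  obtain ⟨n, hn⟩ := exists_five_pow_le hr
  refine (key n t h0 h1 ht).mono ?_
  rintro N ⟨x, hx, rfl, hN⟩
  exact ⟨x, hx, rfl, hN.trans (inter_subset_inter_right _ (disc_subset hn))⟩

theorem Renorm.mapsTo_psi_trap {t u t' : ℝ} {k : ℕ} (R : Renorm t u t' k) :
    MapsTo (psi u) (trap t') (trap t) := fun x hx =>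
  let h := R.cleanMap_psi.mapsTo hx
  ⟨h.1, by linarith [h.1, h.2.1, h.2.2], h.2.1, by linarith [h.1, h.2.1, h.2.2, R.pos]⟩

theorem abs_lt_of_mem_disc_zero {p : ℝ × ℝ} {d : ℝ} (hd : 0 < d) (hp : p ∈ disc 0 (d ^ 2)) :
    p.1 < d ∧ p.2 < d := by
  simp only [disc, sqN, mem_ofPred_eq, sub_zero] at hp
  exact ⟨lt_of_pow_lt_pow_left₀ 2 hd.le (by nlinarith [sq_nonneg p.2]),
    lt_of_pow_lt_pow_left₀ 2 hd.le (by nlinarith [sq_nonneg p.1])⟩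

theorem cleanMap_rho_tri (t : ℝ) :
    CleanMap 1 (fun p => (1 - p.1, p.2)) (Per t) tri (Per t) tri := by
  have hcl : ∀ p ∈ closure tri, p.2 ≤ p.1 ∧ p.1 + p.2 ≤ 1 := fun p hp =>
    ⟨le_of_mem_closure (fun _ hx => hx.2.1.le) (by fun_prop) (by fun_prop) p hp,
      le_of_mem_closure (fun _ hx => hx.2.2.le) (by fun_prop) (by fun_prop) p hp⟩
  refine ⟨isSim_rho_lt, ?_, ?_, ?_, fun p hp => rho_lt_mem_per_iff (hcl p hp).1 (hcl p hp).2⟩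
  · simp only [tri, ofPred_and]
    repeat' apply IsOpen.inter
    all_goals exact isOpen_lt (by fun_prop) (by fun_prop)
  · rintro p ⟨hp, hc⟩
    obtain ⟨h1, h2, h3, h4, h5, h6⟩ := reg_of_per hp
    exact ⟨h1, h3, lt_of_le_of_ne (hcl p hc).2 h5⟩
  · rintro ⟨x, y⟩ ⟨h1, h2, h3⟩
    dsimp only at h1 h2 h3
    refine ⟨?_, ?_, ?_⟩ <;> dsimp only <;> linarith

/-- The triangular part of the trapezoid to the left of the line `x = t`. -/
def leftTri (t : ℝ) : Set (ℝ × ℝ) := {p | 0 < p.2 ∧ p.2 < p.1 ∧ p.1 < t}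

theorem cleanMap_sig_leftTri (t : ℝ) :
    CleanMap 1 (fun p => (t - p.2, t - p.1)) (Per t) (leftTri t) (Per t) (leftTri t) := by
  have hcl : ∀ p ∈ closure (leftTri t), 0 ≤ p.2 ∧ p.1 ≤ t := fun p hp =>
    ⟨le_of_mem_closure (fun _ hx => hx.1.le) (by fun_prop) (by fun_prop) p hp,
      le_of_mem_closure (fun _ hx => hx.2.2.le) (by fun_prop) (by fun_prop) p hp⟩
  refine ⟨isSim_sig t, ?_, ?_, ?_, fun p hp => sig_lt_mem_per_iff (hcl p hp).1 (hcl p hp).2⟩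
  · simp only [leftTri, ofPred_and]
    repeat' apply IsOpen.inter
    all_goals exact isOpen_lt (by fun_prop) (by fun_prop)
  · rintro p ⟨hp, hc⟩
    obtain ⟨h1, h2, h3, h4, h5, h6⟩ := reg_of_per hp
    exact ⟨h1, h3, lt_of_le_of_ne (hcl p hc).2 h6⟩
  · rintro ⟨x, y⟩ ⟨h1, h2, h3⟩
    dsimp only at h1 h2 h3
    refine ⟨?_, ?_, ?_⟩ <;> dsimp only <;> linarith

theorem trap_inter_disc_subset_tri (t : ℝ) : trap t ∩ disc 0 ((1 / 2) ^ 2) ⊆ tri := by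
  rintro p ⟨⟨h1, h2, h3, h4⟩, hd⟩
  have := abs_lt_of_mem_disc_zero (by norm_num) hd
  exact ⟨h1, h3, by linarith⟩

theorem trap_inter_disc_subset_leftTri {t : ℝ} (h0 : 0 < t) :
    trap t ∩ disc 0 (t ^ 2) ⊆ leftTri t := by
  rintro p ⟨⟨h1, h2, h3, h4⟩, hd⟩
  exact ⟨h1, h3, (abs_lt_of_mem_disc_zero h0 hd).1⟩

theorem tri_subset_trap {t : ℝ} (h0 : 0 < t) : tri ⊆ trap t := fun _ h =>
  ⟨h.1, by linarith [h.1, h.2.1, h.2.2], h.2.1, by linarith [h.1, h.2.1, h.2.2]⟩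

theorem leftTri_subset_trap {t : ℝ} (h1 : t < 1) : leftTri t ⊆ trap t := fun _ h =>
  ⟨h.1, by linarith [h.1, h.2.1, h.2.2], h.2.1, by linarith [h.1, h.2.1, h.2.2]⟩

theorem exists_smallAt_corner {t : ℝ} (h0 : 0 < t) (h1 : t < 1) (ht : Irrational t)
    {r : ℝ} (hr : 0 < r) {A B C : ℝ} (hAB : A ≠ 0 ∨ B ≠ 0) :
    ∃ q, SmallAt (Per t) (trap t ∩ disc 0 r) q ∧ A * q.1 + B * q.2 + C ≠ 0 := by
  obtain ⟨n, hn⟩ := exists_five_pow_le hr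
  suffices h : ∃ q, SmallAt (Per t) (trap t ∩ disc 0 (5 * (1 / 2 : ℝ) ^ n)) q ∧
      A * q.1 + B * q.2 + C ≠ 0 by
    obtain ⟨q, hq, hl⟩ := h
    exact ⟨q, hq.mono_left (inter_subset_inter_right _ (disc_subset hn)), hl⟩
  clear hr hn
  induction n generalizing t A B C with
  | zero =>
    have hE : ∀ q, SmallAt (Per t) (trap t) q →
        SmallAt (Per t) (trap t ∩ disc 0 (5 * (1 / 2 : ℝ) ^ 0)) q := fun q hq =>
      hq.mono_left (by simpa using trap_subset_disc h1)
    have hz := smallAt_zero h0 h1 ht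
    have h2 := ((cleanMap_rho_tri t).smallAt
      (hz.mono (by norm_num) (trap_inter_disc_subset_tri t))).mono_left (tri_subset_trap h0)
    have h3 := ((cleanMap_sig_leftTri t).smallAt
      (hz.mono (by positivity) (trap_inter_disc_subset_leftTri h0))).mono_left
      (leftTri_subset_trap h1)
    by_contra! hcon
    have e1 := hcon _ (hE _ hz)
    have e2 := hcon _ (hE _ h2)
    have e3 := hcon _ (hE _ h3)
    simp only [Prod.fst_zero, Prod.snd_zero, mul_zero, zero_add, sub_zero, mul_one] at e1 e2 e3
    have hA : A = 0 := by linarith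
    rw [hA, e1] at e3
    have hB : B = 0 := by
      have : B * t = 0 := by linarith
      exact (mul_eq_zero.1 this).resolve_right h0.ne'
    rcases hAB with h | h <;> exact h ‹_›
  | succ n ih =>
    obtain ⟨u, t', k, R, ht'⟩ := exists_renorm h0 h1 ht
    have H := R.cleanMap_psi
    obtain ⟨A', B', C', hAB', hl⟩ := H.sim.exists_line (C := C) hAB
    obtain ⟨q, hq, hql⟩ := ih R.pos' R.lt_one' ht' (C := C') hAB'
    refine ⟨psi u q, H.smallAt_of_subset inter_subset_left ?_ hq, by rwa [← hl]⟩
    rintro x ⟨hx, hxd⟩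
    refine ⟨R.mapsTo_psi_trap hx, ?_⟩
    have hxd' : sqN (x - 0) < 5 * (1 / 2 : ℝ) ^ n := hxd
    change sqN (psi u x - 0) < _
    rw [← psi_zero u, H.sim.sqN_sub, pow_succ (1 / 2 : ℝ)]
    have := R.ratio_le
    linarith [mul_le_mul_of_nonneg_right this (sqN_nonneg (x - 0))]

theorem exists_smallAt_cell {t : ℝ} (h0 : 0 < t) (h1 : t < 1) (ht : Irrational t)
    {c : Bool × Bool} (hc : (cell t c).Nonempty) {A B C : ℝ} (hAB : A ≠ 0 ∨ B ≠ 0) :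
    ∃ q, SmallAt (Per t) (cell t c) q ∧ A * q.1 + B * q.2 + C ≠ 0 := by
  have hft : ∀ A B C : ℝ, (A ≠ 0 ∨ B ≠ 0) →
      ∃ q, SmallAt (Per t) (cell t (false, true)) q ∧ A * q.1 + B * q.2 + C ≠ 0 := by
    intro A B C hAB
    have H := cleanMap_rho_tri t
    obtain ⟨A', B', C', hAB', hl⟩ := H.sim.exists_line (C := C) hAB
    have hd : 0 < min (1 / 2) (1 - t) := lt_min (by norm_num) (by linarith)
    obtain ⟨q, hq, hql⟩ := exists_smallAt_corner h0 h1 ht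
      (r := (min (1 / 2) (1 - t)) ^ 2) (by positivity) (C := C') hAB'
    refine ⟨_, H.smallAt_of_subset ?_ ?_ hq, by rwa [← hl]⟩
    · rintro p ⟨⟨h1, h2, h3, h4⟩, hd'⟩
      have := abs_lt_of_mem_disc_zero hd hd'
      have := min_le_left (1 / 2) (1 - t)
      exact ⟨h1, h3, by linarith⟩
    · rintro ⟨x, y⟩ ⟨⟨h1, h2, h3, h4⟩, hd'⟩
      have := abs_lt_of_mem_disc_zero hd hd'
      dsimp only at h1 h2 h3 h4 this
      have := min_le_left (1 / 2) (1 - t)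
      have := min_le_right (1 / 2) (1 - t)
      refine ⟨?_, ?_, ?_, ?_, ?_, ?_⟩ <;> simp only [cond_true, cond_false] <;> linarith
  obtain ⟨_ | _, _ | _⟩ := c
  · have H := cleanMap_sig_gt h0
    obtain ⟨A', B', C', hAB', hl⟩ := H.sim.exists_line (C := C) hAB
    obtain ⟨q, hq, hql⟩ := hft _ _ C' hAB'
    exact ⟨_, H.smallAt hq, by rwa [← hl]⟩
  · exact hft _ _ _ hAB
  · have hth : 0 < 2 * t - 1 := by
      obtain ⟨p, k1, k2, k3, k4, k5, k6⟩ := hc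
      simp only [cond_true, cond_false] at k5 k6
      linarith
    have H := cleanMap_sig_leftTri t
    obtain ⟨A', B', C', hAB', hl⟩ := H.sim.exists_line (C := C) hAB
    obtain ⟨q, hq, hql⟩ := exists_smallAt_corner h0 h1 ht
      (r := ((2 * t - 1) / 2) ^ 2) (by positivity) (C := C') hAB'
    refine ⟨_, H.smallAt_of_subset ?_ ?_ hq, by rwa [← hl]⟩
    · rintro p ⟨⟨h1, h2, h3, h4⟩, hd'⟩
      have := abs_lt_of_mem_disc_zero (by linarith) hd'
      exact ⟨h1, h3, by linarith⟩
    · rintro ⟨x, y⟩ ⟨⟨h1, h2, h3, h4⟩, hd'⟩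
      have := abs_lt_of_mem_disc_zero (by linarith) hd'
      dsimp only at h1 h2 h3 h4 this
      refine ⟨?_, ?_, ?_, ?_, ?_, ?_⟩ <;> simp only [cond_true, cond_false] <;> linarith
  · have hd : 0 < min (1 / 2) t := lt_min (by norm_num) h0
    obtain ⟨q, hq, hql⟩ := exists_smallAt_corner h0 h1 ht
      (r := (min (1 / 2) t) ^ 2) (by positivity) (C := C) hAB
    refine ⟨q, hq.mono_left ?_, hql⟩
    rintro p ⟨⟨h1, h2, h3, h4⟩, hd'⟩
    have := abs_lt_of_mem_disc_zero hd hd'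
    have := min_le_left (1 / 2) t
    have := min_le_right (1 / 2) t
    refine ⟨h1, h2, h3, h4, ?_, ?_⟩ <;> simp only [cond_true] <;> linarith

theorem exists_smallAt_near {t : ℝ} (h0 : 0 < t) (h1 : t < 1) (ht : Irrational t)
    {c : Bool × Bool} {p : ℝ × ℝ} (hp : MeetsAt (Per t) (cell t c) p) {r : ℝ} (hr : 0 < r)
    {A B C : ℝ} (hAB : A ≠ 0 ∨ B ≠ 0) :
    ∃ q, SmallAt (Per t) (cell t c) q ∧ sqN (q - p) ≤ r ∧ A * q.1 + B * q.2 + C ≠ 0 := by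
  obtain ⟨n, hn⟩ := exists_five_pow_le hr
  suffices h : ∃ q, SmallAt (Per t) (cell t c) q ∧ sqN (q - p) ≤ 5 * (1 / 2 : ℝ) ^ n ∧
      A * q.1 + B * q.2 + C ≠ 0 by
    obtain ⟨q, hq, hd, hl⟩ := h
    exact ⟨q, hq, hd.trans hn, hl⟩
  clear hr hn
  induction n generalizing t c p A B C with
  | zero =>
    obtain ⟨q, hq, hql⟩ := exists_smallAt_cell h0 h1 ht hp.nonempty (C := C) hAB
    refine ⟨q, hq, ?_, hql⟩
    obtain ⟨a1, a2, a3, a4, -, -⟩ := mem_closure_cell hp.mem_closure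
    obtain ⟨b1, b2, b3, b4, -, -⟩ := mem_closure_cell hq.meetsAt.mem_closure
    simp only [sqN, Prod.fst_sub, Prod.snd_sub, pow_zero, mul_one]
    have e1 : (q.1 - p.1) ^ 2 ≤ 2 ^ 2 := by
      apply sq_le_sq'  <;> linarith
    have e2 : (q.2 - p.2) ^ 2 ≤ 1 ^ 2 := by
      apply sq_le_sq'  <;> linarith
    linarith
  | succ n ih =>
    obtain ⟨u, t', k, R, ht'⟩ := exists_renorm h0 h1 ht
    obtain ⟨G, T, hG, hT, hTc, hcov⟩ := R.exists_levels
    set E : Set (Set (ℝ × ℝ)) := {E | ∃ g c', (g ∈ G ∧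
      CleanMap (2 * u ^ 2) g (Per t') (cell t' c') (Per t) (cell t c)) ∧ g '' cell t' c' = E}
      with hE
    have hEf : E.Finite := by
      refine (hG.biUnion (t := fun g => range fun c' => g '' cell t' c')
        fun g _ => finite_range _).subset ?_
      rintro _ ⟨g, c', ⟨hg, -⟩, rfl⟩
      exact mem_biUnion hg ⟨c', rfl⟩
    have hc : Per t ∩ cell t c ⊆ ⋃₀ T ∪ ⋃₀ E := by
      rintro x ⟨hx, hxc⟩
      rcases hcov x hx with ⟨A, hA, hxA⟩ | ⟨g, hg, c', c₂, H, y, ⟨hy, hyc⟩, rfl⟩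
      · exact Or.inl ⟨A, hA, hxA⟩
      · obtain rfl := eq_of_mem_cell (H.mapsTo hyc) hxc
        exact Or.inr ⟨_, ⟨g, c', ⟨hg, H⟩, rfl⟩, y, hyc, rfl⟩
    obtain ⟨_, ⟨g, c', ⟨hg, H⟩, rfl⟩, hm⟩ := hp.pigeonhole hT hEf hTc hc
    obtain ⟨p', rfl, hp'⟩ := H.exists_meetsAt hm
    obtain ⟨A', B', C', hAB', hl⟩ := H.sim.exists_line (C := C) hAB
    obtain ⟨q, hq, hqd, hql⟩ := ih R.pos' R.lt_one' ht' hp' (C := C') hAB'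
    refine ⟨g q, H.smallAt hq, ?_, by rwa [← hl]⟩
    rw [H.sim.sqN_sub, pow_succ (1 / 2 : ℝ)]
    have := R.ratio_le
    linarith [mul_le_mul_of_nonneg_right this (sqN_nonneg (q - p')), sqN_nonneg (q - p')]

theorem exists_smallAt_off_lines {t : ℝ} (h0 : 0 < t) (h1 : t < 1) (ht : Irrational t)
    {c : Bool × Bool} {p : ℝ × ℝ} (hp : MeetsAt (Per t) (cell t c) p) {U : Set (ℝ × ℝ)}
    (hU : U ∈ 𝓝 p) (L : List (ℝ × ℝ × ℝ)) (hL : ∀ l ∈ L, l.1 ≠ 0 ∨ l.2.1 ≠ 0) :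
    ∃ q ∈ U, SmallAt (Per t) (cell t c) q ∧ ∀ l ∈ L, l.1 * q.1 + l.2.1 * q.2 + l.2.2 ≠ 0 := by
  induction L generalizing p U with
  | nil =>
    obtain ⟨r, hr, hrU⟩ := exists_disc_subset hU
    obtain ⟨q, hq, hd, -⟩ := exists_smallAt_near h0 h1 ht hp (half_pos hr) (A := 1) (B := 0)
      (C := 0) (Or.inl one_ne_zero)
    exact ⟨q, hrU (show sqN _ < r by linarith), hq, by simp⟩
  | cons l L ih =>
    obtain ⟨r, hr, hrU⟩ := exists_disc_subset hU
    obtain ⟨q, hq, hd, hl⟩ := exists_smallAt_near h0 h1 ht hp (half_pos hr) (C := l.2.2)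
      (hL l (by simp))
    have hV : U ∩ {x : ℝ × ℝ | l.1 * x.1 + l.2.1 * x.2 + l.2.2 ≠ 0} ∈ 𝓝 q := by
      refine inter_mem (mem_of_superset ((isOpen_disc p r).mem_nhds
        (show sqN _ < r by linarith)) hrU) (IsOpen.mem_nhds ?_ hl)
      exact isOpen_ne_fun (by fun_prop) (by fun_prop)
    obtain ⟨q', hq', hs, hoff⟩ := ih hq.meetsAt hV fun l' h' => hL l' (by simp [h'])
    refine ⟨q', hq'.1, hs, fun l' h' => ?_⟩
    rcases List.mem_cons.1 h' with rfl | h'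
    · exact hq'.2
    · exact hoff l' h'

/-- A similarity image of a point where cells of `W` accumulate is approximated by points
with arbitrarily small components, off any given finite family of lines. -/
theorem CleanMap.exists_smallAt_off_lines {t κ : ℝ} {h : ℝ × ℝ → ℝ × ℝ} {c : Bool × Bool}
    {W D : Set (ℝ × ℝ)} (H : CleanMap κ h (Per t) (cell t c) W D) (h0 : 0 < t) (h1 : t < 1)
    (ht : Irrational t) {p : ℝ × ℝ} (hp : MeetsAt W (h '' cell t c) p) {U : Set (ℝ × ℝ)}
    (hU : U ∈ 𝓝 p) (L : List (ℝ × ℝ × ℝ)) (hL : ∀ l ∈ L, l.1 ≠ 0 ∨ l.2.1 ≠ 0) :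
    ∃ q ∈ U, SmallAt W D q ∧ ∀ l ∈ L, l.1 * q.1 + l.2.1 * q.2 + l.2.2 ≠ 0 := by
  obtain ⟨p', rfl, hp'⟩ := H.exists_meetsAt hp
  have key : ∀ l : ℝ × ℝ × ℝ, (l.1 ≠ 0 ∨ l.2.1 ≠ 0) → ∃ l' : ℝ × ℝ × ℝ,
      (l'.1 ≠ 0 ∨ l'.2.1 ≠ 0) ∧ ∀ p : ℝ × ℝ, l'.1 * p.1 + l'.2.1 * p.2 + l'.2.2 =
        l.1 * (h p).1 + l.2.1 * (h p).2 + l.2.2 := by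
    intro l hl
    obtain ⟨A, B, C, h1, h2⟩ := H.sim.exists_line (C := l.2.2) hl
    exact ⟨(A, B, C), h1, h2⟩
  choose! f hf1 hf2 using key
  obtain ⟨q, hq, hs, hoff⟩ := _root_.exists_smallAt_off_lines h0 h1 ht hp'
    (H.sim.continuous.continuousAt.preimage_mem_nhds hU) (L.map f) (by
      intro l' hl'
      obtain ⟨l, hl, rfl⟩ := List.mem_map.1 hl'
      exact hf1 l (hL l hl))
  refine ⟨h q, hq, H.smallAt hs, fun l hl => ?_⟩
  rw [← hf2 l (hL l hl)]
  exact hoff _ (List.mem_map_of_mem hl)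

/-- The parallelogram `X_s` in rescaled coordinates. -/
def strip (M : ℝ) : Set (ℝ × ℝ) := {p | 0 < p.2 ∧ p.2 < 1 ∧ p.2 < p.1 ∧ p.1 < p.2 + 2 * M}

/-- The rescaled half-step map, as a relation. -/
def GRel (M : ℝ) (p q : ℝ × ℝ) : Prop :=
  ∃ m n : ℤ, q.1 = p.2 + M + n ∧ q.2 = 1 - p.1 + M + n - 2 * m * M

/-- The point reflection of the rescaled parallelogram. -/
def nu (M : ℝ) (p : ℝ × ℝ) : ℝ × ℝ := (1 + 2 * M - p.1, 1 - p.2)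

/-- The periodic points of the rescaled half-step map. -/
def PM (M : ℝ) : Set (ℝ × ℝ) :=
  {x | ∃ O : Set (ℝ × ℝ), O.Finite ∧ x ∈ O ∧
    ∀ p ∈ O, p ∈ strip M ∧ nu M p ∈ O ∧ ∃ q ∈ O, GRel M p q}

theorem nu_nu (M : ℝ) (p : ℝ × ℝ) : nu M (nu M p) = p := by ext <;> simp [nu]

theorem nu_mem_PM {M : ℝ} {p : ℝ × ℝ} (h : p ∈ PM M) : nu M p ∈ PM M := by
  obtain ⟨O, hf, hp, hO⟩ := h
  exact ⟨O, hf, (hO p hp).2.1, hO⟩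

theorem nu_mem_PM_iff {M : ℝ} {p : ℝ × ℝ} : nu M p ∈ PM M ↔ p ∈ PM M :=
  ⟨fun h => by simpa [nu_nu] using nu_mem_PM h, nu_mem_PM⟩

theorem nu_mem_strip {M : ℝ} {p : ℝ × ℝ} (h : p ∈ strip M) : nu M p ∈ strip M := by
  obtain ⟨h1, h2, h3, h4⟩ := h
  refine ⟨?_, ?_, ?_, ?_⟩ <;> simp only [nu] <;> linarith

theorem GRel.nu {M : ℝ} {p q : ℝ × ℝ} (h : GRel M p q) : GRel M (nu M p) (nu M q) := by
  obtain ⟨m, n, h1, h2⟩ := h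
  refine ⟨-m, -n, ?_, ?_⟩ <;> simp only [_root_.nu, h1, h2] <;> push_cast <;> ring

theorem int_eq_zero_of_lt {c : ℝ} {n : ℤ} (h1 : -c < n * c) (h2 : n * c < c) : n = 0 := by
  have hc : 0 < c := by linarith
  have h3 : (-1 : ℝ) < n := by nlinarith
  have h4 : (n : ℝ) < 1 := by nlinarith
  have h3' : -1 < n := by exact_mod_cast h3
  have h4' : n < 1 := by exact_mod_cast h4
  omega

theorem GRel.left_unique {M : ℝ} {p p' q : ℝ × ℝ} (h : GRel M p q) (h' : GRel M p' q)
    (hp : p ∈ strip M) (hp' : p' ∈ strip M) : p = p' := by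
  obtain ⟨m, n, h1, h2⟩ := h
  obtain ⟨m', n', h1', h2'⟩ := h'
  obtain ⟨a1, a2, a3, a4⟩ := hp
  obtain ⟨b1, b2, b3, b4⟩ := hp'
  have e1 : n - n' = 0 := by
    apply int_eq_zero_of_lt (c := 1) <;> push_cast <;> linarith
  have e1' : (n : ℝ) = n' := by exact_mod_cast (sub_eq_zero.1 e1)
  have e2 : p.2 = p'.2 := by linarith
  have e3 : m - m' = 0 := by
    apply int_eq_zero_of_lt (c := 2 * M) <;> push_cast <;> linarith
  have e3' : (m : ℝ) = m' := by exact_mod_cast (sub_eq_zero.1 e3)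
  rw [e3'] at h2
  exact Prod.ext (by linarith) e2

/-- An injective relation on a finite set that is total is surjective. -/
theorem exists_preimage_of_finite {α : Type*} {O : Set α} (hO : O.Finite) {r : α → α → Prop}
    (h : ∀ p ∈ O, ∃ q ∈ O, r p q) (hr : ∀ p ∈ O, ∀ p' ∈ O, ∀ q, r p q → r p' q → p = p') :
    ∀ q ∈ O, ∃ p ∈ O, r p q := by
  choose! f hf hfr using h
  have hinj : InjOn f O := fun p hp p' hp' he =>
    hr p hp p' hp' (f p) (hfr p hp) (by rw [he]; exact hfr p' hp')
  have hs : f '' O = O := Set.eq_of_subset_of_ncard_le (image_subset_iff.2 hf)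
    (by rw [hinj.ncard_image]) hO
  intro q hq
  rw [← hs] at hq
  obtain ⟨p, hp, rfl⟩ := hq
  exact ⟨p, hp, hfr p hp⟩

theorem fst_ne_of_mem_PM {M : ℝ} {x : ℝ × ℝ} (hx : x ∈ PM M) (i : ℤ) : x.1 ≠ M + i := by
  obtain ⟨O, hf, hx, hO⟩ := hx
  obtain ⟨p, hp, m, n, h1, -⟩ := exists_preimage_of_finite hf (fun p hp => (hO p hp).2.2)
    (fun p hp p' hp' q h h' => h.left_unique h' (hO p hp).1 (hO p' hp').1) x hx
  intro he
  obtain ⟨h2, h3, -, -⟩ := (hO p hp).1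
  have h4 : (0 : ℝ) < (i - n : ℤ) := by push_cast; linarith
  have h5 : ((i - n : ℤ) : ℝ) < 1 := by push_cast; linarith
  have h4' : 0 < i - n := by exact_mod_cast h4
  have h5' : i - n < 1 := by exact_mod_cast h5
  omega

theorem PM_subset_strip (M : ℝ) : PM M ⊆ strip M := fun x ⟨_, _, hx, hO⟩ => (hO x hx).1

theorem GRel.cases_of_lt {M : ℝ} {p q : ℝ × ℝ} (h : GRel M p q) (hq : q ∈ strip M)
    (h1 : -(2 * M) < p.1 + p.2 - 1) (h2 : p.1 + p.2 - 1 < 2 * M) : ∃ n : ℤ,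
    (1 < p.1 + p.2 ∧ q.1 = p.2 + M + n ∧ q.2 = 1 - p.1 + M + n) ∨
    (p.1 + p.2 < 1 ∧ q.1 = p.2 + M + n ∧ q.2 = 1 - p.1 - M + n) := by
  obtain ⟨m, n, e1, e2⟩ := h
  obtain ⟨k1, k2, k3, k4⟩ := hq
  have hM : 0 < 2 * M := by linarith
  have h3 : -1 < (m : ℝ) := by nlinarith
  have h4 : (m : ℝ) < 2 := by nlinarith
  have h3' : -1 < m := by exact_mod_cast h3
  have h4' : m < 2 := by exact_mod_cast h4
  refine ⟨n, ?_⟩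
  obtain rfl | rfl : m = 0 ∨ m = 1 := by omega
  · left; push_cast at *; refine ⟨?_, ?_, ?_⟩ <;> linarith
  · right; push_cast at *; refine ⟨?_, ?_, ?_⟩ <;> linarith

theorem union_image_closed {α : Type*} {ρ σ : α → α} {S : Set α} (hS : S.Finite)
    (hρ : ∀ z ∈ S, ρ (ρ z) = z) (hσ : ∀ z ∈ S, σ (σ (ρ z)) = ρ z) (hT : ∀ z ∈ S, σ (ρ z) ∈ S) :
    ∀ x ∈ S ∪ ρ '' S, ρ x ∈ S ∪ ρ '' S ∧ σ x ∈ S ∪ ρ '' S := by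
  have hinv := exists_preimage_of_finite hS (r := fun z w => σ (ρ z) = w)
    (fun z hz => ⟨_, hT z hz, rfl⟩) (fun z hz z' hz' w h h' => by
      rw [← hρ z hz, ← hσ z hz, h, ← h', hσ z' hz', hρ z' hz'])
  rintro _ (hx | ⟨z, hz, rfl⟩)
  · rename_i x
    refine ⟨Or.inr ⟨x, hx, rfl⟩, ?_⟩
    obtain ⟨w, hw, rfl⟩ := hinv x hx
    rw [hσ w hw]
    exact Or.inr ⟨w, hw, rfl⟩
  · rw [hρ z hz]
    exact ⟨Or.inl hz, Or.inl (hT z hz)⟩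

theorem sigF_sigF {t : ℝ} {p : ℝ × ℝ} (h : Reg t p) : sigF t (sigF t p) = p := by
  obtain ⟨x, y⟩ := p
  obtain ⟨h1, h2, h3, h4, h5, h6⟩ := h
  dsimp only at *
  rcases lt_or_gt_of_ne h6 with h | h
  · rw [sigF_lt h, sigF_lt (by linarith)]; ext <;> dsimp only <;> ring
  · rw [sigF_gt h, sigF_gt (by linarith)]; ext <;> dsimp only <;> ring

theorem rhoF_rhoF {t : ℝ} {p : ℝ × ℝ} (h : Reg t p) : rhoF (rhoF p) = p := by
  obtain ⟨x, y⟩ := p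
  obtain ⟨h1, h2, h3, h4, h5, h6⟩ := h
  dsimp only at *
  rcases lt_or_gt_of_ne h5 with h | h
  · rw [rhoF_lt h, rhoF_lt (by linarith)]; ext <;> dsimp only <;> ring
  · rw [rhoF_gt h, rhoF_gt (by linarith)]; ext <;> dsimp only <;> ring

theorem Reg.rhoF {t : ℝ} {p : ℝ × ℝ} (h : Reg t p) (h0 : 0 < t)
    (ht : p.1 + p.2 < 1 → p.1 + t ≠ 1) : Reg t (rhoF p) := by
  obtain ⟨x, y⟩ := p
  obtain ⟨h1, h2, h3, h4, h5, h6⟩ := h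
  dsimp only at *
  rcases lt_or_gt_of_ne h5 with h | h
  · rw [rhoF_lt h]
    refine ⟨?_, ?_, ?_, ?_, ?_, ?_⟩ <;> dsimp only <;> try linarith
    exact fun h' => ht h (by linarith)
  · rw [rhoF_gt h]
    refine ⟨?_, ?_, ?_, ?_, ?_, ?_⟩ <;> dsimp only <;> try linarith
    exact h6

theorem subset_per_of_return {t : ℝ} (h0 : 0 < t) {S : Set (ℝ × ℝ)} (hS : S.Finite)
    (h : ∀ z ∈ S, Reg t z ∧ (z.1 + z.2 < 1 → z.1 + t ≠ 1) ∧ sigF t (rhoF z) ∈ S) : S ⊆ Per t := by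
  intro x hx
  have hcl := union_image_closed hS (fun z hz => rhoF_rhoF (h z hz).1)
    (fun z hz => sigF_sigF ((h z hz).1.rhoF h0 (h z hz).2.1)) (fun z hz => (h z hz).2.2)
  refine ⟨S ∪ rhoF '' S, hS.union (hS.image _), Or.inl hx, fun z hz => ⟨?_, hcl z hz⟩⟩
  rcases hz with hz | ⟨w, hw, rfl⟩
  · exact (h z hz).1
  · exact (h w hw).1.rhoF h0 (h w hw).2.1

theorem sigF_rhoF_cases {t : ℝ} {p : ℝ × ℝ} (h : Reg t p) (ht : p.1 + p.2 < 1 → p.1 + t ≠ 1) :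
    (1 < p.1 + p.2 ∧ t < p.1 ∧ sigF t (rhoF p) = (p.2 + t, 1 - p.1 + t)) ∨
    (1 < p.1 + p.2 ∧ p.1 < t ∧ sigF t (rhoF p) = (p.2 + t - 1, t - p.1)) ∨
    (p.1 + p.2 < 1 ∧ p.1 + t < 1 ∧ sigF t (rhoF p) = (1 + t - p.2, p.1 + t)) ∨
    (p.1 + p.2 < 1 ∧ 1 < p.1 + t ∧ sigF t (rhoF p) = (t - p.2, p.1 + t - 1)) := by
  obtain ⟨x, y⟩ := p
  obtain ⟨h1, h2, h3, h4, h5, h6⟩ := h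
  dsimp only at *
  rcases lt_or_gt_of_ne h5 with h | h
  · rcases lt_or_gt_of_ne (ht h) with h' | h'
    · refine Or.inr (Or.inr (Or.inl ⟨h, h', ?_⟩))
      rw [rhoF_lt h, sigF_gt (by linarith)]; ext <;> dsimp only <;> ring
    · refine Or.inr (Or.inr (Or.inr ⟨h, h', ?_⟩))
      rw [rhoF_lt h, sigF_lt (by linarith)]; ext <;> dsimp only <;> ring
  · rcases lt_or_gt_of_ne h6 with h' | h'
    · refine Or.inr (Or.inl ⟨h, h', ?_⟩)
      rw [rhoF_gt h, sigF_lt (by linarith)]; ext <;> dsimp only <;> ring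
    · refine Or.inl ⟨h, h', ?_⟩
      rw [rhoF_gt h, sigF_gt (by linarith)]; ext <;> dsimp only <;> ring

theorem Reg.mem_strip {t M : ℝ} {p : ℝ × ℝ} (h : Reg t p) (hM : p.1 < p.2 + 2 * M) :
    p ∈ strip M := ⟨h.1, h.2.1, h.2.2.1, hM⟩

theorem add_ne_one_of_per {t : ℝ} {p : ℝ × ℝ} (h : p ∈ Per t) (hp : p.1 + p.2 < 1) :
    p.1 + t ≠ 1 := by
  have h := (reg_of_per (rhoF_mem_per h)).2.2.2.2.2
  rw [← Prod.eta p, rhoF_lt hp] at h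
  exact fun h' => h (by dsimp only; linarith)

theorem mem_PM_of_return {M : ℝ} {S : Set (ℝ × ℝ)} (hS : S.Finite)
    (h : ∀ z ∈ S, z ∈ strip M ∧ ∃ q ∈ S, GRel M z q ∨ GRel M z (nu M q)) : S ⊆ PM M := by
  intro x hx
  refine ⟨S ∪ nu M '' S, hS.union (hS.image _), Or.inl hx, ?_⟩
  rintro p (hp | ⟨z, hz, rfl⟩)
  · obtain ⟨h1, q, hq, h2⟩ := h p hp
    refine ⟨h1, Or.inr ⟨p, hp, rfl⟩, ?_⟩
    rcases h2 with h2 | h2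
    · exact ⟨q, Or.inl hq, h2⟩
    · exact ⟨_, Or.inr ⟨q, hq, rfl⟩, h2⟩
  · obtain ⟨h1, q, hq, h2⟩ := h z hz
    refine ⟨nu_mem_strip h1, Or.inl (by rwa [nu_nu]), ?_⟩
    rcases h2 with h2 | h2
    · exact ⟨_, Or.inr ⟨q, hq, rfl⟩, h2.nu⟩
    · exact ⟨q, Or.inl hq, by simpa [nu_nu] using h2.nu⟩

theorem per_subset_PM {t : ℝ} (h0 : 0 < t) {k : ℕ} (hk : 1 ≤ k) : Per t ⊆ PM (k + t) := by
  have hk' : (1 : ℝ) ≤ k := by exact_mod_cast hk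
  intro x ⟨S, hf, hx, hS⟩
  refine mem_PM_of_return hf (fun z hz => ?_) hx
  have hz' : z ∈ Per t := ⟨S, hf, hz, hS⟩
  obtain ⟨hreg, hr, -⟩ := hS z hz
  have hT := (hS _ hr).2.2
  refine ⟨hreg.mem_strip (by linarith [hreg.1, hreg.2.2.2.1]), _, hT, ?_⟩
  rcases sigF_rhoF_cases hreg (add_ne_one_of_per hz') with h | h | h | h <;> rw [h.2.2]
  · exact Or.inl ⟨0, -k, by push_cast; ring, by push_cast; ring⟩
  · exact Or.inl ⟨0, -k - 1, by push_cast; ring, by push_cast; ring⟩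
  · exact Or.inr ⟨1, k, by simp only [nu]; push_cast; ring, by simp only [nu]; push_cast; ring⟩
  · exact Or.inr ⟨1, k + 1, by simp only [nu]; push_cast; ring, by simp only [nu]; push_cast; ring⟩

theorem int_add_eq_zero {a : ℝ} {n : ℤ} (h1 : 0 ≤ a) (h2 : a ≤ 1) (h3 : 0 < a + n)
    (h4 : a + n < 1) : n = 0 := by
  have h5 : (-1 : ℝ) < n := by linarith
  have h6 : (n : ℝ) < 1 := by linarith
  have h5' : -1 < n := by exact_mod_cast h5
  have h6' : n < 1 := by exact_mod_cast h6
  omega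

theorem mem_per_of_mem_PM {t : ℝ} (h0 : 0 < t) (h1 : t < 1) {k : ℕ} (hk : 1 ≤ k) {x : ℝ × ℝ}
    (hx : x ∈ PM (k + t)) (hx1 : x.1 ≤ 1 + t) : x ∈ Per t := by
  have hk' : (1 : ℝ) ≤ k := by exact_mod_cast hk
  have hx1 : x.1 < 1 + t := lt_of_le_of_ne hx1 fun h =>
    fst_ne_of_mem_PM hx (1 - k) (by rw [h]; push_cast; ring)
  obtain ⟨O, hf, hxO, hO⟩ := hx
  refine subset_per_of_return h0 (S := {z ∈ O | z.1 < 1 + t}) (hf.subset (sep_subset _ _)) ?_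
    ⟨hxO, hx1⟩
  rintro z ⟨hz, hz1⟩
  have hzt : z.1 ≠ t := fun h => fst_ne_of_mem_PM ⟨O, hf, hz, hO⟩ (-k) (by rw [h]; push_cast; ring)
  obtain ⟨⟨a1, a2, a3, a4⟩, -, q, hq, hzq⟩ := hO z hz
  obtain ⟨⟨b1, b2, b3, b4⟩, hnu, -⟩ := hO q hq
  have hst : q ∈ strip (k + t) := ⟨b1, b2, b3, b4⟩
  obtain ⟨n, ⟨e0, e1, e2⟩ | ⟨e0, e1, e2⟩⟩ := hzq.cases_of_lt hst (by linarith) (by linarith)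
  · have hreg : Reg t z := ⟨a1, a2, a3, hz1, e0.ne', hzt⟩
    refine ⟨hreg, fun h => by linarith, ?_⟩
    rcases sigF_rhoF_cases hreg (fun h => by linarith) with ⟨c1, c2, c3⟩ | ⟨c1, c2, c3⟩ | h | h
    · have hn : n + k = 0 := int_add_eq_zero (a := 1 - z.1 + t) (by linarith) (by linarith)
        (by push_cast; linarith) (by push_cast; linarith)
      have hn' : (n : ℝ) + k = 0 := by exact_mod_cast hn
      have : q = sigF t (rhoF z) := by
        rw [c3]; ext <;> dsimp only <;> linarith
      exact this ▸ ⟨hq, by linarith⟩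
    · have hn : n + k + 1 = 0 := int_add_eq_zero (a := t - z.1) (by linarith) (by linarith)
        (by push_cast; linarith) (by push_cast; linarith)
      have hn' : (n : ℝ) + k + 1 = 0 := by exact_mod_cast hn
      have : q = sigF t (rhoF z) := by
        rw [c3]; ext <;> dsimp only <;> linarith
      exact this ▸ ⟨hq, by linarith⟩
    · linarith
    · linarith
  · have hreg : Reg t z := ⟨a1, a2, a3, hz1, e0.ne, hzt⟩
    have hne : z.1 + t ≠ 1 := fun h => by
      have hn : n - k = 0 := int_add_eq_zero (a := 0) le_rfl (by linarith)
        (by push_cast; linarith) (by push_cast; linarith)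
      have hn' : (n : ℝ) - k = 0 := by exact_mod_cast hn
      linarith
    refine ⟨hreg, fun _ => hne, ?_⟩
    rcases sigF_rhoF_cases hreg (fun _ => hne) with h | h | ⟨c1, c2, c3⟩ | ⟨c1, c2, c3⟩
    · linarith
    · linarith
    · have hn : n - k = 0 := int_add_eq_zero (a := 1 - z.1 - t) (by linarith) (by linarith)
        (by push_cast; linarith) (by push_cast; linarith)
      have hn' : (n : ℝ) - k = 0 := by exact_mod_cast hn
      have : nu (k + t) q = sigF t (rhoF z) := by
        rw [c3]; ext <;> simp only [nu] <;> linarith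
      exact this ▸ ⟨hnu, by simp only [nu]; linarith⟩
    · have hn : n - k - 1 = 0 := int_add_eq_zero (a := 2 - z.1 - t) (by linarith) (by linarith)
        (by push_cast; linarith) (by push_cast; linarith)
      have hn' : (n : ℝ) - k - 1 = 0 := by exact_mod_cast hn
      have : nu (k + t) q = sigF t (rhoF z) := by
        rw [c3]; ext <;> simp only [nu] <;> linarith
      exact this ▸ ⟨hnu, by simp only [nu]; linarith⟩

theorem per_subset_PM_of_gt {t : ℝ} (h0 : 1 / 2 < t) (h1 : t < 1) {x : ℝ × ℝ} (hx : x ∈ Per t)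
    (hx1 : x.1 ≤ t ∨ x.1 + x.2 ≤ 1) : x ∈ PM t := by
  have hx1 : x.1 < t ∨ x.1 + x.2 < 1 := by
    obtain ⟨-, -, -, -, h5, h6⟩ := reg_of_per hx
    exact hx1.imp (lt_of_le_of_ne · h6) (lt_of_le_of_ne · h5)
  obtain ⟨S, hf, hxS, hS⟩ := hx
  refine mem_PM_of_return (S := {z ∈ S | z.1 < t ∨ z.1 + z.2 < 1}) (hf.subset (sep_subset _ _))
    ?_ ⟨hxS, hx1⟩
  rintro z ⟨hz, hz1⟩
  have hz' : z ∈ Per t := ⟨S, hf, hz, hS⟩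
  obtain ⟨hreg, hr, -⟩ := hS z hz
  have hT := (hS _ hr).2.2
  obtain ⟨a1, a2, a3, a4, a5, a6⟩ := id hreg
  refine ⟨hreg.mem_strip (by rcases hz1 with h | h <;> linarith), ?_⟩
  rcases sigF_rhoF_cases hreg (add_ne_one_of_per hz') with
    ⟨c1, c2, c3⟩ | ⟨c1, c2, c3⟩ | ⟨c1, c2, c3⟩ | ⟨c1, c2, c3⟩ <;> rw [c3] at hT
  · exfalso; rcases hz1 with h | h <;> linarith
  · exact ⟨_, ⟨hT, Or.inl (by dsimp only; linarith)⟩,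
      Or.inl ⟨0, -1, by push_cast; ring, by push_cast; ring⟩⟩
  · have hρ := (hS _ hT).2.1
    rw [rhoF_gt (by linarith)] at hρ
    have hσ := (hS _ hρ).2.2
    rw [sigF_gt (by linarith)] at hσ
    have hρ' := (hS _ hσ).2.1
    rw [rhoF_gt (by linarith)] at hρ'
    have hσ' := (hS _ hρ').2.2
    rw [sigF_gt (by linarith)] at hσ'
    exact ⟨_, ⟨hσ', Or.inr (by dsimp only; linarith)⟩,
      Or.inl ⟨1, 0, by push_cast; ring, by push_cast; ring⟩⟩
  · exact ⟨_, ⟨hT, Or.inl (by dsimp only; linarith)⟩, Or.inr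
      ⟨1, 1, by simp only [nu]; push_cast; ring, by simp only [nu]; push_cast; ring⟩⟩

/-- The second reflection of the trapezoid without its octagon. -/
def sigE (t : ℝ) (p : ℝ × ℝ) : ℝ × ℝ :=
  if p.1 < t then (t - p.2, t - p.1) else (p.2 + t, p.1 - t)

theorem sigE_lt {t x y : ℝ} (h : x < t) : sigE t (x, y) = (t - y, t - x) := if_pos h
theorem sigE_gt {t x y : ℝ} (h : t < x) : sigE t (x, y) = (y + t, x - t) := if_neg h.not_gt

theorem sigE_sigE {t : ℝ} {p : ℝ × ℝ} (h : Reg t p) : sigE t (sigE t p) = p := by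
  obtain ⟨x, y⟩ := p
  obtain ⟨h1, h2, h3, h4, h5, h6⟩ := h
  dsimp only at *
  rcases lt_or_gt_of_ne h6 with h | h
  · rw [sigE_lt h, sigE_lt (by linarith)]; ext <;> dsimp only <;> ring
  · rw [sigE_gt h, sigE_gt (by linarith)]; ext <;> dsimp only <;> ring

theorem mem_per_of_sigE {t : ℝ} (h0 : 0 < t) {S : Set (ℝ × ℝ)} (hS : S.Finite)
    (h : ∀ z ∈ S, Reg t z ∧ (z.1 < t ∨ z.1 + z.2 < 1) ∧ rhoF z ∈ S ∧ sigE t z ∈ S) :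
    S ⊆ Per t := by
  intro x hx
  refine ⟨S ∪ (fun z : ℝ × ℝ => (1 + t - z.2, 1 + t - z.1)) '' {z ∈ S | t < z.1} ∪
      (fun z : ℝ × ℝ => (1 + t - z.2, z.1 - t)) '' {z ∈ S | t < z.1}, ?_, Or.inl (Or.inl hx), ?_⟩
  · exact (hS.union ((hS.subset (sep_subset _ _)).image _)).union
        ((hS.subset (sep_subset _ _)).image _)
  · rintro _ ((hz | ⟨⟨x, y⟩, ⟨hz, htx⟩, rfl⟩) | ⟨⟨x, y⟩, ⟨hz, htx⟩, rfl⟩)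
    · rename_i w
      obtain ⟨x, y⟩ := w
      obtain ⟨hr, hE, hρ, hσ⟩ := h _ hz
      refine ⟨hr, Or.inl (Or.inl hρ), ?_⟩
      rcases lt_or_gt_of_ne hr.2.2.2.2.2 with h | h
      · rw [sigF_lt h]; rw [sigE_lt h] at hσ; exact Or.inl (Or.inl hσ)
      · rw [sigF_gt h]; exact Or.inl (Or.inr ⟨_, ⟨hz, h⟩, rfl⟩)
    · obtain ⟨⟨a1, a2, a3, a4, a5, a6⟩, hE, hρ, hσ⟩ := h _ hz
      dsimp only at *
      have hE : x + y < 1 := by rcases hE with h | h <;> linarith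
      refine ⟨⟨by dsimp only; linarith, by dsimp only; linarith, by dsimp only; linarith,
        by dsimp only; linarith, fun h => by dsimp only at h; linarith,
        fun h => by dsimp only at h; linarith⟩, ?_, ?_⟩
      · rw [rhoF_gt (by linarith)]
        exact Or.inr ⟨_, ⟨hz, htx⟩, by ext <;> dsimp only; ring⟩
      · rw [sigF_gt (by linarith)]
        exact Or.inl (Or.inl (mem_of_eq hz (by ring) (by ring)))
    · obtain ⟨⟨a1, a2, a3, a4, a5, a6⟩, hE, hρ, hσ⟩ := h _ hz
      dsimp only at *
      have hE : x + y < 1 := by rcases hE with h | h <;> linarith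
      refine ⟨⟨by dsimp only; linarith, by dsimp only; linarith, by dsimp only; linarith,
        by dsimp only; linarith, fun h => by dsimp only at h; linarith,
        fun h => by dsimp only at h; linarith⟩, ?_, ?_⟩
      · rw [rhoF_gt (by linarith)]
        exact Or.inl (Or.inr ⟨_, ⟨hz, htx⟩, by ext <;> dsimp only; ring⟩)
      · rw [sigF_gt (by linarith)]
        rw [sigE_gt htx] at hσ
        exact Or.inr ⟨_, ⟨hσ, by dsimp only; linarith⟩, by ext <;> dsimp only <;> ring⟩

theorem sigE_rhoF_cases {t : ℝ} {p : ℝ × ℝ} (h : Reg t p) (hE : p.1 < t ∨ p.1 + p.2 < 1)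
    (ht : p.1 + p.2 < 1 → p.1 + t ≠ 1) :
    (1 < p.1 + p.2 ∧ p.1 < t ∧ sigE t (rhoF p) = (p.2 + t - 1, t - p.1)) ∨
    (p.1 + p.2 < 1 ∧ p.1 + t < 1 ∧ sigE t (rhoF p) = (p.2 + t, 1 - p.1 - t)) ∨
    (p.1 + p.2 < 1 ∧ 1 < p.1 + t ∧ sigE t (rhoF p) = (t - p.2, p.1 + t - 1)) := by
  obtain ⟨x, y⟩ := p
  obtain ⟨h1, h2, h3, h4, h5, h6⟩ := h
  dsimp only at *
  rcases lt_or_gt_of_ne h5 with h | h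
  · rcases lt_or_gt_of_ne (ht h) with h' | h'
    · refine Or.inr (Or.inl ⟨h, h', ?_⟩)
      rw [rhoF_lt h, sigE_gt (by linarith)]
    · refine Or.inr (Or.inr ⟨h, h', ?_⟩)
      rw [rhoF_lt h, sigE_lt (by linarith)]; ext <;> dsimp only; ring
  · have h' : x < t := by rcases hE with h' | h' <;> linarith
    refine Or.inl ⟨h, h', ?_⟩
    rw [rhoF_gt h, sigE_lt (by linarith)]; ext <;> dsimp only; ring

theorem Reg.rhoF_fst_lt {t : ℝ} {p : ℝ × ℝ} (h : Reg t p) (hE : p.1 < t ∨ p.1 + p.2 < 1) :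
    (_root_.rhoF p).1 < t ∨ (_root_.rhoF p).1 + (_root_.rhoF p).2 < 1 := by
  obtain ⟨x, y⟩ := p
  obtain ⟨h1, h2, h3, h4, h5, h6⟩ := h
  dsimp only at *
  rcases lt_or_gt_of_ne h5 with h | h
  · rw [rhoF_lt h]; right; dsimp only; linarith
  · rw [rhoF_gt h]; left; dsimp only; rcases hE with h' | h' <;> linarith

theorem mem_per_of_sigE_return {t : ℝ} (h0 : 0 < t) {S : Set (ℝ × ℝ)}
    (hS : S.Finite) (h : ∀ z ∈ S, Reg t z ∧ (z.1 < t ∨ z.1 + z.2 < 1) ∧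
      (z.1 + z.2 < 1 → z.1 + t ≠ 1) ∧ sigE t (rhoF z) ∈ S) : S ⊆ Per t := by
  have hcl := union_image_closed hS (fun z hz => rhoF_rhoF (h z hz).1)
    (fun z hz => sigE_sigE ((h z hz).1.rhoF h0 (h z hz).2.2.1)) (fun z hz => (h z hz).2.2.2)
  refine subset_union_left.trans
    (mem_per_of_sigE h0 (hS.union (hS.image _)) fun z hz => ⟨?_, ?_, hcl z hz⟩)
  · rcases hz with hz | ⟨w, hw, rfl⟩
    · exact (h z hz).1
    · exact (h w hw).1.rhoF h0 (h w hw).2.2.1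
  · rcases hz with hz | ⟨w, hw, rfl⟩
    · exact (h z hz).2.1
    · exact (h w hw).1.rhoF_fst_lt (h w hw).2.1

theorem mem_per_of_mem_PM_of_gt {t : ℝ} (h0 : 1 / 2 < t) (h1 : t < 1) {x : ℝ × ℝ}
    (hx : x ∈ PM t) (hx1 : x.1 ≤ t ∨ x.1 + x.2 ≤ 1) : x ∈ Per t := by
  have key : ∀ z ∈ PM t, (z.1 ≤ t ∨ z.1 + z.2 ≤ 1) → ∃ q ∈ PM t, GRel t z q ∧ ∃ n : ℤ,
    (1 < z.1 + z.2 ∧ q.1 = z.2 + t + n ∧ q.2 = 1 - z.1 + t + n) ∨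
    (z.1 + z.2 < 1 ∧ q.1 = z.2 + t + n ∧ q.2 = 1 - z.1 - t + n) := by
    rintro z ⟨O, hf, hz, hO⟩ hz1
    obtain ⟨⟨a1, a2, a3, a4⟩, -, q, hq, hzq⟩ := hO z hz
    exact ⟨q, ⟨O, hf, hq, hO⟩, hzq, hzq.cases_of_lt (hO q hq).1 (by linarith)
      (by rcases hz1 with h | h <;> linarith)⟩
  have hx1 : x.1 < t ∨ x.1 + x.2 < 1 := by
    refine hx1.elim (fun h => Or.inl (lt_of_le_of_ne h fun h => fst_ne_of_mem_PM hx 0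
      (by rw [h]; push_cast; ring))) fun h => Or.inr (lt_of_le_of_ne h fun h' => ?_)
    obtain ⟨q, -, -, n, hn | hn⟩ := key x hx (Or.inr h) <;> linarith
  obtain ⟨O, hf, hxO, hO⟩ := hx
  refine mem_per_of_sigE_return (by linarith) (S := {z ∈ O | z.1 < t ∨ z.1 + z.2 < 1})
    (hf.subset (sep_subset _ _)) ?_ ⟨hxO, hx1⟩
  rintro z ⟨hz, hz1⟩
  have hzt : z.1 ≠ t := fun h => fst_ne_of_mem_PM ⟨O, hf, hz, hO⟩ 0 (by rw [h]; push_cast; ring)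
  obtain ⟨⟨a1, a2, a3, a4⟩, -, q, hq, hzq⟩ := hO z hz
  obtain ⟨⟨b1, b2, b3, b4⟩, hnu, -⟩ := hO q hq
  have hst : q ∈ strip t := ⟨b1, b2, b3, b4⟩
  obtain ⟨n, ⟨e0, e1, e2⟩ | ⟨e0, e1, e2⟩⟩ := hzq.cases_of_lt hst (by linarith)
    (by rcases hz1 with h | h <;> linarith)
  · have hz1' : z.1 < t := by rcases hz1 with h | h <;> linarith
    have hreg : Reg t z := ⟨a1, a2, a3, by linarith, e0.ne', hzt⟩
    refine ⟨hreg, hz1, fun h => by linarith, ?_⟩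
    rcases sigE_rhoF_cases hreg hz1 (fun h => by linarith) with ⟨c1, c2, c3⟩ | h | h
    · have hn : n + 1 = 0 := int_add_eq_zero (a := t - z.1) (by linarith) (by linarith)
        (by push_cast; linarith) (by push_cast; linarith)
      have hn' : (n : ℝ) + 1 = 0 := by exact_mod_cast hn
      have : q = sigE t (rhoF z) := by
        rw [c3]; ext <;> dsimp only <;> linarith
      exact this ▸ ⟨hq, Or.inl (by linarith)⟩
    · linarith
    · linarith
  · have hreg : Reg t z := ⟨a1, a2, a3, by linarith, e0.ne, hzt⟩
    have hne : z.1 + t ≠ 1 := fun h => by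
      have hn : n = 0 := int_add_eq_zero (a := 0) le_rfl (by linarith) (by linarith) (by linarith)
      have hn' : (n : ℝ) = 0 := by exact_mod_cast hn
      linarith
    refine ⟨hreg, hz1, fun _ => hne, ?_⟩
    rcases sigE_rhoF_cases hreg hz1 (fun _ => hne) with h | ⟨c1, c2, c3⟩ | ⟨c1, c2, c3⟩
    · linarith
    · have hn : n = 0 := int_add_eq_zero (a := 1 - z.1 - t) (by linarith) (by linarith)
        (by linarith) (by linarith)
      have hn' : (n : ℝ) = 0 := by exact_mod_cast hn
      have : q = sigE t (rhoF z) := by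
        rw [c3]; ext <;> dsimp only <;> linarith
      exact this ▸ ⟨hq, Or.inr (by linarith)⟩
    · have hn : n - 1 = 0 := int_add_eq_zero (a := 2 - z.1 - t) (by linarith) (by linarith)
        (by push_cast; linarith) (by push_cast; linarith)
      have hn' : (n : ℝ) - 1 = 0 := by exact_mod_cast hn
      have : nu t q = sigE t (rhoF z) := by
        rw [c3]; ext <;> simp only [nu] <;> linarith
      exact this ▸ ⟨hnu, Or.inl (by simp only [nu]; linarith)⟩

theorem unitSq_subset_PM {t : ℝ} (h0 : 0 < t) {k i : ℕ} (hi : 1 ≤ i) (hik : i + 1 ≤ 2 * k) :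
    unitSq t i ⊆ PM (k + t) := by
  rintro ⟨x, y⟩ ⟨h1, h2, h3, h4⟩
  dsimp only at *
  set W : Set ℝ := {x - t - i, 1 - (x - t - i), y, 1 - y} with hWdef
  have hW : ∀ c ∈ W, 1 - c ∈ W ∧ 0 < c ∧ c < 1 := by
    rintro c (rfl | rfl | rfl | rfl) <;> refine ⟨by simp [W], ?_, ?_⟩ <;> linarith
  have hWf : W.Finite := by simp [W]
  refine ⟨(fun z : ℕ × ℝ × ℝ => (t + z.1 + z.2.1, z.2.2)) '' (Icc 1 (2 * k - 1) ×ˢ W ×ˢ W),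
    ((finite_Icc _ _).prod (hWf.prod hWf)).image _,
    ⟨(i, x - t - i, y), ⟨⟨hi, by omega⟩, by simp [W], by simp [W]⟩, by ext <;> dsimp only; ring⟩, ?_⟩
  rintro _ ⟨⟨j, a, b⟩, ⟨⟨hj1, hj2⟩, ha, hb⟩, rfl⟩
  dsimp only at *
  obtain ⟨ha', ha0, ha1⟩ := hW a ha
  obtain ⟨hb', hb0, hb1⟩ := hW b hb
  have e1 : (1 : ℝ) ≤ j := by exact_mod_cast hj1
  have e2 : (j : ℝ) + 1 ≤ 2 * k := by exact_mod_cast (by omega : j + 1 ≤ 2 * k)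
  refine ⟨⟨hb0, hb1, by dsimp only; linarith, by dsimp only; linarith⟩, ?_, ?_⟩
  · refine ⟨(2 * k - j, 1 - a, 1 - b), ⟨⟨by dsimp only; omega, by dsimp only; omega⟩, ha', hb'⟩, ?_⟩
    simp only [nu]
    rw [Nat.cast_sub (by omega)]
    push_cast
    ext <;> dsimp only; ring
  · refine ⟨_, ⟨(j, b, 1 - a), ⟨⟨hj1, hj2⟩, hb, ha'⟩, rfl⟩, 0, j - k, ?_, ?_⟩ <;> push_cast <;> ring

theorem octagon_subset_PM (t : ℝ) : octagon t ⊆ PM t := by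
  rintro ⟨x, y⟩ ⟨h1, h2, h3, h4, h5, h6, h7, h8⟩
  dsimp only at *
  refine ⟨{(x, y), (y + t, 1 - x + t), (1 + 2 * t - x, 1 - y), (1 + t - y, x - t)},
    by simp, by simp, ?_⟩
  rintro _ (rfl | rfl | rfl | rfl)
  · refine ⟨⟨?_, ?_, ?_, ?_⟩, by simp [nu], _, Or.inr (Or.inl rfl), 0, 0, ?_, ?_⟩ <;>
      dsimp only <;> push_cast <;> linarith
  · refine ⟨⟨?_, ?_, ?_, ?_⟩, Or.inr (Or.inr (Or.inr ?_)), _, Or.inr (Or.inr (Or.inl rfl)),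
      0, 0, ?_, ?_⟩ <;> try (dsimp only; push_cast; linarith)
    simp only [nu]; ext <;> dsimp only <;> ring
  · refine ⟨⟨?_, ?_, ?_, ?_⟩, Or.inl ?_, _, Or.inr (Or.inr (Or.inr rfl)),
      0, 0, ?_, ?_⟩ <;> try (dsimp only; push_cast; linarith)
    simp only [nu]; ext <;> dsimp only <;> ring
  · refine ⟨⟨?_, ?_, ?_, ?_⟩, Or.inr (Or.inl ?_), _, Or.inl rfl,
      0, 0, ?_, ?_⟩ <;> try (dsimp only; push_cast; linarith)
    simp only [nu]; ext <;> dsimp only <;> ring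

theorem exists_pm_cover {t : ℝ} (h0 : 0 < t) (h1 : t < 1) {k : ℕ} (hk : 1 ≤ k ∨ 1 / 2 < t) :
    ∃ (C : Set (Bool × Bool)) (T : Set (Set (ℝ × ℝ))), T.Finite ∧
      (∀ A ∈ T, IsPreconnected A ∧ A ⊆ PM (k + t)) ∧
      (∀ c ∈ C, ∀ x ∈ closure (cell t c), x ∈ Per t ↔ x ∈ PM (k + t)) ∧
      ∀ x ∈ PM (k + t), x ∈ ⋃₀ T ∨ ∃ c ∈ C, x ∈ cell t c ∨ nu (k + t) x ∈ cell t c := by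
  rcases Nat.eq_zero_or_pos k with rfl | hk0
  · have hk : 1 / 2 < t := hk.resolve_left (by norm_num)
    rw [Nat.cast_zero, zero_add]
    refine ⟨{c | c.1 = true ∨ c.2 = true}, {octagon t}, finite_singleton _, ?_, ?_, ?_⟩
    · rintro _ rfl
      exact ⟨isPreconnected_octagon t, octagon_subset_PM t⟩
    · rintro c hc x hx
      have hx' : x.1 ≤ t ∨ x.1 + x.2 ≤ 1 := by
        obtain ⟨-, -, -, -, h5, h6⟩ := mem_closure_cell hx
        rcases hc with hc | hc
        · rw [hc] at h5; exact Or.inl h5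
        · rw [hc] at h6; exact Or.inr h6
      exact ⟨fun h => per_subset_PM_of_gt hk h1 h hx', fun h => mem_per_of_mem_PM_of_gt hk h1 h hx'⟩
    · have key : ∀ x ∈ PM t, (x.1 ≤ t ∨ x.1 + x.2 ≤ 1) →
          ∃ c ∈ {c : Bool × Bool | c.1 = true ∨ c.2 = true}, x ∈ cell t c := by
        intro x hx hx1
        obtain ⟨⟨a, b⟩, hc⟩ := (reg_of_per (mem_per_of_mem_PM_of_gt hk h1 hx hx1)).exists_cell
        refine ⟨_, ?_, hc⟩
        rcases a with _ | _
        · rcases b with _ | _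
          · obtain ⟨-, -, -, -, h5, h6⟩ := hc
            simp only [cond_false] at h5 h6
            exfalso
            rcases hx1 with h | h <;> linarith
          · exact Or.inr rfl
        · exact Or.inl rfl
      intro x hx
      by_cases ha : x.1 ≤ t ∨ x.1 + x.2 ≤ 1
      · obtain ⟨c, hc, hxc⟩ := key x hx ha
        exact Or.inr ⟨c, hc, Or.inl hxc⟩
      by_cases hb : 1 + t ≤ x.1 ∨ 1 + 2 * t ≤ x.1 + x.2
      · obtain ⟨c, hc, hxc⟩ := key _ (nu_mem_PM hx) (by
          simp only [nu]
          rcases hb with h | h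
          · left; linarith
          · right; linarith)
        exact Or.inr ⟨c, hc, Or.inr hxc⟩
      · push Not at ha hb
        obtain ⟨b1, b2, b3, b4⟩ := PM_subset_strip t hx
        exact Or.inl ⟨_, rfl, ha.1, hb.1, b1, b2, ha.2, hb.2, b3, by linarith⟩
  · refine ⟨univ, unitSq t '' {i | 1 ≤ i ∧ i + 1 ≤ 2 * k}, ?_, ?_, ?_, ?_⟩
    · exact ((finite_Iic (2 * k)).subset fun i hi => by
        simp only [mem_ofPred_eq, mem_Iic] at *; omega).image _
    · rintro _ ⟨i, ⟨hi, hik⟩, rfl⟩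
      exact ⟨isPreconnected_unitSq t i, unitSq_subset_PM h0 hi hik⟩
    · rintro c - x hx
      exact ⟨fun h => per_subset_PM h0 hk0 h,
        fun h => mem_per_of_mem_PM h0 h1 hk0 h (mem_closure_cell hx).2.2.2.1⟩
    · intro x hx
      by_cases ha : x.1 ≤ 1 + t
      · obtain ⟨c, hc⟩ := (reg_of_per (mem_per_of_mem_PM h0 h1 hk0 hx ha)).exists_cell
        exact Or.inr ⟨c, mem_univ _, Or.inl hc⟩
      by_cases hb : 2 * k + t ≤ x.1
      · obtain ⟨c, hc⟩ := (reg_of_per (mem_per_of_mem_PM h0 h1 hk0 (nu_mem_PM hx)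
          (by simp only [nu]; linarith))).exists_cell
        exact Or.inr ⟨c, mem_univ _, Or.inr hc⟩
      · push Not at ha hb
        obtain ⟨b1, b2, -, -⟩ := PM_subset_strip _ hx
        have f1 := Nat.floor_le (show 0 ≤ x.1 - t by linarith)
        have f2 := Nat.lt_floor_add_one (x.1 - t)
        set i := ⌊x.1 - t⌋₊ with hi
        have hne : (i : ℝ) ≠ x.1 - t := fun h =>
          fst_ne_of_mem_PM hx (i - k) (by push_cast; linarith)
        have hlt := lt_of_le_of_ne f1 hne
        have g1 : (0 : ℝ) < i := by linarith
        have g2 : (i : ℝ) < (2 * k : ℕ) := by push_cast; linarith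
        have g1' : 0 < i := by exact_mod_cast g1
        have g2' : i < 2 * k := by exact_mod_cast g2
        exact Or.inl ⟨_, ⟨i, ⟨g1', g2'⟩, rfl⟩, by linarith, by linarith, b1, b2⟩

/-- Where components of the rescaled periodic set accumulate, there are nearby points with
arbitrarily small components, off any given finite family of lines. -/
theorem exists_smallAt_PM {M : ℝ} (hM : 1 / 2 < M) (hirr : Irrational M) {p : ℝ × ℝ}
    (hp : MeetsAt (PM M) univ p) {U : Set (ℝ × ℝ)} (hU : U ∈ 𝓝 p) (L : List (ℝ × ℝ × ℝ))
    (hL : ∀ l ∈ L, l.1 ≠ 0 ∨ l.2.1 ≠ 0) :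
    ∃ q ∈ U, SmallAt (PM M) univ q ∧ ∀ l ∈ L, l.1 * q.1 + l.2.1 * q.2 + l.2.2 ≠ 0 := by
  obtain ⟨t, k, h0, h1, ht, rfl⟩ : ∃ t : ℝ, ∃ k : ℕ, 0 < t ∧ t < 1 ∧ Irrational t ∧ k + t = M := by
    have f1 := Nat.floor_le (show 0 ≤ M by linarith)
    have f2 := Nat.lt_floor_add_one M
    have hi := hirr.sub_natCast ⌊M⌋₊
    exact ⟨M - ⌊M⌋₊, ⌊M⌋₊, lt_of_le_of_ne (by linarith) (fun h => hi ⟨0, by rw [← h]; simp⟩),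
      by linarith, hi, by ring⟩
  have hk : 1 ≤ k ∨ 1 / 2 < t := by
    rcases Nat.eq_zero_or_pos k with rfl | hk
    · right; simpa using hM
    · exact Or.inl hk
  obtain ⟨C, T, hT, hTc, hC, hcov⟩ := exists_pm_cover h0 h1 hk
  have hid : ∀ c ∈ C, CleanMap 1 id (Per t) (cell t c) (PM (k + t)) univ := fun c hc =>
    ⟨⟨1, 0, 0, 0, 1, by norm_num, by norm_num, by norm_num, fun p => by ext <;> simp⟩,
      isOpen_cell t c, per_inter_closure_cell t c, fun _ _ => mem_univ _, hC c hc⟩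
  have hnu : ∀ c ∈ C, CleanMap 1 (nu (k + t)) (Per t) (cell t c) (PM (k + t)) univ := fun c hc =>
    ⟨⟨-1, 0, 1 + 2 * (k + t), 1, 1, by norm_num, by norm_num, by norm_num, fun p => by
      simp only [nu]; ext <;> dsimp only <;> ring⟩,
      isOpen_cell t c, per_inter_closure_cell t c, fun _ _ => mem_univ _, fun x hx =>
        (hC c hc x hx).trans nu_mem_PM_iff.symm⟩
  obtain ⟨A, ⟨⟨c, b⟩, hc, rfl⟩, hA⟩ := hp.pigeonhole
    (E := (fun c : (Bool × Bool) × Bool => (bif c.2 then id else nu (k + t)) '' cell t c.1) ''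
      (C ×ˢ univ)) hT (Set.toFinite _) hTc (by
    rintro x ⟨hx, -⟩
    rcases hcov x hx with h | ⟨c, hc, h | h⟩
    · exact Or.inl h
    · exact Or.inr ⟨_, ⟨(c, true), ⟨hc, mem_univ _⟩, rfl⟩, x, h, rfl⟩
    · exact Or.inr ⟨_, ⟨(c, false), ⟨hc, mem_univ _⟩, rfl⟩, _, h, nu_nu _ x⟩)
  rcases b with _ | _
  · exact (hnu c hc.1).exists_smallAt_off_lines h0 h1 ht hA hU L hL
  · exact (hid c hc.1).exists_smallAt_off_lines h0 h1 ht hA hU L hL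

theorem strict_bounds_of_unique {s a b : ℝ} (hs : 0 < s) {m n : ℤ}
    (hA : -1 ≤ a + 2 * m ∧ a + 2 * m ≤ 1)
    (hB : -s ≤ b + 2 * m + 2 * s * n ∧ b + 2 * m + 2 * s * n ≤ s)
    (hu : ∀ m' n' : ℤ, (-1 ≤ a + 2 * m' ∧ a + 2 * m' ≤ 1) →
      (-s ≤ b + 2 * m' + 2 * s * n' ∧ b + 2 * m' + 2 * s * n' ≤ s) → m' = m ∧ n' = n) :
    (-1 < a + 2 * m ∧ a + 2 * m < 1) ∧
      (-s < b + 2 * m + 2 * s * n ∧ b + 2 * m + 2 * s * n < s) := by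
  have hex : ∀ c : ℝ, ∃ n : ℤ, -s ≤ c + 2 * s * n ∧ c + 2 * s * n ≤ s := by
    intro c
    have h1 := Int.floor_le ((c + s) / (2 * s))
    have h2 := Int.lt_floor_add_one ((c + s) / (2 * s))
    rw [le_div_iff₀ (by positivity)] at h1
    rw [div_lt_iff₀ (by positivity)] at h2
    exact ⟨-⌊(c + s) / (2 * s)⌋, by push_cast; linarith, by push_cast; linarith⟩
  refine ⟨⟨lt_of_le_of_ne hA.1 fun h => ?_, lt_of_le_of_ne hA.2 fun h => ?_⟩,
    lt_of_le_of_ne hB.1 fun h => ?_, lt_of_le_of_ne hB.2 fun h => ?_⟩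
  · obtain ⟨n', h1, h2⟩ := hex (b + 2 * (m + 1 : ℤ))
    have := (hu (m + 1) n' (by push_cast; constructor <;> linarith) ⟨h1, h2⟩).1
    omega
  · obtain ⟨n', h1, h2⟩ := hex (b + 2 * (m - 1 : ℤ))
    have := (hu (m - 1) n' (by push_cast; constructor <;> linarith) ⟨h1, h2⟩).1
    omega
  · have := (hu m (n + 1) hA (by push_cast; constructor <;> linarith)).2
    omega
  · have := (hu m (n - 1) hA (by push_cast; constructor <;> linarith)).2
    omega

theorem unique_of_strict_bounds {s a b : ℝ} {m n m' n' : ℤ}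
    (hA : -1 < a + 2 * m ∧ a + 2 * m < 1)
    (hB : -s < b + 2 * m + 2 * s * n ∧ b + 2 * m + 2 * s * n < s)
    (hA' : -1 ≤ a + 2 * m' ∧ a + 2 * m' ≤ 1)
    (hB' : -s ≤ b + 2 * m' + 2 * s * n' ∧ b + 2 * m' + 2 * s * n' ≤ s) : m' = m ∧ n' = n := by
  have h1 : m' - m = 0 := int_eq_zero_of_lt (c := 2) (by push_cast; linarith)
    (by push_cast; linarith)
  obtain rfl : m' = m := by omega
  have h2 : n' - n = 0 := int_eq_zero_of_lt (c := 2 * s) (by push_cast; linarith)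
    (by push_cast; linarith)
  exact ⟨rfl, by omega⟩

/-- The interior of the parallelogram `F₁`. -/
def P1 (s : ℝ) : Set (ℝ × ℝ) := {p | -s < p.2 ∧ p.2 < s ∧ -1 < p.2 - p.1 ∧ p.2 - p.1 < 1}

/-- The interior of the parallelogram `F₂`. -/
def P2 (s : ℝ) : Set (ℝ × ℝ) := {p | -s < p.1 ∧ p.1 < s ∧ -1 < p.1 + p.2 ∧ p.1 + p.2 < 1}

theorem mem_F1 {s : ℝ} (hs : 0 < s) {p : ℝ × ℝ} :
    p ∈ F1 s ↔ -s ≤ p.2 ∧ p.2 ≤ s ∧ -1 ≤ p.2 - p.1 ∧ p.2 - p.1 ≤ 1 := by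
  constructor
  · rintro ⟨a, b, ⟨h1, h2⟩, ⟨h3, h4⟩, rfl⟩
    dsimp only
    refine ⟨?_, ?_, ?_, ?_⟩ <;> nlinarith
  · rintro ⟨h1, h2, h3, h4⟩
    refine ⟨(p.1 - p.2) / 2, p.2 / (2 * s), ⟨by linarith, by linarith⟩, ⟨?_, ?_⟩, ?_⟩
    · rw [le_div_iff₀ (by positivity)]; linarith
    · rw [div_le_iff₀ (by positivity)]; linarith
    · ext <;> dsimp only <;> field_simp; ring

theorem mem_F2 {s : ℝ} (hs : 0 < s) {p : ℝ × ℝ} :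
    p ∈ F2 s ↔ -s ≤ p.1 ∧ p.1 ≤ s ∧ -1 ≤ p.1 + p.2 ∧ p.1 + p.2 ≤ 1 := by
  constructor
  · rintro ⟨q, hq, rfl⟩
    obtain ⟨h1, h2, h3, h4⟩ := (mem_F1 hs).1 hq
    simp only [rotQ]
    refine ⟨?_, ?_, ?_, ?_⟩ <;> linarith
  · rintro ⟨h1, h2, h3, h4⟩
    refine ⟨(p.2, -p.1), (mem_F1 hs).2 ?_, by ext <;> simp [rotQ]⟩
    dsimp only
    refine ⟨?_, ?_, ?_, ?_⟩ <;> linarith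

theorem P1_subset_F1 {s : ℝ} (hs : 0 < s) : P1 s ⊆ F1 s := fun _ h =>
  (mem_F1 hs).2 ⟨h.1.le, h.2.1.le, h.2.2.1.le, h.2.2.2.le⟩

theorem P2_subset_F2 {s : ℝ} (hs : 0 < s) : P2 s ⊆ F2 s := fun _ h =>
  (mem_F2 hs).2 ⟨h.1.le, h.2.1.le, h.2.2.1.le, h.2.2.2.le⟩

theorem neg_mem_P1 {s : ℝ} {p : ℝ × ℝ} (h : p ∈ P1 s) : -p ∈ P1 s := by
  obtain ⟨h1, h2, h3, h4⟩ := h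
  refine ⟨?_, ?_, ?_, ?_⟩ <;> simp only [Prod.fst_neg, Prod.snd_neg] <;> linarith

theorem eq_of_mem_P2 {s : ℝ} (hs : 0 < s) {p q q' : ℝ × ℝ} (h : q - p ∈ L2 s) (h' : q' - p ∈ L2 s)
    (hq : q ∈ P2 s) (hq' : q' ∈ F2 s) : q' = q := by
  obtain ⟨m, n, e⟩ := h
  obtain ⟨m', n', e'⟩ := h'
  obtain rfl : q = p + (2 * m + 2 * s * n, -(2 * s * n)) := by rw [← e]; abel
  obtain rfl : q' = p + (2 * m' + 2 * s * n', -(2 * s * n')) := by rw [← e']; abel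
  obtain ⟨h1, h2, h3, h4⟩ := hq
  obtain ⟨h1', h2', h3', h4'⟩ := (mem_F2 hs).1 hq'
  simp only [Prod.fst_add, Prod.snd_add] at *
  obtain ⟨rfl, rfl⟩ := unique_of_strict_bounds (s := s) (a := p.1 + p.2) (b := p.1) (m := m)
    (n := n) (m' := m') (n' := n') (by constructor <;> linarith) (by constructor <;> linarith)
    (by constructor <;> linarith) (by constructor <;> linarith)
  rfl

theorem eq_of_mem_P1 {s : ℝ} (hs : 0 < s) {p q q' : ℝ × ℝ} (h : q - p ∈ L1 s) (h' : q' - p ∈ L1 s)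
    (hq : q ∈ P1 s) (hq' : q' ∈ F1 s) : q' = q := by
  obtain ⟨m, n, e⟩ := h
  obtain ⟨m', n', e'⟩ := h'
  obtain rfl : q = p + (2 * s * n, 2 * m + 2 * s * n) := by rw [← e]; abel
  obtain rfl : q' = p + (2 * s * n', 2 * m' + 2 * s * n') := by rw [← e']; abel
  obtain ⟨h1, h2, h3, h4⟩ := hq
  obtain ⟨h1', h2', h3', h4'⟩ := (mem_F1 hs).1 hq'
  simp only [Prod.fst_add, Prod.snd_add] at *
  obtain ⟨rfl, rfl⟩ := unique_of_strict_bounds (s := s) (a := p.2 - p.1) (b := p.2) (m := m)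
    (n := n) (m' := m') (n' := n') (by constructor <;> linarith) (by constructor <;> linarith)
    (by constructor <;> linarith) (by constructor <;> linarith)
  rfl

theorem mem_P2_of_unique {s : ℝ} (hs : 0 < s) {p q : ℝ × ℝ} (h : q - p ∈ L2 s) (hq : q ∈ F2 s)
    (hu : ∃! v, v ∈ L2 s ∧ p + v ∈ F2 s) : q ∈ P2 s := by
  have hu' := fun v hv => hu.unique (y₁ := q - p) (y₂ := v) ⟨h, by simpa using hq⟩ hv
  obtain ⟨m, n, e⟩ := h
  obtain rfl : q = p + (2 * m + 2 * s * n, -(2 * s * n)) := by rw [← e]; abel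
  obtain ⟨h1, h2, h3, h4⟩ := (mem_F2 hs).1 hq
  simp only [Prod.fst_add, Prod.snd_add] at *
  have := strict_bounds_of_unique (s := s) (a := p.1 + p.2) (b := p.1) (m := m) (n := n) hs
    (by constructor <;> linarith) (by constructor <;> linarith) (by
      rintro m' n' ⟨a1, a2⟩ ⟨b1, b2⟩
      have := hu' (2 * m' + 2 * s * n', -(2 * s * n')) ⟨⟨m', n', rfl⟩, (mem_F2 hs).2 (by
        simp only [Prod.fst_add, Prod.snd_add]
        refine ⟨?_, ?_, ?_, ?_⟩ <;> linarith)⟩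
      rw [e, Prod.ext_iff] at this
      dsimp only at this
      have e1 : s * (n : ℝ) = s * n' := by linarith
      have e2 : (n : ℝ) = n' := mul_left_cancel₀ hs.ne' e1
      have e3 : (m : ℝ) = m' := by linarith
      exact ⟨by exact_mod_cast e3.symm, by exact_mod_cast e2.symm⟩)
  refine ⟨?_, ?_, ?_, ?_⟩ <;> simp only [Prod.fst_add, Prod.snd_add] <;> linarith

theorem mem_P1_of_unique {s : ℝ} (hs : 0 < s) {p q : ℝ × ℝ} (h : q - p ∈ L1 s) (hq : q ∈ F1 s)
    (hu : ∃! v, v ∈ L1 s ∧ p + v ∈ F1 s) : q ∈ P1 s := by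
  have hu' := fun v hv => hu.unique (y₁ := q - p) (y₂ := v) ⟨h, by simpa using hq⟩ hv
  obtain ⟨m, n, e⟩ := h
  obtain rfl : q = p + (2 * s * n, 2 * m + 2 * s * n) := by rw [← e]; abel
  obtain ⟨h1, h2, h3, h4⟩ := (mem_F1 hs).1 hq
  simp only [Prod.fst_add, Prod.snd_add] at *
  have := strict_bounds_of_unique (s := s) (a := p.2 - p.1) (b := p.2) (m := m) (n := n) hs
    (by constructor <;> linarith) (by constructor <;> linarith) (by
      rintro m' n' ⟨a1, a2⟩ ⟨b1, b2⟩
      have := hu' (2 * s * n', 2 * m' + 2 * s * n') ⟨⟨m', n', rfl⟩, (mem_F1 hs).2 (by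
        simp only [Prod.fst_add, Prod.snd_add]
        refine ⟨?_, ?_, ?_, ?_⟩ <;> linarith)⟩
      rw [e, Prod.ext_iff] at this
      dsimp only at this
      have e1 : s * (n : ℝ) = s * n' := by linarith
      have e2 : (n : ℝ) = n' := mul_left_cancel₀ hs.ne' e1
      have e3 : (m : ℝ) = m' := by linarith
      exact ⟨by exact_mod_cast e3.symm, by exact_mod_cast e2.symm⟩)
  refine ⟨?_, ?_, ?_, ?_⟩ <;> simp only [Prod.fst_add, Prod.snd_add] <;> linarith

theorem zero_mem_L1 (s : ℝ) : (0 : ℝ × ℝ) ∈ L1 s := ⟨0, 0, by ext <;> simp⟩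
theorem zero_mem_L2 (s : ℝ) : (0 : ℝ × ℝ) ∈ L2 s := ⟨0, 0, by ext <;> simp⟩

theorem stepRel_iff {s : ℝ} (hs : 0 < s) {p q : ℝ × ℝ} : StepRel s p q ↔
    (p ∈ F1 s ∧ q - p ∈ L2 s ∧ q ∈ P2 s) ∨ (p ∈ F2 s ∧ q - p ∈ L1 s ∧ q ∈ P1 s) := by
  simp only [StepRel, Fin.exists_fin_two]
  refine or_congr ⟨?_, ?_⟩ ⟨?_, ?_⟩
  · rintro ⟨hp, hu, hL, hq⟩
    exact ⟨hp, hL, mem_P2_of_unique hs hL hq hu⟩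
  · rintro ⟨hp, hL, hq⟩
    refine ⟨hp, ⟨q - p, ⟨hL, ?_⟩, ?_⟩, hL, P2_subset_F2 hs hq⟩
    · rw [add_sub_cancel]; exact P2_subset_F2 hs hq
    · rintro v ⟨hv, hv'⟩
      rw [← eq_of_mem_P2 hs (q' := p + v) hL (by rwa [add_sub_cancel_left]) hq hv',
        add_sub_cancel_left]
  · rintro ⟨hp, hu, hL, hq⟩
    exact ⟨hp, hL, mem_P1_of_unique hs hL hq hu⟩
  · rintro ⟨hp, hL, hq⟩
    refine ⟨hp, ⟨q - p, ⟨hL, ?_⟩, ?_⟩, hL, P1_subset_F1 hs hq⟩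
    · rw [add_sub_cancel]; exact P1_subset_F1 hs hq
    · rintro v ⟨hv, hv'⟩
      rw [← eq_of_mem_P1 hs (q' := p + v) hL (by rwa [add_sub_cancel_left]) hq hv',
        add_sub_cancel_left]

/-- The octagonal PET on the interior of `F₁`, off the points where a choice between `F₁` and `F₂`
has to be made. -/
def MapT (s : ℝ) (p q : ℝ × ℝ) : Prop := ∃ r ∈ P2 s, r - p ∈ L2 s ∧ q ∈ P1 s ∧ q - r ∈ L1 s

/-- Iterates of `MapT`. -/
def IterT (s : ℝ) : ℕ → ℝ × ℝ → ℝ × ℝ → Prop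
  | 0, p, q => p = q
  | n + 1, p, q => ∃ r, IterT s n p r ∧ MapT s r q

/-- Points in exactly one of the open parallelograms and on the boundary of the other. -/
def Stuck (s : ℝ) : Set (ℝ × ℝ) :=
  {q | (q ∈ P1 s ∧ q ∈ F2 s ∧ q ∉ P2 s) ∨ (q ∈ F1 s ∧ q ∈ P2 s ∧ q ∉ P1 s)}

section Dynamics

variable {s : ℝ}

theorem eq_self_of_mem_F2 (hs : 0 < s) {q r : ℝ × ℝ} (hq : q ∈ F2 s) (h : r - q ∈ L2 s)
    (hr : r ∈ P2 s) : q = r :=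
  eq_of_mem_P2 hs h (by rw [sub_self]; exact zero_mem_L2 s) hr hq

theorem eq_self_of_mem_F1 (hs : 0 < s) {q r : ℝ × ℝ} (hq : q ∈ F1 s) (h : r - q ∈ L1 s)
    (hr : r ∈ P1 s) : q = r :=
  eq_of_mem_P1 hs h (by rw [sub_self]; exact zero_mem_L1 s) hr hq

theorem StepRel.eq_of_stuck (hs : 0 < s) {q r : ℝ × ℝ} (h : StepRel s q r) (hq : q ∈ Stuck s) :
    q = r := by
  rcases (stepRel_iff hs).1 h with ⟨h1, h2, h3⟩ | ⟨h1, h2, h3⟩ <;>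
    rcases hq with ⟨a1, a2, a3⟩ | ⟨a1, a2, a3⟩
  · exact eq_self_of_mem_F2 hs a2 h2 h3
  · exact eq_self_of_mem_F2 hs (P2_subset_F2 hs a2) h2 h3
  · exact eq_self_of_mem_F1 hs (P1_subset_F1 hs a1) h2 h3
  · exact eq_self_of_mem_F1 hs a1 h2 h3

theorem MapRel.mapT_or_stuck (hs : 0 < s) {p q : ℝ × ℝ} (hp : p ∈ P1 s) (h : MapRel s p q) :
    MapT s p q ∨ q ∈ Stuck s := by
  obtain ⟨r, h1, h2⟩ := h
  rcases (stepRel_iff hs).1 h1 with ⟨a1, a2, a3⟩ | ⟨a1, a2, a3⟩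
  · rcases (stepRel_iff hs).1 h2 with ⟨b1, b2, b3⟩ | ⟨b1, b2, b3⟩
    · obtain rfl := eq_self_of_mem_F2 hs (P2_subset_F2 hs a3) b2 b3
      by_cases hr : r ∈ P1 s
      · exact Or.inl ⟨r, a3, a2, hr, by rw [sub_self]; exact zero_mem_L1 s⟩
      · exact Or.inr (Or.inr ⟨b1, a3, hr⟩)
    · exact Or.inl ⟨r, a3, a2, b3, b2⟩
  · obtain rfl := eq_self_of_mem_F1 hs (P1_subset_F1 hs hp) a2 a3
    by_cases hr : p ∈ P2 s
    · have : p = q := by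
        rcases (stepRel_iff hs).1 h2 with ⟨b1, b2, b3⟩ | ⟨b1, b2, b3⟩
        · exact eq_self_of_mem_F2 hs a1 b2 b3
        · exact eq_self_of_mem_F1 hs (P1_subset_F1 hs hp) b2 b3
      subst this
      exact Or.inl ⟨p, hr, by rw [sub_self]; exact zero_mem_L2 s, hp,
        by rw [sub_self]; exact zero_mem_L1 s⟩
    · have hst : p ∈ Stuck s := Or.inl ⟨hp, a1, hr⟩
      rw [← h2.eq_of_stuck hs hst]
      exact Or.inr hst

theorem IterRel.iterT_or_stuck (hs : 0 < s) {p : ℝ × ℝ} (hp : p ∈ P1 s) :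
    ∀ {n : ℕ} {q : ℝ × ℝ}, IterRel s n p q → (IterT s n p q ∧ q ∈ P1 s) ∨ q ∈ Stuck s
  | 0, q, h => by
    obtain rfl : p = q := h
    exact Or.inl ⟨rfl, hp⟩
  | n + 1, q, ⟨r, hr, hrq⟩ => by
    rcases IterRel.iterT_or_stuck hs hp hr with ⟨h1, h2⟩ | h1
    · rcases hrq.mapT_or_stuck hs h2 with h | h
      · obtain ⟨m, h3, h4, h5, h6⟩ := h
        exact Or.inl ⟨⟨r, h1, m, h3, h4, h5, h6⟩, h5⟩
      · exact Or.inr h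
    · obtain ⟨m, h3, h4⟩ := hrq
      obtain rfl := h3.eq_of_stuck hs h1
      obtain rfl := h4.eq_of_stuck hs h1
      exact Or.inr h1

theorem IterRel.iterT_or_mem (hs : 0 < s) {x : ℝ × ℝ} {n : ℕ} (hx : x ∈ P1 s)
    (h : IterRel s n x x) : IterT s n x x ∨ x ∈ F2 s \ P2 s := by
  rcases h.iterT_or_stuck hs hx with h | h | h
  · exact Or.inl h.1
  · exact Or.inr ⟨h.2.1, h.2.2⟩
  · exact absurd hx h.2.2

theorem IterT.mem {p q : ℝ × ℝ} {n : ℕ} (hp : p ∈ P1 s) (h : IterT s n p q) : q ∈ P1 s := by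
  cases n with
  | zero => obtain rfl : p = q := h; exact hp
  | succ n => obtain ⟨r, -, m, -, -, h, -⟩ := h; exact h

theorem IterT.iterRel (hs : 0 < s) {p : ℝ × ℝ} (hp : p ∈ P1 s) :
    ∀ {n : ℕ} {q : ℝ × ℝ}, IterT s n p q → IterRel s n p q
  | 0, _, h => h
  | n + 1, q, ⟨r, hr, m, h1, h2, h3, h4⟩ => by
    refine ⟨r, IterT.iterRel hs hp hr, m, (stepRel_iff hs).2 ?_, (stepRel_iff hs).2 ?_⟩
    · exact Or.inl ⟨P1_subset_F1 hs (hr.mem hp), h2, h1⟩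
    · exact Or.inr ⟨P2_subset_F2 hs h1, h4, h3⟩

theorem iterRel_self (hs : 0 < s) {x : ℝ × ℝ} (h1 : x ∈ P1 s) (h2 : x ∈ F2 s) (n : ℕ) :
    IterRel s n x x := by
  have h : StepRel s x x :=
    (stepRel_iff hs).2 (Or.inr ⟨h2, by rw [sub_self]; exact zero_mem_L1 s, h1⟩)
  induction n with
  | zero => rfl
  | succ n ih => exact ⟨x, ih, x, h, h⟩

theorem IterT.trans {p q : ℝ × ℝ} {m : ℕ} (h : IterT s m p q) :
    ∀ {n : ℕ} {r : ℝ × ℝ}, IterT s n q r → IterT s (m + n) p r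
  | 0, _, h' => by obtain rfl : q = _ := h'; exact h
  | _ + 1, _, ⟨t, ht, htr⟩ => ⟨t, h.trans ht, htr⟩

theorem IterT.mul {p : ℝ × ℝ} {m : ℕ} (h : IterT s m p p) (k : ℕ) : IterT s (m * k) p p := by
  induction k with
  | zero => rfl
  | succ k ih => rw [Nat.mul_succ]; exact ih.trans h

/-- The half-step map in the symmetric normalisation. -/
def GS (s : ℝ) (p q : ℝ × ℝ) : Prop :=
  ∃ m n : ℤ, -q.2 = p.1 + 2 * m + 2 * s * n ∧ q.1 = p.2 - 2 * s * n

theorem GS.neg {p q : ℝ × ℝ} (h : GS s p q) : GS s (-p) (-q) := by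
  obtain ⟨m, n, h1, h2⟩ := h
  refine ⟨-m, -n, ?_, ?_⟩ <;> simp only [Prod.fst_neg, Prod.snd_neg] <;> push_cast <;> linarith

theorem rotQ_mem_P2 {p : ℝ × ℝ} : rotQ p ∈ P2 s ↔ p ∈ P1 s := by
  constructor
  · rintro ⟨h1, h2, h3, h4⟩
    simp only [rotQ] at *
    refine ⟨?_, ?_, ?_, ?_⟩ <;> linarith
  · rintro ⟨h1, h2, h3, h4⟩
    refine ⟨?_, ?_, ?_, ?_⟩ <;> simp only [rotQ] <;> linarith

theorem mapT_iff {p q : ℝ × ℝ} : MapT s p q ↔ ∃ m ∈ P1 s, GS s p m ∧ GS s m (-q) ∧ q ∈ P1 s := by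
  constructor
  · rintro ⟨r, h1, ⟨a, b, e⟩, h3, ⟨a', b', e'⟩⟩
    rw [Prod.ext_iff] at e e'
    obtain ⟨e1, e2⟩ := e
    obtain ⟨e3, e4⟩ := e'
    simp only [Prod.fst_sub, Prod.snd_sub] at *
    have hr : rotQ (r.2, -r.1) = r := by ext <;> simp [rotQ]
    refine ⟨(r.2, -r.1), rotQ_mem_P2.1 (by rwa [hr]), ⟨a, b, ?_, ?_⟩, ⟨a', b', ?_, ?_⟩, h3⟩ <;>
      simp only [Prod.fst_neg, Prod.snd_neg] <;> linarith
  · rintro ⟨m, h1, ⟨a, b, e1, e2⟩, ⟨a', b', e3, e4⟩, h3⟩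
    simp only [Prod.fst_neg, Prod.snd_neg] at *
    refine ⟨rotQ m, rotQ_mem_P2.2 h1, ⟨a, b, ?_⟩, h3, ⟨a', b', ?_⟩⟩ <;> ext <;>
      simp only [rotQ, Prod.fst_sub, Prod.snd_sub] <;> linarith

/-- The periodic points of the octagonal PET. -/
def PT (s : ℝ) : Set (ℝ × ℝ) :=
  {x | ∃ O : Set (ℝ × ℝ), O.Finite ∧ x ∈ O ∧ ∀ p ∈ O, p ∈ P1 s ∧ -p ∈ O ∧ ∃ q ∈ O, GS s p q}

theorem PT_subset_P1 : PT s ⊆ P1 s := fun x ⟨_, _, hx, hO⟩ => (hO x hx).1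

theorem IterT.exists_orbit {p : ℝ × ℝ} (hp : p ∈ P1 s) : ∀ {n : ℕ} {q : ℝ × ℝ}, IterT s n p q →
    ∃ O : Set (ℝ × ℝ), O.Finite ∧ p ∈ O ∧ q ∈ O ∧
      ∀ z ∈ O, z ∈ P1 s ∧ -z ∈ O ∧ (z = q ∨ z = -q ∨ ∃ w ∈ O, GS s z w)
  | 0, q, h => by
    obtain rfl : p = q := h
    refine ⟨{p, -p}, by simp, by simp, by simp, ?_⟩
    rintro z (rfl | rfl)
    · exact ⟨hp, by simp, Or.inl rfl⟩
    · exact ⟨neg_mem_P1 hp, by simp, Or.inr (Or.inl rfl)⟩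
  | n + 1, q, ⟨r, hr, h⟩ => by
    obtain ⟨O, hf, h1, h2, h3⟩ := IterT.exists_orbit hp hr
    obtain ⟨m, hm, g1, g2, hq⟩ := mapT_iff.1 h
    refine ⟨O ∪ {m, -m, q, -q}, hf.union (by simp), Or.inl h1, by simp, ?_⟩
    rintro z (hz | rfl | rfl | rfl | rfl)
    · obtain ⟨a1, a2, a3⟩ := h3 z hz
      refine ⟨a1, Or.inl a2, Or.inr (Or.inr ?_)⟩
      rcases a3 with rfl | rfl | ⟨w, hw, hg⟩
      · exact ⟨m, by simp, g1⟩
      · exact ⟨-m, by simp, g1.neg⟩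
      · exact ⟨w, Or.inl hw, hg⟩
    · exact ⟨hm, by simp, Or.inr (Or.inr ⟨-q, by simp, g2⟩)⟩
    · exact ⟨neg_mem_P1 hm, by simp, Or.inr (Or.inr ⟨q, by simp, by simpa using g2.neg⟩)⟩
    · exact ⟨hq, by simp, Or.inl rfl⟩
    · exact ⟨neg_mem_P1 hq, by simp, Or.inr (Or.inl rfl)⟩

theorem IterT.mem_PT {x : ℝ × ℝ} {n : ℕ} (hn : 0 < n) (hx : x ∈ P1 s) (h : IterT s n x x) :
    x ∈ PT s := by
  obtain ⟨n, rfl⟩ := Nat.exists_eq_succ_of_ne_zero hn.ne'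
  obtain ⟨r, hr, h⟩ := h
  obtain ⟨O, hf, h1, h2, h3⟩ := hr.exists_orbit hx
  obtain ⟨m, hm, g1, g2, -⟩ := mapT_iff.1 h
  refine ⟨O ∪ {m, -m}, hf.union (by simp), Or.inl h1, ?_⟩
  rintro z (hz | rfl | rfl)
  · obtain ⟨a1, a2, a3⟩ := h3 z hz
    refine ⟨a1, Or.inl a2, ?_⟩
    rcases a3 with rfl | rfl | ⟨w, hw, hg⟩
    · exact ⟨m, by simp, g1⟩
    · exact ⟨-m, by simp, g1.neg⟩
    · exact ⟨w, Or.inl hw, hg⟩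
  · exact ⟨hm, by simp, -x, Or.inl (h3 x h1).2.1, g2⟩
  · exact ⟨neg_mem_P1 hm, by simp, x, Or.inl h1, by simpa using g2.neg⟩

/-- The similarity from the rescaled parallelogram to `F₁`. -/
def unscale (s : ℝ) (P : ℝ × ℝ) : ℝ × ℝ := (2 * s * P.1 - 1 - s, 2 * s * P.2 - s)

/-- The inverse of `unscale`. -/
def rescale (s : ℝ) (p : ℝ × ℝ) : ℝ × ℝ := ((p.1 + 1 + s) / (2 * s), (p.2 + s) / (2 * s))

theorem unscale_rescale (hs : 0 < s) (p : ℝ × ℝ) : unscale s (rescale s p) = p := by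
  ext <;> simp only [unscale, rescale] <;> field_simp <;> ring

theorem rescale_unscale (hs : 0 < s) (p : ℝ × ℝ) : rescale s (unscale s p) = p := by
  ext <;> simp only [unscale, rescale] <;> field_simp <;> ring

theorem unscale_mem_P1 (hs : 0 < s) {P : ℝ × ℝ} :
    unscale s P ∈ P1 s ↔ P ∈ strip (1 / (2 * s)) := by
  have e : 2 * s * (2 * (1 / (2 * s))) = 2 := by field_simp
  have h2 : 0 < 2 * s := by positivity
  constructor
  · rintro ⟨h1, h2, h3, h4⟩
    simp only [unscale] at *
    refine ⟨?_, ?_, ?_, ?_⟩ <;> refine lt_of_mul_lt_mul_left (a := 2 * s) ?_ (by positivity) <;>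
      linarith
  · rintro ⟨h1, h2, h3, h4⟩
    have g1 := mul_lt_mul_of_pos_left h1 (by positivity : 0 < 2 * s)
    have g2 := mul_lt_mul_of_pos_left h2 (by positivity : 0 < 2 * s)
    have g3 := mul_lt_mul_of_pos_left h3 (by positivity : 0 < 2 * s)
    have g4 := mul_lt_mul_of_pos_left h4 (by positivity : 0 < 2 * s)
    refine ⟨?_, ?_, ?_, ?_⟩ <;> simp only [unscale] <;> linarith

theorem unscale_nu (hs : 0 < s) (P : ℝ × ℝ) : unscale s (nu (1 / (2 * s)) P) = -unscale s P := by
  ext <;> simp only [unscale, nu, Prod.fst_neg, Prod.snd_neg] <;> field_simp <;> ring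

theorem GS_unscale (hs : 0 < s) {P Q : ℝ × ℝ} :
    GS s (unscale s P) (unscale s Q) ↔ GRel (1 / (2 * s)) P Q := by
  have e : 2 * s * (1 / (2 * s)) = 1 := by field_simp
  have h2 : 2 * s ≠ 0 := by positivity
  simp only [GS, GRel, unscale]
  constructor
  · rintro ⟨m, n, h1, h2'⟩
    refine ⟨m, -n, mul_left_cancel₀ h2 ?_, mul_left_cancel₀ h2 ?_⟩ <;> push_cast
    · linear_combination h2' - e
    · linear_combination -h1 - (1 - 2 * (m : ℝ)) * e
  · rintro ⟨m, n, h1, h2'⟩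
    refine ⟨m, -n, ?_, ?_⟩ <;> push_cast
    · linear_combination -(2 * s) * h2' - (1 - 2 * (m : ℝ)) * e
    · linear_combination (2 * s) * h1 + e

theorem unscale_mem_PT (hs : 0 < s) {P : ℝ × ℝ} :
    unscale s P ∈ PT s ↔ P ∈ PM (1 / (2 * s)) := by
  constructor
  · rintro ⟨O, hf, hP, hO⟩
    refine ⟨rescale s '' O, hf.image _, ⟨_, hP, rescale_unscale hs P⟩, ?_⟩
    rintro _ ⟨z, hz, rfl⟩
    obtain ⟨h1, h2, w, hw, h3⟩ := hO z hz
    refine ⟨(unscale_mem_P1 hs).1 (by rwa [unscale_rescale hs]), ⟨_, h2, ?_⟩, _, ⟨w, hw, rfl⟩,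
      (GS_unscale hs).1 (by rwa [unscale_rescale hs, unscale_rescale hs])⟩
    rw [← rescale_unscale hs (nu _ _), unscale_nu hs, unscale_rescale hs]
  · rintro ⟨O, hf, hP, hO⟩
    refine ⟨unscale s '' O, hf.image _, ⟨_, hP, rfl⟩, ?_⟩
    rintro _ ⟨z, hz, rfl⟩
    obtain ⟨h1, h2, w, hw, h3⟩ := hO z hz
    exact ⟨(unscale_mem_P1 hs).2 h1, ⟨_, h2, unscale_nu hs z⟩, _, ⟨w, hw, rfl⟩,
      (GS_unscale hs).2 h3⟩

theorem cleanMap_unscale (hs : 0 < s) :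
    CleanMap ((2 * s) ^ 2) (unscale s) (PM (1 / (2 * s))) univ (PT s) univ :=
  ⟨⟨2 * s, 0, -1 - s, -s, 1, by norm_num, by positivity, by ring,
    fun p => by ext <;> simp only [unscale] <;> ring⟩, isOpen_univ, fun _ _ => mem_univ _,
    fun _ _ => mem_univ _, fun _ _ => (unscale_mem_PT hs).symm⟩

theorem GS.left_unique (hs : 0 < s) {p p' q : ℝ × ℝ} (h : GS s p q) (h' : GS s p' q)
    (hp : p ∈ P1 s) (hp' : p' ∈ P1 s) : p = p' := by
  rw [← unscale_rescale hs p, ← unscale_rescale hs p', ← unscale_rescale hs q] at *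
  rw [GS_unscale hs] at h h'
  rw [unscale_mem_P1 hs] at hp hp'
  rw [h.left_unique h' hp hp']

theorem exists_iterT_of_mem_PT (hs : 0 < s) {x : ℝ × ℝ} (hx : x ∈ PT s) :
    ∃ n, 0 < n ∧ IterT s n x x := by
  obtain ⟨O, hf, hxO, hO⟩ := hx
  have hP : ∀ p ∈ O, p ∈ P1 s := fun p hp => (hO p hp).1
  have hN : ∀ p ∈ O, -p ∈ O := fun p hp => (hO p hp).2.1
  have hG : ∀ p ∈ O, ∃ q ∈ O, GS s p q := fun p hp => (hO p hp).2.2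
  choose! f hfO hfG using hG
  have hinj : ∀ p ∈ O, ∀ q ∈ O, f p = f q → p = q := fun p hp q hq he =>
    (hfG p hp).left_unique hs (he ▸ hfG q hq) (hP p hp) (hP q hq)
  let T : O → O := fun p => ⟨-f (f p), hN _ (hfO _ (hfO _ p.2))⟩
  have hT : Function.Injective T := fun p q h => by
    have h1 : f (f p) = f (f q) := neg_injective (congrArg Subtype.val h)
    exact Subtype.ext (hinj _ p.2 _ q.2 (hinj _ (hfO _ p.2) _ (hfO _ q.2) h1))
  have hmap : ∀ p : O, MapT s p (T p) := fun p => mapT_iff.2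
    ⟨f p, hP _ (hfO _ p.2), hfG _ p.2, by
      simpa [T] using hfG _ (hfO _ p.2), hP _ (T p).2⟩
  have hit : ∀ n : ℕ, IterT s n x (T^[n] ⟨x, hxO⟩ : O) := by
    intro n
    induction n with
    | zero => rfl
    | succ n ih =>
      rw [Function.iterate_succ_apply']
      exact ⟨_, ih, hmap _⟩
  have : Finite O := hf
  obtain ⟨n, hn, h⟩ := Function.mem_periodicPts.1 (hT.mem_periodicPts ⟨x, hxO⟩)
  refine ⟨n, hn, ?_⟩
  have := hit n
  rwa [h.eq] at this

end Dynamics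

/-- The affine function with coefficients `l`. -/
def affF (l : ℝ × ℝ × ℝ) (y : ℝ × ℝ) : ℝ := l.1 * y.1 + l.2.1 * y.2 + l.2.2

theorem continuous_affF (l : ℝ × ℝ × ℝ) : Continuous (affF l) := by
  unfold affF; fun_prop

theorem affF_combo (l : ℝ × ℝ × ℝ) (x y : ℝ × ℝ) {a b : ℝ} (h : a + b = 1) :
    affF l (a • x + b • y) = a * affF l x + b * affF l y := by
  simp only [affF, Prod.fst_add, Prod.snd_add, Prod.smul_fst, Prod.smul_snd, smul_eq_mul]
  linear_combination -l.2.2 * h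

/-- Open polygonal regions: finite intersections of open half planes. -/
def IsPolyRegion (S : Set (ℝ × ℝ)) : Prop :=
  ∃ L : Set (ℝ × ℝ × ℝ), L.Finite ∧ S = {y | ∀ l ∈ L, 0 < affF l y}

namespace IsPolyRegion

variable {S S' : Set (ℝ × ℝ)}

theorem inter (h : IsPolyRegion S) (h' : IsPolyRegion S') : IsPolyRegion (S ∩ S') := by
  obtain ⟨L, hL, rfl⟩ := h
  obtain ⟨L', hL', rfl⟩ := h'
  refine ⟨L ∪ L', hL.union hL', ?_⟩
  ext y
  simp only [mem_inter_iff, mem_ofPred_eq, mem_union, or_imp, forall_and]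

theorem preimage_add (h : IsPolyRegion S) (v : ℝ × ℝ) : IsPolyRegion {y | y + v ∈ S} := by
  obtain ⟨L, hL, rfl⟩ := h
  refine ⟨(fun l : ℝ × ℝ × ℝ => (l.1, l.2.1, l.2.2 + l.1 * v.1 + l.2.1 * v.2)) '' L,
    hL.image _, ?_⟩
  ext y
  simp only [mem_ofPred_eq, forall_mem_image]
  refine forall₂_congr fun l _ => ?_
  rw [show affF l (y + v) = affF (l.1, l.2.1, l.2.2 + l.1 * v.1 + l.2.1 * v.2) y by
    simp only [affF, Prod.fst_add, Prod.snd_add]; ring]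

protected theorem isOpen (h : IsPolyRegion S) : IsOpen S := by
  obtain ⟨L, hL, rfl⟩ := h
  have : {y | ∀ l ∈ L, 0 < affF l y} = ⋂ l ∈ L, {y | 0 < affF l y} := by ext; simp
  rw [this]
  exact hL.isOpen_biInter fun l _ => isOpen_lt continuous_const (continuous_affF l)

protected theorem convex (h : IsPolyRegion S) : Convex ℝ S := by
  obtain ⟨L, hL, rfl⟩ := h
  intro x hx y hy a b ha hb hab l hl
  rw [affF_combo l x y hab]
  rcases ha.eq_or_lt with rfl | ha
  · obtain rfl : b = 1 := by linarith
    simpa using hy l hl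
  · exact add_pos_of_pos_of_nonneg (mul_pos ha (hx l hl)) (mul_nonneg hb (hy l hl).le)

end IsPolyRegion

theorem closure_poly {L : Set (ℝ × ℝ × ℝ)} (hne : {y | ∀ l ∈ L, 0 < affF l y}.Nonempty) :
    closure {y | ∀ l ∈ L, 0 < affF l y} = {y | ∀ l ∈ L, 0 ≤ affF l y} := by
  refine Subset.antisymm (closure_minimal (fun y hy l hl => (hy l hl).le) ?_) fun y hy => ?_
  · have : {y | ∀ l ∈ L, 0 ≤ affF l y} = ⋂ l ∈ L, {y | 0 ≤ affF l y} := by ext; simp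
    rw [this]
    exact isClosed_biInter fun l _ => isClosed_le continuous_const (continuous_affF l)
  · obtain ⟨x, hx⟩ := hne
    have h1 : Tendsto (fun t : ℝ => (1 - t) • y + t • x) (𝓝[>] 0) (𝓝 y) := by
      have : Continuous fun t : ℝ => (1 - t) • y + t • x := by fun_prop
      have := (this.tendsto 0).mono_left (nhdsWithin_le_nhds (s := Ioi 0))
      simpa using this
    refine mem_closure_of_tendsto h1 ?_
    filter_upwards [Ioo_mem_nhdsGT (zero_lt_one' ℝ)] with t ht l hl
    rw [affF_combo l y x (by ring)]
    exact add_pos_of_nonneg_of_pos (mul_nonneg (by linarith [ht.2]) (hy l hl))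
      (mul_pos ht.1 (hx l hl))

theorem finite_extremePoints_poly {L : Set (ℝ × ℝ × ℝ)} (hL : L.Finite) :
    (extremePoints ℝ {y : ℝ × ℝ | ∀ l ∈ L, 0 ≤ affF l y}).Finite := by
  refine Set.Finite.of_injOn (f := fun e => {l ∈ L | affF l e = 0}) (t := 𝒫 L)
    (fun e _ => sep_subset _ _) (fun e he e' he' h => ?_) hL.powerset
  have hev : ∀ᶠ t in 𝓝 (0 : ℝ), ∀ l ∈ L, 0 ≤ affF l ((1 - t) • e + t • e') := by
    refine (eventually_all_finite hL).2 fun l hl => ?_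
    rcases (he.1 l hl).eq_or_lt with h0 | h0
    · have h1 : l ∈ {l ∈ L | affF l e' = 0} := by
        have h2 : l ∈ {l ∈ L | affF l e = 0} := ⟨hl, h0.symm⟩
        exact (congrArg (fun A => l ∈ A) h).mp h2
      filter_upwards with t
      rw [affF_combo l e e' (by ring), ← h0, h1.2]
      simp
    · have hc : Continuous fun t : ℝ => affF l ((1 - t) • e + t • e') :=
        (continuous_affF l).comp (by fun_prop)
      have h2 := hc.tendsto 0
      simp only [sub_zero, one_smul, zero_smul, add_zero] at h2
      exact (h2.eventually (lt_mem_nhds h0)).mono fun t ht => le_of_lt ht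
  obtain ⟨t, ht, ht0⟩ := ((hev.filter_mono (nhdsWithin_le_nhds (s := Iio 0))).and
    self_mem_nhdsWithin).exists
  have ht0 : t < 0 := ht0
  have hseg : e ∈ openSegment ℝ ((1 - t) • e + t • e') e' := by
    refine ⟨1 / (1 - t), -t / (1 - t), by apply div_pos <;> linarith,
      by apply div_pos <;> linarith, ?_, ?_⟩
    · have : 1 - t ≠ 0 := by linarith
      field_simp; ring
    · have : 1 - t ≠ 0 := by linarith
      ext <;> simp only [Prod.fst_add, Prod.snd_add, Prod.smul_fst, Prod.smul_snd, smul_eq_mul] <;>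
        field_simp <;> ring
  exact ((mem_extremePoints.1 he).2 _ ht _ he'.1 hseg).2.symm

theorem IsPolyRegion.isConvexPolygon_closure {S : Set (ℝ × ℝ)} (h : IsPolyRegion S) (hne : S.Nonempty)
    (hb : Bornology.IsBounded S) : IsConvexPolygon (closure S) := by
  have hcv := h.convex.closure
  have hop := h.isOpen
  obtain ⟨L, hL, rfl⟩ := h
  have hfin := finite_extremePoints_poly hL
  rw [← closure_poly hne] at hfin
  have hK := Metric.isCompact_of_isClosed_isBounded isClosed_closure hb.closure
  refine ⟨⟨hfin.toFinset, ?_⟩, hne.mono (interior_maximal subset_closure hop)⟩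
  rw [hfin.coe_toFinset, ← (hfin.isCompact_convexHull ℝ).isClosed.closure_eq,
    closure_convexHull_extremePoints hK hcv]

theorem IsPolyRegion.interior_closure {S : Set (ℝ × ℝ)} (h : IsPolyRegion S) (hne : S.Nonempty) :
    interior (closure S) = S := by
  rw [h.convex.interior_closure_eq_interior_of_nonempty_interior (by rwa [h.isOpen.interior_eq]),
    h.isOpen.interior_eq]

section Pieces

variable {s : ℝ}

theorem isPoly_P1 (s : ℝ) : IsPolyRegion (P1 s) := by
  refine ⟨{(0, 1, s), (0, -1, s), (-1, 1, 1), (1, -1, 1)}, by simp, ?_⟩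
  ext y
  simp only [mem_insert_iff, mem_singleton_iff, forall_eq_or_imp, forall_eq, affF, mem_ofPred_eq,
    P1]
  constructor
  · rintro ⟨h1, h2, h3, h4⟩
    refine ⟨?_, ?_, ?_, ?_⟩ <;> linarith
  · rintro ⟨h1, h2, h3, h4⟩
    refine ⟨?_, ?_, ?_, ?_⟩ <;> linarith

theorem isPoly_P2 (s : ℝ) : IsPolyRegion (P2 s) := by
  refine ⟨{(1, 0, s), (-1, 0, s), (1, 1, 1), (-1, -1, 1)}, by simp, ?_⟩
  ext y
  simp only [mem_insert_iff, mem_singleton_iff, forall_eq_or_imp, forall_eq, affF, mem_ofPred_eq,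
    P2]
  constructor
  · rintro ⟨h1, h2, h3, h4⟩
    refine ⟨?_, ?_, ?_, ?_⟩ <;> linarith
  · rintro ⟨h1, h2, h3, h4⟩
    refine ⟨?_, ?_, ?_, ?_⟩ <;> linarith

theorem isCompact_F1 (s : ℝ) : IsCompact (F1 s) := by
  have : F1 s = (fun z : ℝ × ℝ => (2 * z.1 + 2 * s * z.2, 2 * s * z.2)) ''
      (Icc (-(1 : ℝ) / 2) (1 / 2) ×ˢ Icc (-(1 : ℝ) / 2) (1 / 2)) := by
    ext p
    constructor
    · rintro ⟨a, b, ha, hb, rfl⟩; exact ⟨(a, b), ⟨ha, hb⟩, rfl⟩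
    · rintro ⟨⟨a, b⟩, ⟨ha, hb⟩, rfl⟩; exact ⟨a, b, ha, hb, rfl⟩
  rw [this]
  exact (isCompact_Icc.prod isCompact_Icc).image (by fun_prop)

theorem isCompact_F2 (s : ℝ) : IsCompact (F2 s) :=
  (isCompact_F1 s).image (by unfold rotQ; fun_prop)

theorem zero_mem_P1 (hs : 0 < s) : (0 : ℝ × ℝ) ∈ P1 s := by
  refine ⟨?_, ?_, ?_, ?_⟩ <;> simp [hs]

theorem interior_F1 (hs : 0 < s) : interior (F1 s) = P1 s := by
  refine Subset.antisymm ?_ (interior_maximal (P1_subset_F1 hs) (isPoly_P1 s).isOpen)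
  rw [← (isPoly_P1 s).interior_closure ⟨0, zero_mem_P1 hs⟩]
  refine interior_mono fun y hy => ?_
  obtain ⟨L, hL, e⟩ := isPoly_P1 s
  refine mem_closure_of_tendsto (f := fun t : ℝ => (1 - t) • y) (b := 𝓝[>] 0) ?_ ?_
  · have : Continuous fun t : ℝ => (1 - t) • y := by fun_prop
    simpa using (this.tendsto 0).mono_left (nhdsWithin_le_nhds (s := Ioi 0))
  · filter_upwards [Ioo_mem_nhdsGT (zero_lt_one' ℝ)] with t ht
    obtain ⟨h1, h2, h3, h4⟩ := (mem_F1 hs).1 hy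
    obtain ⟨t0, t1⟩ := ht
    refine ⟨?_, ?_, ?_, ?_⟩ <;> simp only [Prod.smul_fst, Prod.smul_snd, smul_eq_mul] <;> nlinarith

theorem IterT.exists_poly (hs : 0 < s) {p : ℝ × ℝ} (hp : p ∈ P1 s) :
    ∀ {n : ℕ} {q : ℝ × ℝ}, IterT s n p q → ∃ C, IsPolyRegion C ∧ p ∈ C ∧ C ⊆ P1 s ∧
      (∀ y ∈ C, IterT s n y (y + (q - p))) ∧
      ∀ y ∈ closure C, y ∈ P1 s → ∀ q', IterT s n y q' → y ∈ C ∧ q' = y + (q - p)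
  | 0, q, h => by
    obtain rfl : p = q := h
    refine ⟨P1 s, isPoly_P1 s, hp, Subset.rfl, fun y _ => ?_, fun y _ hy q' h => ⟨hy, ?_⟩⟩
    · rw [sub_self, add_zero]; rfl
    · rw [sub_self, add_zero]; exact h.symm
  | n + 1, q, ⟨r, hr, m, h1, h2, h3, h4⟩ => by
    obtain ⟨C, hC, hpC, hCP, hit, hcl⟩ := IterT.exists_poly hs hp hr
    have hc : ∀ v : ℝ × ℝ, Continuous fun y : ℝ × ℝ => y + v := fun v => by fun_prop
    refine ⟨C ∩ ({y | y + (m - p) ∈ P2 s} ∩ {y | y + (q - p) ∈ P1 s}),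
      hC.inter (((isPoly_P2 s).preimage_add _).inter ((isPoly_P1 s).preimage_add _)),
      ⟨hpC, by simpa using h1, by simpa using h3⟩, fun y hy => hCP hy.1, ?_, ?_⟩
    · rintro y ⟨hy1, hy2, hy3⟩
      refine ⟨_, hit y hy1, _, hy2, ?_, hy3, ?_⟩
      · rwa [show y + (m - p) - (y + (r - p)) = m - r by abel]
      · rwa [show y + (q - p) - (y + (m - p)) = q - m by abel]
    · rintro y hy hyP q' ⟨r', hr', m', h1', h2', h3', h4'⟩
      have hyC := closure_mono inter_subset_left hy
      have hy2 : y + (m - p) ∈ F2 s := by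
        have := closure_minimal (t := (fun y => y + (m - p)) ⁻¹' F2 s)
          (fun z hz => P2_subset_F2 hs hz) ((isCompact_F2 s).isClosed.preimage (hc _))
        exact this (closure_mono (inter_subset_right.trans inter_subset_left) hy)
      have hy3 : y + (q - p) ∈ F1 s := by
        have := closure_minimal (t := (fun y => y + (q - p)) ⁻¹' F1 s)
          (fun z hz => P1_subset_F1 hs hz) ((isCompact_F1 s).isClosed.preimage (hc _))
        exact this (closure_mono (inter_subset_right.trans inter_subset_right) hy)
      obtain ⟨g1, rfl⟩ := hcl y hyC hyP r' hr'
      obtain rfl : y + (m - p) = m' := eq_of_mem_P2 hs h2'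
        (by rwa [show y + (m - p) - (y + (r - p)) = m - r by abel]) h1' hy2
      obtain rfl : y + (q - p) = q' := eq_of_mem_P1 hs h4'
        (by rwa [show y + (q - p) - (y + (m - p)) = q - m by abel]) h3' hy3
      exact ⟨⟨g1, h1', h3'⟩, rfl⟩

theorem IterT.exists_partial {p : ℝ × ℝ} {m : ℕ} :
    ∀ {n : ℕ} {q : ℝ × ℝ}, IterT s (m + n) p q → ∃ r, IterT s m p r
  | 0, _, h => ⟨_, h⟩
  | _ + 1, _, ⟨_, ht, _⟩ => IterT.exists_partial ht

theorem exists_poly_component (hs : 0 < s) {x : ℝ × ℝ} (hx : x ∈ PT s) :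
    ∃ C, connectedComponentIn (PT s) x = C ∧ IsPolyRegion C ∧ x ∈ C ∧ C ⊆ PT s ∧
      closure C ∩ PT s ⊆ C ∧ ∃ n, 0 < n ∧ ∀ y ∈ C, IterT s n y y := by
  obtain ⟨n, hn, hit⟩ := exists_iterT_of_mem_PT hs hx
  obtain ⟨C, hC, hxC, hCP, h1, h2⟩ := hit.exists_poly hs (PT_subset_P1 hx)
  simp only [sub_self, add_zero] at h1 h2
  have hCT : C ⊆ PT s := fun y hy => (h1 y hy).mem_PT hn (hCP hy)
  have hcl : closure C ∩ PT s ⊆ C := by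
    rintro y ⟨hy, hyT⟩
    obtain ⟨m, hm, hym⟩ := exists_iterT_of_mem_PT hs hyT
    have h3 := hym.mul n
    obtain ⟨k, hk⟩ := Nat.exists_eq_add_of_le (Nat.le_mul_of_pos_left n hm)
    rw [hk] at h3
    obtain ⟨q', hq'⟩ := h3.exists_partial
    exact (h2 y hy (PT_subset_P1 hyT) q' hq').1
  refine ⟨C, Subset.antisymm ?_ ?_, hC, hxC, hCT, hcl, n, hn, h1⟩
  · refine isPreconnected_connectedComponentIn.subset_of_closure_inter_subset hC.isOpen
      ⟨x, mem_connectedComponentIn hx, hxC⟩ ?_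
    exact fun y hy => hcl ⟨hy.1, connectedComponentIn_subset _ _ hy.2⟩
  · exact hC.convex.isPreconnected.subset_connectedComponentIn hxC hCT

theorem mem_PT_or_of_mem_interior (hs : 0 < s) {Q : Set (ℝ × ℝ)} (hQ : Q ⊆ F1 s) {n : ℕ}
    (hn : 0 < n) (h : ∀ p ∈ interior Q, IterRel s n p p) {y : ℝ × ℝ} (hy : y ∈ interior Q) :
    y ∈ P1 s ∧ (y ∈ PT s ∨ y ∈ F2 s \ P2 s) := by
  have hyP : y ∈ P1 s := by rw [← interior_F1 hs]; exact interior_mono hQ hy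
  refine ⟨hyP, ?_⟩
  rcases (h y hy).iterT_or_mem hs hyP with h | h
  · exact Or.inl (h.mem_PT hn hyP)
  · exact Or.inr h

theorem IsConvexPolygon.isClosed {P : Set (ℝ × ℝ)} (h : IsConvexPolygon P) : IsClosed P := by
  obtain ⟨⟨V, rfl⟩, -⟩ := h
  exact (V.finite_toSet.isCompact_convexHull ℝ).isClosed

theorem IsConvexPolygon.convex {P : Set (ℝ × ℝ)} (h : IsConvexPolygon P) : Convex ℝ P := by
  obtain ⟨⟨V, rfl⟩, -⟩ := h
  exact convex_convexHull ℝ _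

theorem IsConvexPolygon.closure_interior {P : Set (ℝ × ℝ)} (h : IsConvexPolygon P) :
    closure (interior P) = P := by
  rw [h.convex.closure_interior_eq_closure_of_nonempty_interior h.2, h.isClosed.closure_eq]

theorem closure_component_mem_tiles (hs : 0 < s) {x : ℝ × ℝ} (hx : x ∈ PT s)
    (h : Disjoint (closure (connectedComponentIn (PT s) x)) (F2 s \ P2 s)) :
    closure (connectedComponentIn (PT s) x) ∈ tiles s := by
  obtain ⟨C, e, hC, hxC, hCT, hcl, n, hn, hit⟩ := exists_poly_component hs hx
  rw [e] at h ⊢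
  have hCF : C ⊆ F1 s := hCT.trans (PT_subset_P1.trans (P1_subset_F1 hs))
  have hb : Bornology.IsBounded C := (isCompact_F1 s).isBounded.subset hCF
  refine ⟨hC.isConvexPolygon_closure ⟨x, hxC⟩ hb,
    closure_minimal hCF (isCompact_F1 s).isClosed, ⟨n, hn, ?_⟩, ?_⟩
  · rw [hC.interior_closure ⟨x, hxC⟩]
    exact fun y hy => (hit y hy).iterRel hs (PT_subset_P1 (hCT hy))
  · rintro Q hQ hQF ⟨m, hm, hper⟩ hCQ
    refine Subset.antisymm hCQ ?_
    rw [← hQ.closure_interior]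
    refine closure_mono (hQ.convex.interior.isPreconnected.subset_of_closure_inter_subset
      hC.isOpen ⟨x, interior_maximal (subset_closure.trans hCQ) hC.isOpen hxC, hxC⟩ ?_)
    rintro y ⟨hy1, hy2⟩
    rcases (mem_PT_or_of_mem_interior hs hQF hm hper hy2).2 with h1 | h1
    · exact hcl ⟨hy1, h1⟩
    · exact absurd h1 (disjoint_left.1 h hy1)

end Pieces

/-- Near `p`, the set `S` is closed under dilations about `p` with ratio in `[1, 2]`. -/
def LocConic (p : ℝ × ℝ) (S : Set (ℝ × ℝ)) : Prop :=
  ∀ᶠ x in 𝓝 p, ∀ t ∈ Icc (1 : ℝ) 2, x ∈ S → AffineMap.homothety p t x ∈ S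

theorem affF_homothety (l : ℝ × ℝ × ℝ) (p x : ℝ × ℝ) (t : ℝ) :
    affF l (AffineMap.homothety p t x) = affF l p + t * (affF l x - affF l p) := by
  simp only [affF, AffineMap.homothety_apply, vsub_eq_sub, vadd_eq_add, Prod.fst_add, Prod.snd_add,
    Prod.smul_fst, Prod.smul_snd, Prod.fst_sub, Prod.snd_sub, smul_eq_mul]
  ring

theorem eventually_affF_homothety (p : ℝ × ℝ) (l : ℝ × ℝ × ℝ) : ∀ᶠ x in 𝓝 p,
    ∀ t ∈ Icc (1 : ℝ) 2, (0 < affF l x → 0 < affF l (AffineMap.homothety p t x)) ∧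
      (0 ≤ affF l x → 0 ≤ affF l (AffineMap.homothety p t x)) := by
  have hc := (continuous_affF l).tendsto p
  rcases lt_trichotomy (affF l p) 0 with h | h | h
  · filter_upwards [hc.eventually (gt_mem_nhds h)] with x hx t ht
    constructor <;> intro h' <;> linarith
  · filter_upwards with x t ht
    rw [affF_homothety, h, zero_add, sub_zero]
    have : 0 < t := by linarith [ht.1]
    exact ⟨fun h' => by positivity, fun h' => by positivity⟩
  · filter_upwards [hc.eventually (lt_mem_nhds (half_lt_self h))] with x hx t ht
    have : 0 < affF l (AffineMap.homothety p t x) := by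
      rw [affF_homothety]
      nlinarith [ht.1, ht.2]
    exact ⟨fun _ => this, fun _ => this.le⟩

theorem IsPolyRegion.locConic {S : Set (ℝ × ℝ)} (h : IsPolyRegion S) (p : ℝ × ℝ) :
    LocConic p S := by
  obtain ⟨L, hL, rfl⟩ := h
  filter_upwards [(eventually_all_finite hL).2 fun l _ => eventually_affF_homothety p l]
    with x hx t ht hxS l hl
  exact (hx l hl t ht).1 (hxS l hl)

theorem locConic_closed_poly {L : Set (ℝ × ℝ × ℝ)} (hL : L.Finite) (p : ℝ × ℝ) :
    LocConic p {y | ∀ l ∈ L, 0 ≤ affF l y} := by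
  filter_upwards [(eventually_all_finite hL).2 fun l _ => eventually_affF_homothety p l]
    with x hx t ht hxS l hl
  exact (hx l hl t ht).2 (hxS l hl)

section Assembly

variable {s : ℝ}

theorem F1_eq_poly (hs : 0 < s) : F1 s = {y | ∀ l ∈ ({(0, 1, s), (0, -1, s), (-1, 1, 1),
    (1, -1, 1)} : Set (ℝ × ℝ × ℝ)), 0 ≤ affF l y} := by
  ext y
  simp only [mem_F1 hs, mem_insert_iff, mem_singleton_iff, forall_eq_or_imp, forall_eq, affF,
    mem_ofPred_eq]
  constructor
  · rintro ⟨h1, h2, h3, h4⟩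
    refine ⟨?_, ?_, ?_, ?_⟩ <;> linarith
  · rintro ⟨h1, h2, h3, h4⟩
    refine ⟨?_, ?_, ?_, ?_⟩ <;> linarith

theorem F2_eq_poly (hs : 0 < s) : F2 s = {y | ∀ l ∈ ({(1, 0, s), (-1, 0, s), (1, 1, 1),
    (-1, -1, 1)} : Set (ℝ × ℝ × ℝ)), 0 ≤ affF l y} := by
  ext y
  simp only [mem_F2 hs, mem_insert_iff, mem_singleton_iff, forall_eq_or_imp, forall_eq, affF,
    mem_ofPred_eq]
  constructor
  · rintro ⟨h1, h2, h3, h4⟩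
    refine ⟨?_, ?_, ?_, ?_⟩ <;> linarith
  · rintro ⟨h1, h2, h3, h4⟩
    refine ⟨?_, ?_, ?_, ?_⟩ <;> linarith

theorem convex_F1 (hs : 0 < s) : Convex ℝ (F1 s) := by
  rw [F1_eq_poly hs]
  intro x hx y hy a b ha hb hab l hl
  rw [affF_combo l x y hab]
  exact add_nonneg (mul_nonneg ha (hx l hl)) (mul_nonneg hb (hy l hl))

theorem locConic_F1 (hs : 0 < s) (p : ℝ × ℝ) : LocConic p (F1 s) := by
  rw [F1_eq_poly hs]; exact locConic_closed_poly (by simp) p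

theorem locConic_F2 (hs : 0 < s) (p : ℝ × ℝ) : LocConic p (F2 s) := by
  rw [F2_eq_poly hs]; exact locConic_closed_poly (by simp) p

theorem eventually_periodic_of_not_meetsAt (hs : 0 < s) {p : ℝ × ℝ}
    (hp : ¬ MeetsAt (PT s) univ p) : ∃ k, 0 < k ∧ ∀ᶠ x in 𝓝 p, ∀ t ∈ Icc (1 : ℝ) 2,
      x ∈ P1 s → x ∈ PT s ∨ x ∈ F2 s → IterRel s k (AffineMap.homothety p t x)
        (AffineMap.homothety p t x) := by
  simp only [MeetsAt, gt_iff_lt, not_forall, not_infinite] at hp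
  obtain ⟨r, hr, hfin⟩ := hp
  have hex : ∀ N ∈ connectedComponentIn (PT s) '' (PT s ∩ univ ∩ disc p r),
      IsPolyRegion N ∧ N ⊆ PT s ∧ ∃ n, 0 < n ∧ ∀ y ∈ N, IterT s n y y := by
    rintro _ ⟨x, ⟨⟨hx, -⟩, -⟩, rfl⟩
    obtain ⟨C, e, hC, -, h1, -, h2⟩ := exists_poly_component hs hx
    rw [e]
    exact ⟨hC, h1, h2⟩
  choose! hpoly hsub n hn hit using hex
  refine ⟨∏ N ∈ hfin.toFinset, n N, Finset.prod_pos fun N hN => hn N (hfin.mem_toFinset.1 hN), ?_⟩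
  filter_upwards [(eventually_all_finite hfin).2 fun N hN => (hpoly N hN).locConic p,
    (isPoly_P1 s).locConic p, locConic_F2 hs p, (isOpen_disc p r).mem_nhds (mem_disc_self hr)]
    with x h1 h2 h3 h4 t ht hxP hx
  rcases hx with hx | hx
  · have hN := mem_image_of_mem (connectedComponentIn (PT s))
      (show x ∈ PT s ∩ univ ∩ disc p r from ⟨⟨hx, mem_univ _⟩, h4⟩)
    have h5 := h1 _ hN t ht (mem_connectedComponentIn hx)
    obtain ⟨k, hk⟩ := Finset.dvd_prod_of_mem n (hfin.mem_toFinset.2 hN)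
    rw [hk]
    exact ((hit _ hN _ h5).mul k).iterRel hs (PT_subset_P1 (hsub _ hN h5))
  · exact iterRel_self hs (h2 t ht hxP) (h3 t ht hx) _

theorem convex_cone {A : Set (ℝ × ℝ)} (hA : Convex ℝ A) (p : ℝ × ℝ) :
    Convex ℝ (⋃ t ∈ Icc (1 : ℝ) 2, AffineMap.homothety p t '' A) := by
  intro x hx y hy a b ha hb hab
  simp only [mem_iUnion, exists_prop] at hx hy ⊢
  obtain ⟨t, ht, x, hx, rfl⟩ := hx
  obtain ⟨u, hu, y, hy, rfl⟩ := hy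
  have hv1 : 1 ≤ a * t + b * u := by nlinarith [ht.1, hu.1]
  have hv2 : a * t + b * u ≤ 2 := by nlinarith [ht.2, hu.2]
  have hv : a * t + b * u ≠ 0 := by linarith
  have ht0 : 0 ≤ t := by linarith [ht.1]
  have hu0 : 0 ≤ u := by linarith [hu.1]
  refine ⟨a * t + b * u, ⟨hv1, hv2⟩, (a * t / (a * t + b * u)) • x + (b * u / (a * t + b * u)) • y,
    hA hx hy (by positivity) (by positivity) (by field_simp), ?_⟩
  ext <;> simp only [AffineMap.homothety_apply, vsub_eq_sub, vadd_eq_add, Prod.fst_add,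
    Prod.snd_add, Prod.smul_fst, Prod.smul_snd, Prod.fst_sub, Prod.snd_sub, smul_eq_mul] <;>
    field_simp
  · linear_combination (-p.1) * hab
  · linear_combination (-p.2) * hab

theorem isOpen_cone {A : Set (ℝ × ℝ)} (hA : IsOpen A) (p : ℝ × ℝ) :
    IsOpen (⋃ t ∈ Icc (1 : ℝ) 2, AffineMap.homothety p t '' A) :=
  isOpen_biUnion fun t ht => AffineMap.homothety_isOpenMap p t (by linarith [ht.1]) _ hA

theorem sqN_homothety (p x : ℝ × ℝ) :
    sqN (AffineMap.homothety p (2 : ℝ) x - p) = 4 * sqN (x - p) := by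
  simp only [sqN, AffineMap.homothety_apply, vsub_eq_sub, vadd_eq_add, Prod.fst_add, Prod.snd_add,
    Prod.smul_fst, Prod.smul_snd, Prod.fst_sub, Prod.snd_sub, smul_eq_mul]
  ring

theorem eq_of_sqN_le {p x : ℝ × ℝ} (h : sqN (x - p) ≤ 0) : x = p := by
  simp only [sqN, Prod.fst_sub, Prod.snd_sub] at h
  ext <;> nlinarith [sq_nonneg (x.1 - p.1), sq_nonneg (x.2 - p.2)]

theorem not_mapsTo_homothety {T : Set (ℝ × ℝ)} (hT : IsCompact T) (hi : (interior T).Nonempty)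
    (p : ℝ × ℝ) : ¬ MapsTo (AffineMap.homothety p (2 : ℝ)) T T := by
  intro h
  obtain ⟨z, hz, hmax⟩ := hT.exists_isMaxOn (hi.mono interior_subset)
    (f := fun x => sqN (x - p)) (continuous_sqN.comp (by fun_prop)).continuousOn
  have h1 : sqN (AffineMap.homothety p (2 : ℝ) z - p) ≤ sqN (z - p) := hmax (h hz)
  rw [sqN_homothety] at h1
  have hsub : T ⊆ {p} := fun x hx => eq_of_sqN_le (by
    have : sqN (x - p) ≤ sqN (z - p) := hmax hx
    linarith)
  have := hi.mono (interior_mono hsub)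
  rw [interior_singleton] at this
  exact this.ne_empty rfl

theorem exists_nhds_without_tile (hs : 0 < s) {p : ℝ × ℝ} (hp : ¬ MeetsAt (PT s) univ p) :
    ∃ U ∈ 𝓝 p, ∀ T ∈ tiles s, ¬ T ⊆ U := by
  obtain ⟨k, hk, hper⟩ := eventually_periodic_of_not_meetsAt hs hp
  refine ⟨_, hper.and (locConic_F1 hs p), ?_⟩
  rintro T ⟨hT, hTF, ⟨n, hn, hit⟩, hmax⟩ hTU
  have hTc : IsCompact T := (isCompact_F1 s).of_isClosed_subset hT.isClosed hTF
  refine not_mapsTo_homothety hTc hT.2 p ?_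
  obtain ⟨V, hV⟩ := hT.1
  have hVT : (V : Set (ℝ × ℝ)) ⊆ T := hV ▸ subset_convexHull ℝ _
  set f := AffineMap.homothety p (2 : ℝ) with hf
  have hfc : Continuous f := AffineMap.homothety_continuous p 2
  set U := ⋃ t ∈ Icc (1 : ℝ) 2, AffineMap.homothety p t '' interior T with hUdef
  have h2 : (2 : ℝ) ∈ Icc (1 : ℝ) 2 := ⟨by norm_num, le_rfl⟩
  have hU1 : interior T ⊆ U := fun x hx => mem_biUnion (x := (1 : ℝ)) ⟨le_rfl, by norm_num⟩
    ⟨x, hx, by simp⟩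
  have hU2 : f '' interior T ⊆ U := fun x hx => mem_biUnion (x := (2 : ℝ)) h2 hx
  have hUcv : Convex ℝ U := convex_cone hT.convex.interior p
  have hUo : IsOpen U := isOpen_cone isOpen_interior p
  have hTU1 : T ⊆ closure U := by
    rw [← hT.closure_interior]; exact closure_mono hU1
  have hTU2 : f '' T ⊆ closure U := by
    rw [← hT.closure_interior]
    exact (image_closure_subset_closure_image hfc).trans (closure_mono hU2)
  set Q := convexHull ℝ ((V : Set (ℝ × ℝ)) ∪ f '' V) with hQ
  have hTQ : T ⊆ Q := by
    rw [hV]; exact convexHull_mono subset_union_left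
  have hQU : Q ⊆ closure U := convexHull_min
    (union_subset (hVT.trans hTU1) ((image_mono hVT).trans hTU2)) hUcv.closure
  have hQi : interior Q ⊆ U := by
    have := interior_mono hQU
    rwa [hUcv.interior_closure_eq_interior_of_nonempty_interior
      (by rw [hUo.interior_eq]; exact hT.2.mono hU1), hUo.interior_eq] at this
  have hfT : f '' T ⊆ Q := by
    rw [hV, AffineMap.image_convexHull]; exact convexHull_mono subset_union_right
  have hpoly : IsConvexPolygon Q := by
    classical
    exact ⟨⟨V ∪ V.image f, by rw [Finset.coe_union, Finset.coe_image]⟩,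
      hT.2.mono (interior_mono hTQ)⟩
  have hQF : Q ⊆ F1 s := by
    refine convexHull_min (union_subset (hVT.trans hTF) ?_) (convex_F1 hs)
    rintro _ ⟨v, hv, rfl⟩
    exact (hTU (hVT hv)).2 2 h2 (hTF (hVT hv))
  have heq : T = Q := hmax Q hpoly hQF ⟨k, hk, fun y hy => ?_⟩ hTQ
  · rintro z hz
    rw [heq]
    exact hfT ⟨z, hz, rfl⟩
  · have hyU := hQi hy
    rw [hUdef] at hyU
    simp only [mem_iUnion, exists_prop] at hyU
    obtain ⟨t, ht, x, hx, rfl⟩ := hyU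
    obtain ⟨g1, g2⟩ := mem_PT_or_of_mem_interior hs hTF hn hit hx
    exact (hTU (interior_subset hx)).1 t ht g1 (g2.imp_right And.left)

theorem mem_limitSet_of_smallAt (hs : 0 < s) {q : ℝ × ℝ} (hq : SmallAt (PT s) univ q)
    (h1 : q.1 ≠ s) (h2 : q.1 ≠ -s) (h3 : q.1 + q.2 ≠ 1) (h4 : q.1 + q.2 ≠ -1) :
    q ∈ limitSet s := by
  have hF : q ∈ F1 s := by
    rw [← (isCompact_F1 s).isClosed.closure_eq, mem_closure_iff_nhds]
    intro U hU
    obtain ⟨r, hr, hrU⟩ := exists_disc_subset hU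
    obtain ⟨N, x, hx, rfl, hN⟩ := (hq r hr).nonempty
    exact ⟨x, hrU (hN (mem_connectedComponentIn hx)).2, P1_subset_F1 hs (PT_subset_P1 hx)⟩
  refine ⟨hF, fun U hU => ?_⟩
  have hW : {x : ℝ × ℝ | x.1 ≠ s ∧ x.1 ≠ -s ∧ x.1 + x.2 ≠ 1 ∧ x.1 + x.2 ≠ -1} ∈ 𝓝 q := by
    have c1 : ContinuousAt (fun x : ℝ × ℝ => x.1) q := by fun_prop
    have c2 : ContinuousAt (fun x : ℝ × ℝ => x.1 + x.2) q := by fun_prop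
    filter_upwards [c1.eventually_ne h1, c1.eventually_ne h2, c2.eventually_ne h3,
      c2.eventually_ne h4] with x a b c d
    exact ⟨a, b, c, d⟩
  obtain ⟨K, hK, hKc, hKW⟩ := exists_mem_nhds_isClosed_subset (inter_mem hU hW)
  obtain ⟨r, hr, hrK⟩ := exists_disc_subset hK
  have hinj : InjOn closure
      {N | ∃ x ∈ PT s, N = connectedComponentIn (PT s) x ∧ N ⊆ univ ∩ disc q r} := by
    rintro _ ⟨x, hx, rfl, -⟩ _ ⟨y, hy, rfl, -⟩ he
    obtain ⟨C, e, hC, hxC, -⟩ := exists_poly_component hs hx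
    obtain ⟨C', e', hC', hyC', -⟩ := exists_poly_component hs hy
    rw [e, e'] at he ⊢
    rw [← hC.interior_closure ⟨x, hxC⟩, he, hC'.interior_closure ⟨y, hyC'⟩]
  refine ((hq r hr).image hinj).mono ?_
  rintro _ ⟨_, ⟨x, hx, rfl, hN⟩, rfl⟩
  have hcl : closure (connectedComponentIn (PT s) x) ⊆ K :=
    closure_minimal (hN.trans (inter_subset_right.trans hrK)) hKc
  have hxc := subset_closure (mem_connectedComponentIn hx)
  refine ⟨closure_component_mem_tiles hs hx ?_, x, (hKW (hcl hxc)).1, hxc⟩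
  refine disjoint_left.2 fun y hy ⟨hy2, hy3⟩ => hy3 ?_
  obtain ⟨a, b, c, d⟩ := (hKW (hcl hy)).2
  obtain ⟨a', b', c', d'⟩ := (mem_F2 hs).1 hy2
  exact ⟨lt_of_le_of_ne a' (Ne.symm b), lt_of_le_of_ne b' a, lt_of_le_of_ne c' (Ne.symm d),
    lt_of_le_of_ne d' c⟩

theorem exists_limitSet_of_meetsAt (hs : s ∈ Ioo (0 : ℝ) 1) (hirr : Irrational s) {p : ℝ × ℝ}
    (hp : MeetsAt (PT s) univ p) {U : Set (ℝ × ℝ)} (hU : U ∈ 𝓝 p) :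
    ∃ q ∈ U, q ∈ limitSet s ∧ q ≠ p := by
  obtain ⟨h0, h1⟩ := hs
  have hM : 1 / 2 < 1 / (2 * s) := by
    rw [div_lt_div_iff₀ (by norm_num) (by positivity)]; linarith
  have hMirr : Irrational (1 / (2 * s)) := by
    rw [one_div, irrational_inv_iff]
    exact_mod_cast hirr.natCast_mul (m := 2) (by norm_num)
  have hsurj : unscale s '' univ = univ := by
    rw [image_univ]
    exact Function.Surjective.range_eq fun x => ⟨_, unscale_rescale h0 x⟩
  obtain ⟨P, rfl, hP⟩ := (cleanMap_unscale h0).exists_meetsAt (p := p) (by rwa [hsurj])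
  have hcont := (cleanMap_unscale h0).sim.continuous
  let pull : ℝ × ℝ × ℝ → ℝ × ℝ × ℝ := fun l =>
    (2 * s * l.1, 2 * s * l.2.1, l.2.2 - l.1 * (1 + s) - l.2.1 * s)
  have hpull : ∀ (l : ℝ × ℝ × ℝ) (x : ℝ × ℝ), (pull l).1 * x.1 + (pull l).2.1 * x.2 + (pull l).2.2
      = affF l (unscale s x) := fun l x => by simp only [pull, affF, unscale]; ring
  have h2s : 2 * s ≠ 0 := by positivity
  obtain ⟨q, hqU, hq, hlines⟩ := exists_smallAt_PM hM hMirr hP (hcont.continuousAt.preimage_mem_nhds hU)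
    (([(1, 0, -(unscale s P).1), (1, 0, -s), (1, 0, s), (1, 1, -1), (1, 1, 1)] :
      List (ℝ × ℝ × ℝ)).map pull) (by simp [pull, h0.ne'])
  simp only [List.forall_mem_map, hpull, List.forall_mem_cons, affF] at hlines
  obtain ⟨g1, g2, g3, g4, g5, -⟩ := hlines
  refine ⟨unscale s q, hqU, mem_limitSet_of_smallAt h0 ((cleanMap_unscale h0).smallAt hq)
    ?_ ?_ ?_ ?_, fun h => g1 ?_⟩
  · exact fun h => g2 (by linarith)
  · exact fun h => g3 (by linarith)
  · exact fun h => g4 (by linarith)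
  · exact fun h => g5 (by linarith)
  · rw [h]; ring

theorem exists_limitSet_of_not_meetsAt (hs : 0 < s) {p : ℝ × ℝ} (hp : p ∈ limitSet s)
    (hmeet : ¬ MeetsAt (PT s) univ p) {U : Set (ℝ × ℝ)} (hU : U ∈ 𝓝 p) :
    ∃ q ∈ U, q ∈ limitSet s ∧ q ≠ p := by
  obtain ⟨U', hU', htile⟩ := exists_nhds_without_tile hs hmeet
  obtain ⟨r, hr, hrU⟩ := exists_disc_subset (inter_mem hU hU')
  by_contra! hcon
  have hcont : Continuous fun x : ℝ × ℝ => sqN (x - p) := continuous_sqN.comp (by fun_prop)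
  have hcpt : IsCompact (F1 s ∩ {x | sqN (x - p) = r / 2}) :=
    (isCompact_F1 s).inter_right (isClosed_eq hcont continuous_const)
  have hfin : {T ∈ tiles s | ((F1 s ∩ {x | sqN (x - p) = r / 2}) ∩ T).Nonempty}.Finite := by
    refine hcpt.induction_on (p := fun S => {T ∈ tiles s | (S ∩ T).Nonempty}.Finite) ?_ ?_ ?_ ?_
    · simp
    · exact fun A B hAB hB => hB.subset fun T hT =>
        ⟨hT.1, hT.2.mono (inter_subset_inter_left _ hAB)⟩
    · refine fun A B hA hB => (hA.union hB).subset ?_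
      rintro T ⟨hT, x, hx | hx, hxT⟩
      · exact Or.inl ⟨hT, x, hx, hxT⟩
      · exact Or.inr ⟨hT, x, hx, hxT⟩
    · rintro q ⟨hqF, hq⟩
      have hq : sqN (q - p) = r / 2 := hq
      have hqd : q ∈ disc p r := show sqN (q - p) < r by linarith
      have hqp : q ≠ p := by
        rintro rfl
        simp only [sqN, sub_self, Prod.fst_zero, Prod.snd_zero] at hq
        norm_num at hq
        linarith
      by_contra! hinf
      exact hqp (hcon q (hrU hqd).1 ⟨hqF, fun W hW => hinf W (mem_nhdsWithin_of_mem_nhds hW)⟩)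
  refine hp.2 _ ((isOpen_disc p (r / 2)).mem_nhds (mem_disc_self (by positivity)))
    (hfin.subset ?_)
  rintro T ⟨hT, x, hx, hxT⟩
  have hT' : IsPeriodicTile s T := hT
  have hx : sqN (x - p) < r / 2 := hx
  obtain ⟨y, hyT, hy⟩ := not_subset.1 fun h : T ⊆ disc p r =>
    htile T hT (h.trans (hrU.trans inter_subset_right))
  have hy : r ≤ sqN (y - p) := not_lt.1 hy
  obtain ⟨z, hzT, hz⟩ := hT'.1.convex.isPreconnected.intermediate_value hxT hyT
    hcont.continuousOn ⟨hx.le, by linarith⟩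
  exact ⟨hT, z, ⟨hT'.2.1 hzT, hz⟩, hzT⟩

end Assembly

/-- For irrational `s ∈ (0,1)`, the limit set `Λ̂_s` is perfect: each of
its points is an accumulation point of the rest. -/
theorem limitSet_perfect (s : ℝ) (hs : s ∈ Ioo (0:ℝ) 1) (hirr : Irrational s) :
    ∀ p ∈ limitSet s, p ∈ closure (limitSet s \ {p}) := by
  intro p hp
  rw [mem_closure_iff_nhds]
  intro U hU
  by_cases h : MeetsAt (PT s) univ p
  · obtain ⟨q, hq, hq', hqp⟩ := exists_limitSet_of_meetsAt hs hirr h hU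
    exact ⟨q, hq, hq', hqp⟩
  · obtain ⟨q, hq, hq', hqp⟩ := exists_limitSet_of_not_meetsAt hs.1 hp h hU
    exact ⟨q, hq, hq', hqp⟩

end
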